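/- arXiv:2308.15187 — 2 statements merged into one kernel-verified Lean document; each statement's English description precedes it below -/
import Mathlib

section
/- Let Δ ⊂ ℝ³ be a 3-dimensional reflexive polytope and Δ* its dual reflexive polytope. Then the sum, over all 1-dimensional faces (edges) Θ of Δ, of the products d(Θ)·d(Θ*) equals 24, where Θ* = {y ∈ Δ* : ⟨x, y⟩ = −1 for all x ∈ Θ} is the dual edge of Δ* and where for a lattice segment S the lattice length d(S) is the number of points of ℤ³ lying on S minus 1. -/
open Finset

/-- The standard dot product on `Fin n → ℝ`. -/
def dotp {n : ℕ} (x y : Fin n → ℝ) : ℝ := ∑ i, x i * y i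

/-- A point of `ℝⁿ` all of whose coordinates are integers. -/
def IsLatticePoint {n : ℕ} (x : Fin n → ℝ) : Prop := ∀ i, ∃ m : ℤ, x i = (m : ℝ)

/-- A lattice polytope: the convex hull of finitely many lattice points. -/
def IsLatticePolytope {n : ℕ} (Δ : Set (Fin n → ℝ)) : Prop :=
  ∃ V : Set (Fin n → ℝ), V.Finite ∧ (∀ v ∈ V, IsLatticePoint v) ∧ Δ = convexHull ℝ V

/-- A (nonempty) face of a convex set `Δ`, cut out by a supporting hyperplane. -/
def IsFaceOf {n : ℕ} (F Δ : Set (Fin n → ℝ)) : Prop :=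
  F.Nonempty ∧ ∃ u : Fin n → ℝ, ∃ c : ℝ,
    (∀ x ∈ Δ, dotp x u ≤ c) ∧ F = {x ∈ Δ | dotp x u = c}

/-- The dimension of a subset of `ℝⁿ`: the dimension of its affine span. -/
noncomputable def faceDim {n : ℕ} (F : Set (Fin n → ℝ)) : ℕ :=
  Module.finrank ℝ ↥(vectorSpan ℝ F)

/-- A reflexive polytope with respect to the lattice `ℤⁿ`: a lattice polytope with `0` in its
interior, each of whose facets lies on a hyperplane `{x | ⟨x, l⟩ = -1}` with `l ∈ ℤⁿ`. -/
def IsReflexive {n : ℕ} (Δ : Set (Fin n → ℝ)) : Prop :=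
  IsLatticePolytope Δ ∧ (0 : Fin n → ℝ) ∈ interior Δ ∧
    ∀ F : Set (Fin n → ℝ), IsFaceOf F Δ → faceDim F + 1 = n →
      ∃ l : Fin n → ℤ, F ⊆ {x | dotp x (fun i => (l i : ℝ)) = -1}

/-- The dual (polar) set `Δ* = {y | ⟨x, y⟩ ≥ -1 for all x ∈ Δ}`. -/
def dualSet {n : ℕ} (Δ : Set (Fin n → ℝ)) : Set (Fin n → ℝ) :=
  {y | ∀ x ∈ Δ, -1 ≤ dotp x y}

/-- The face of `Δ*` dual to a face `Θ` of `Δ`. -/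
def dualFace {n : ℕ} (Δ Θ : Set (Fin n → ℝ)) : Set (Fin n → ℝ) :=
  {y ∈ dualSet Δ | ∀ x ∈ Θ, dotp x y = -1}

/-- The right-hand side of the Dedekind reciprocity law. -/
noncomputable def reciprocityTerm (x y : ℤ) : ℝ :=
  (x / y + y / x + (Int.gcd x y : ℝ) ^ 2 / (x * y)) - 3 * (x.sign * y.sign : ℤ)

/-- Twelve times the Dedekind sum `s(x, y)`, computed by the Euclidean algorithm. -/
noncomputable def dedekindNat (x y : ℕ) : ℝ :=
  if _h : y = 0 ∨ x % y = 0 then 0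
  else reciprocityTerm (x % y : ℕ) y - dedekindNat y (x % y)
termination_by y
decreasing_by
  push Not at _h
  exact Nat.mod_lt _ (Nat.pos_of_ne_zero _h.1)

theorem dedekindNat_mod (x y : ℕ) : dedekindNat (x % y) y = dedekindNat x y := by
  rw [dedekindNat, dedekindNat.eq_1 x y]
  simp

theorem reciprocityTerm_comm (x y : ℤ) : reciprocityTerm x y = reciprocityTerm y x := by
  unfold reciprocityTerm
  rw [Int.gcd_comm, mul_comm (x : ℝ), mul_comm x.sign]
  ring

theorem dedekindNat_add_swap_of_lt {x y : ℕ} (hx : 0 < x) (hxy : x < y) :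
    dedekindNat x y + dedekindNat y x = reciprocityTerm x y := by
  rw [dedekindNat.eq_1 x y, dif_neg]
  · simp [Nat.mod_eq_of_lt hxy]
  · rw [Nat.mod_eq_of_lt hxy]
    omega

theorem dedekindNat_add_swap {x y : ℕ} (hx : 0 < x) (hy : 0 < y) :
    dedekindNat x y + dedekindNat y x = reciprocityTerm x y := by
  rcases lt_trichotomy x y with h | rfl | h
  · exact dedekindNat_add_swap_of_lt hx h
  · have hx' : (x : ℝ) ≠ 0 := by positivity
    rw [dedekindNat]
    simp [reciprocityTerm, hx', sq, Int.sign_natCast_of_ne_zero hx.ne']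
    norm_num
  · rw [add_comm, reciprocityTerm_comm]
    exact dedekindNat_add_swap_of_lt hy h

theorem reciprocityTerm_three_term {x z : ℕ} (hx : 0 < x) (hz : 0 < z) :
    reciprocityTerm x (x + z : ℕ) + reciprocityTerm z (x + z : ℕ) = reciprocityTerm x z := by
  have hx' : (x : ℝ) ≠ 0 := by positivity
  have hz' : (z : ℝ) ≠ 0 := by positivity
  have hxz : (x : ℝ) + z ≠ 0 := by positivity
  have h1 : Int.gcd x (x + z : ℕ) = Int.gcd x z := by simp
  have h2 : Int.gcd z (x + z : ℕ) = Int.gcd x z := by simp [Nat.gcd_comm]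
  simp only [reciprocityTerm, h1, h2, Int.sign_natCast_of_ne_zero hx.ne',
    Int.sign_natCast_of_ne_zero hz.ne', Int.sign_natCast_of_ne_zero (show x + z ≠ 0 by omega)]
  push_cast
  field_simp
  ring

theorem dedekindNat_sub {x y : ℕ} (hx : 0 < x) (hxy : x < y) :
    dedekindNat (y - x) y = - dedekindNat x y := by
  obtain ⟨z, rfl⟩ := Nat.exists_eq_add_of_lt hxy
  set w := z + 1 with hw
  have hw0 : 0 < w := by omega
  rw [show x + z + 1 = x + w by omega, show x + w - x = w by omega]
  have e1 := dedekindNat_add_swap_of_lt hx (show x < x + w by omega)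
  have e2 := dedekindNat_add_swap_of_lt hw0 (show w < x + w by omega)
  have e3 := dedekindNat_add_swap hx hw0
  have e4 : dedekindNat (x + w) x = dedekindNat w x := by
    rw [← dedekindNat_mod, Nat.add_mod_left, dedekindNat_mod]
  have e5 : dedekindNat (x + w) w = dedekindNat x w := by
    rw [← dedekindNat_mod, Nat.add_mod_right, dedekindNat_mod]
  have e6 := reciprocityTerm_three_term hx hw0
  linarith

/-- The extension of `dedekindNat` to integers that is odd in each variable. -/
noncomputable def dedekind (x y : ℤ) : ℝ :=
  y.sign * dedekindNat (x % y).toNat y.natAbs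

theorem dedekind_neg_right (x y : ℤ) : dedekind x (-y) = - dedekind x y := by
  simp [dedekind]

theorem dedekind_add_mul (x y k : ℤ) : dedekind (x + k * y) y = dedekind x y := by
  simp [dedekind]

theorem dedekind_natCast (x y : ℕ) (hy : 0 < y) : dedekind x y = dedekindNat x y := by
  rw [dedekind, Int.sign_natCast_of_ne_zero hy.ne', ← Int.natCast_mod, Int.toNat_natCast,
    Int.natAbs_natCast, dedekindNat_mod]
  simp

theorem dedekind_neg_left (x y : ℤ) : dedekind (-x) y = - dedekind x y := by
  wlog hy : 0 < y generalizing y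
  · rcases eq_or_ne y 0 with rfl | h0
    · simp [dedekind]
    · have := this (-y) (by omega)
      rwa [dedekind_neg_right, dedekind_neg_right, neg_inj] at this
  have key (r : ℕ) (hr : (r : ℤ) < y) : dedekind (-r) y = - dedekind r y := by
    obtain ⟨n, rfl⟩ := Int.eq_ofNat_of_zero_le hy.le
    have hn : 0 < n := by exact_mod_cast hy
    have hrn : r < n := by exact_mod_cast hr
    rcases Nat.eq_zero_or_pos r with rfl | hr0
    · have : dedekindNat 0 n = 0 := by rw [dedekindNat]; simp
      have h0 := dedekind_natCast 0 n hn
      simp only [this, Nat.cast_zero] at h0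
      simp [h0]
    · have := dedekind_add_mul (-r) n 1
      rw [← this, show (-r + 1 * n : ℤ) = ((n - r : ℕ) : ℤ) by omega,
        dedekind_natCast _ _ hn, dedekind_natCast _ _ hn, dedekindNat_sub hr0 hrn]
  have hr := Int.emod_nonneg x hy.ne'
  have hr' := Int.emod_lt_of_pos x hy
  have hx : x = x % y + (x / y) * y := by rw [mul_comm]; exact (Int.emod_add_mul_ediv x y).symm
  have hk := key (x % y).toNat (by omega)
  rw [Int.toNat_of_nonneg hr] at hk
  rw [hx, dedekind_add_mul, ← hk, ← dedekind_add_mul (-(x % y)) y (-(x / y))]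
  congr 1
  ring

theorem reciprocityTerm_neg_left (x y : ℤ) : reciprocityTerm (-x) y = - reciprocityTerm x y := by
  simp [reciprocityTerm, neg_div, div_neg]
  ring

/-- Dedekind reciprocity. -/
theorem dedekind_add_swap {x y : ℤ} (hx : x ≠ 0) (hy : y ≠ 0) :
    dedekind x y + dedekind y x = reciprocityTerm x y := by
  wlog hx0 : 0 < x generalizing x
  · have := this (x := -x) (by omega) (by omega)
    rw [dedekind_neg_left, dedekind_neg_right, reciprocityTerm_neg_left] at this
    linarith
  wlog hy0 : 0 < y generalizing y
  · have := this (y := -y) (by omega) (by omega)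
    rw [dedekind_neg_left, dedekind_neg_right, reciprocityTerm_comm, reciprocityTerm_neg_left,
      reciprocityTerm_comm] at this
    linarith
  obtain ⟨m, rfl⟩ := Int.eq_ofNat_of_zero_le hx0.le
  obtain ⟨n, rfl⟩ := Int.eq_ofNat_of_zero_le hy0.le
  have hm : 0 < m := by exact_mod_cast hx0
  have hn : 0 < n := by exact_mod_cast hy0
  rw [dedekind_natCast _ _ hn, dedekind_natCast _ _ hm]
  exact dedekindNat_add_swap hm hn

def dot3 (a b : Fin 3 → ℤ) : ℤ := a 0 * b 0 + a 1 * b 1 + a 2 * b 2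

def cross3 (a b : Fin 3 → ℤ) : Fin 3 → ℤ :=
  ![a 1 * b 2 - a 2 * b 1, a 2 * b 0 - a 0 * b 2, a 0 * b 1 - a 1 * b 0]

/-- The determinant of the matrix with rows `a`, `b`, `c`. -/
def det3 (a b c : Fin 3 → ℤ) : ℤ := dot3 a (cross3 b c)

theorem det3_eq (a b c : Fin 3 → ℤ) :
    det3 a b c = a 0 * (b 1 * c 2 - b 2 * c 1) + a 1 * (b 2 * c 0 - b 0 * c 2)
      + a 2 * (b 0 * c 1 - b 1 * c 0) := by
  simp [det3, dot3, cross3]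

theorem det3_rotate (a b c : Fin 3 → ℤ) : det3 b c a = det3 a b c := by
  simp only [det3_eq]; ring

theorem det3_swap (a b c : Fin 3 → ℤ) : det3 b a c = -det3 a b c := by
  simp only [det3_eq]; ring

theorem det3_swap_right (a b c : Fin 3 → ℤ) :
    det3 a c b = -det3 a b c := by
  simp only [det3_eq]; ring

/-- Cramer's rule. -/
theorem det3_cramer (a b c m : Fin 3 → ℤ) :
    det3 a b c • m = det3 m b c • a + det3 m c a • b + det3 m a b • c := by
  ext i
  fin_cases i <;> simp [det3_eq] <;> ring

/-- The greatest common divisor of the coordinates. -/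
def content (v : Fin 3 → ℤ) : ℕ := Int.gcd (Int.gcd (v 0) (v 1)) (v 2)

theorem content_dvd (v : Fin 3 → ℤ) (i : Fin 3) : (content v : ℤ) ∣ v i := by
  have h := Int.gcd_dvd_left (Int.gcd (v 0) (v 1)) (v 2)
  fin_cases i
  · exact h.trans (Int.gcd_dvd_left _ _)
  · exact h.trans (Int.gcd_dvd_right _ _)
  · exact Int.gcd_dvd_right _ _

theorem dvd_content {v : Fin 3 → ℤ} {k : ℤ} (h : ∀ i, k ∣ v i) : k ∣ content v :=
  Int.dvd_coe_gcd (Int.dvd_coe_gcd (h 0) (h 1)) (h 2)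

theorem content_dvd_dot3 (u v : Fin 3 → ℤ) : (content v : ℤ) ∣ dot3 u v :=
  ((Dvd.dvd.mul_left (content_dvd v 0) _).add (Dvd.dvd.mul_left (content_dvd v 1) _)).add
    (Dvd.dvd.mul_left (content_dvd v 2) _)

theorem content_eq_of_dvd {v : Fin 3 → ℤ} {g : ℕ} (h : ∀ i, (g : ℤ) ∣ v i)
    (h' : (content v : ℤ) ∣ g) : content v = g :=
  Nat.dvd_antisymm (Int.natCast_dvd_natCast.mp h') (Int.natCast_dvd_natCast.mp (dvd_content h))

theorem exists_dot3_eq_content (v : Fin 3 → ℤ) : ∃ u, dot3 u v = content v := by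
  refine ⟨![Int.gcdA (Int.gcd (v 0) (v 1)) (v 2) * Int.gcdA (v 0) (v 1),
    Int.gcdA (Int.gcd (v 0) (v 1)) (v 2) * Int.gcdB (v 0) (v 1),
    Int.gcdB (Int.gcd (v 0) (v 1)) (v 2)], ?_⟩
  rw [content, Int.gcd_eq_gcd_ab (Int.gcd (v 0) (v 1)) (v 2)]
  conv_rhs => rw [Int.gcd_eq_gcd_ab (v 0) (v 1)]
  simp only [dot3, Matrix.cons_val]
  rw [← Int.gcd_eq_gcd_ab (v 0) (v 1)]
  have := Int.gcd_eq_gcd_ab (v 0) (v 1)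
  linear_combination (-((v 0).gcd (v 1) : ℤ).gcdA (v 2)) * this

theorem content_eq_zero {v : Fin 3 → ℤ} : content v = 0 ↔ v = 0 := by
  constructor
  · intro h
    ext i
    have := content_dvd v i
    rw [h] at this
    simpa using this
  · rintro rfl
    simp [content]

theorem content_neg (v : Fin 3 → ℤ) : content (-v) = content v := by
  simp [content]

theorem content_cross3_eq_gcd {a b c : Fin 3 → ℤ} (h : det3 a b c = 1) (p : Fin 3 → ℤ) :
    content (cross3 p c) = Int.gcd (det3 p b c) (det3 p c a) := by
  apply content_eq_of_dvd
  · intro i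
    have h1 := Int.gcd_dvd_left (det3 p b c) (det3 p c a)
    have h2 := Int.gcd_dvd_right (det3 p b c) (det3 p c a)
    have : cross3 p c i = det3 p b c * cross3 a c i + det3 p c a * cross3 b c i := by
      rw [← one_mul (cross3 p c i), ← h]
      fin_cases i <;> simp [det3_eq, cross3] <;> ring
    rw [this]
    exact (h1.mul_right _).add (h2.mul_right _)
  · apply Int.dvd_coe_gcd
    · have := content_dvd_dot3 (-b) (cross3 p c)
      convert this using 1
      simp [det3_eq, dot3, cross3]; ring
    · have := content_dvd_dot3 a (cross3 p c)
      convert this using 1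
      simp [det3_eq, dot3, cross3]; ring

/-- A primitive of the area form on the quotient by `c`. -/
noncomputable def slopeAt (p c v : Fin 3 → ℤ) : ℝ :=
  det3 c (cross3 c p) v / (det3 c p (cross3 c p) * det3 c p v)

theorem slope_sub_slope {p a b c : Fin 3 → ℤ} (h : det3 a b c = 1) (hb : det3 p b c ≠ 0)
    (ha : det3 p c a ≠ 0) : slopeAt p c b - slopeAt p c a = -1 / (det3 p b c * det3 p c a) := by
  have e1 : det3 c p b = det3 p b c := (det3_rotate _ _ _).symm
  have e2 : det3 c p a = - det3 p c a := det3_swap _ _ _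
  have hq : det3 c p (cross3 c p) ≠ 0 := by
    have hcp : cross3 c p ≠ 0 := by
      intro h0
      apply ha
      have : det3 p c a = - dot3 a (cross3 c p) := by simp [det3_eq, dot3, cross3]; ring
      simp [this, h0, dot3]
    have : det3 c p (cross3 c p) = dot3 (cross3 c p) (cross3 c p) := by
      simp [det3_eq, dot3, cross3]; ring
    rw [this]
    contrapose! hcp
    simp only [dot3] at hcp
    ext i
    fin_cases i <;> simp <;> nlinarith [sq_nonneg (cross3 c p 0), sq_nonneg (cross3 c p 1),
      sq_nonneg (cross3 c p 2)]
  have key : det3 c (cross3 c p) b * det3 c p a - det3 c (cross3 c p) a * det3 c p b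
      = det3 c p (cross3 c p) * det3 a b c := by
    simp only [det3_eq]; ring
  rw [h, e1, e2, mul_one] at key
  have keyR : (det3 c (cross3 c p) b : ℝ) * (-det3 p c a) - det3 c (cross3 c p) a * det3 p b c
      = det3 c p (cross3 c p) := by exact_mod_cast key
  have hqR : (det3 c p (cross3 c p) : ℝ) ≠ 0 := by exact_mod_cast hq
  have hbR : (det3 p b c : ℝ) ≠ 0 := by exact_mod_cast hb
  have haR : (det3 p c a : ℝ) ≠ 0 := by exact_mod_cast ha
  rw [slopeAt, slopeAt, e1, e2]
  push_cast
  field_simp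
  linear_combination -keyR

open Classical in
/-- The contribution of a primitive pair `a`, `b` to the Dedekind-sum cochain based at `p`. -/
noncomputable def edgeTerm (p a b : Fin 3 → ℤ) : ℝ :=
  if h : ∃ c, det3 a b c = 1 then
    dedekind (det3 p b h.choose) (det3 p a b) + dedekind (det3 p h.choose a) (det3 p a b)
      + (content (cross3 p b) ^ 2 * slopeAt p b a - content (cross3 p a) ^ 2 * slopeAt p a b)
  else 0

theorem edgeTerm_eq {a b c : Fin 3 → ℤ} (h : det3 a b c = 1) (p : Fin 3 → ℤ) :
    edgeTerm p a b = dedekind (det3 p b c) (det3 p a b) + dedekind (det3 p c a) (det3 p a b)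
      + (content (cross3 p b) ^ 2 * slopeAt p b a - content (cross3 p a) ^ 2 * slopeAt p a b) := by
  have hex : ∃ c, det3 a b c = 1 := ⟨c, h⟩
  rw [edgeTerm, dif_pos hex]
  set c' := hex.choose
  have h' : det3 a b c' = 1 := hex.choose_spec
  have hc' : c' = det3 c' b c • a + det3 c' c a • b + c := by
    have := det3_cramer a b c c'
    rwa [h, one_smul, show det3 c' a b = 1 by rw [← h']; exact (det3_rotate _ _ _).symm,
      one_smul] at this
  have e1 : det3 p b c' = det3 p b c + (-det3 c' b c) * det3 p a b := by
    conv_lhs => rw [hc']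
    generalize det3 c' b c = s
    generalize det3 c' c a = t
    simp only [det3_eq, Pi.add_apply, Pi.smul_apply, smul_eq_mul]; ring
  have e2 : det3 p c' a = det3 p c a + (-det3 c' c a) * det3 p a b := by
    conv_lhs => rw [hc']
    generalize det3 c' b c = s
    generalize det3 c' c a = t
    simp only [det3_eq, Pi.add_apply, Pi.smul_apply, smul_eq_mul]; ring
  rw [e1, e2, dedekind_add_mul, dedekind_add_mul]

theorem edgeTerm_swap (p a b : Fin 3 → ℤ) : edgeTerm p b a = - edgeTerm p a b := by
  have key {u v w : Fin 3 → ℤ} (h : det3 u v w = 1) : det3 v u (-w) = 1 := by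
    rw [← h]; simp only [det3_eq, Pi.neg_apply]; ring
  by_cases hex : ∃ c, det3 a b c = 1
  · obtain ⟨c, h⟩ := hex
    have e1 : det3 p a (-c) = det3 p c a := by simp only [det3_eq, Pi.neg_apply]; ring
    have e2 : det3 p (-c) b = det3 p b c := by simp only [det3_eq, Pi.neg_apply]; ring
    rw [edgeTerm_eq h, edgeTerm_eq (key h), e1, e2, det3_swap_right p a b, dedekind_neg_right,
      dedekind_neg_right]
    ring
  · rw [edgeTerm, edgeTerm, dif_neg hex, dif_neg, neg_zero]
    rintro ⟨c, h⟩
    exact hex ⟨-c, key h⟩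

/-- Whether `p` or `-p` lies in a cone, in terms of the signs of its coordinates. -/
noncomputable def signIndicator (x y z : ℤ) : ℝ :=
  if (0 < x ∧ 0 < y ∧ 0 < z) ∨ (x < 0 ∧ y < 0 ∧ z < 0) then 1 else 0

theorem four_mul_signIndicator {x y z : ℤ} (hx : x ≠ 0) (hy : y ≠ 0) (hz : z ≠ 0) :
    4 * signIndicator x y z
      = 1 + ((x.sign * y.sign + y.sign * z.sign + z.sign * x.sign : ℤ) : ℝ) := by
  unfold signIndicator
  rcases lt_or_gt_of_ne hx with hx | hx <;> rcases lt_or_gt_of_ne hy with hy | hy <;>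
    rcases lt_or_gt_of_ne hz with hz | hz <;>
    simp [hx, hy, hz, hx.not_gt, hy.not_gt, hz.not_gt, Int.sign_eq_one_of_pos,
      Int.sign_eq_neg_one_of_neg] <;> norm_num

theorem edgeTerm_triangle {p a b c : Fin 3 → ℤ} (h : det3 a b c = 1) (hx : det3 p a b ≠ 0)
    (hy : det3 p b c ≠ 0) (hz : det3 p c a ≠ 0) :
    ((det3 p a b + det3 p b c + det3 p c a : ℤ) : ℝ)
        * (1 / (det3 p a b : ℝ) + 1 / (det3 p b c : ℝ) + 1 / (det3 p c a : ℝ))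
      = edgeTerm p a b + edgeTerm p b c + edgeTerm p c a
        + 12 * signIndicator (det3 p a b) (det3 p b c) (det3 p c a) := by
  have h1 : det3 b c a = 1 := by rw [det3_rotate, h]
  have h2 : det3 c a b = 1 := by rw [det3_rotate, h1]
  have s0 := slope_sub_slope h hy hz
  have s1 := slope_sub_slope h1 hz hx
  have s2 := slope_sub_slope h2 hx hy
  have g0 := content_cross3_eq_gcd h p
  have g1 := content_cross3_eq_gcd h1 p
  have g2 := content_cross3_eq_gcd h2 p
  have r0 := dedekind_add_swap hy hz
  have r1 := dedekind_add_swap hz hx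
  have r2 := dedekind_add_swap hx hy
  have hs := four_mul_signIndicator hx hy hz
  rw [edgeTerm_eq h, edgeTerm_eq h1, edgeTerm_eq h2]
  unfold reciprocityTerm at r0 r1 r2
  rw [← g0] at r0
  rw [← g1] at r1
  rw [← g2] at r2
  have hxR : (det3 p a b : ℝ) ≠ 0 := by exact_mod_cast hx
  have hyR : (det3 p b c : ℝ) ≠ 0 := by exact_mod_cast hy
  have hzR : (det3 p c a : ℝ) ≠ 0 := by exact_mod_cast hz
  generalize det3 p a b = x at *
  generalize det3 p b c = y at *
  generalize det3 p c a = z at *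
  have expand : ((x + y + z : ℤ) : ℝ) * (1 / (x : ℝ) + 1 / (y : ℝ) + 1 / (z : ℝ))
      = 3 + ((x / y + y / x) + (y / z + z / y) + (z / x + x / z) : ℝ) := by
    push_cast
    field_simp
    ring
  rw [expand]
  push_cast at hs r0 r1 r2 ⊢
  linear_combination -r0 - r1 - r2 - 3 * hs - content (cross3 p c) ^ 2 * s0
    - content (cross3 p a) ^ 2 * s1 - content (cross3 p b) ^ 2 * s2

theorem exists_eq_add_smul (a b : Fin 3 → ℤ) :
    ∃ w : Fin 3 → ℤ, content w = 1 ∧ b = a + (content (b - a) : ℤ) • w := by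
  rcases Nat.eq_zero_or_pos (content (b - a)) with h | h
  · refine ⟨![1, 0, 0], by simp [content], ?_⟩
    rw [h]
    have := content_eq_zero.mp h
    simp [sub_eq_zero.mp this]
  · choose w hw using content_dvd (b - a)
    have hb : b = a + (content (b - a) : ℤ) • w := by
      ext i
      have := hw i
      simp only [Pi.sub_apply] at this
      simp only [Pi.add_apply, Pi.smul_apply, smul_eq_mul]
      linarith
    refine ⟨w, ?_, hb⟩
    have h1 : ((content (b - a) * content w : ℕ) : ℤ) ∣ content (b - a) := by
      apply dvd_content
      intro i
      rw [hw i]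
      push_cast
      exact mul_dvd_mul_left _ (content_dvd w i)
    have h2 : content (b - a) * content w ∣ content (b - a) * 1 := by
      rw [mul_one]; exact Int.natCast_dvd_natCast.mp h1
    exact Nat.dvd_one.mp (Nat.dvd_of_mul_dvd_mul_left h h2)

theorem content_natCast_smul {w : Fin 3 → ℤ} (hw : content w = 1) (n : ℕ) :
    content ((n : ℤ) • w) = n := by
  apply content_eq_of_dvd
  · intro i
    exact ⟨w i, by simp⟩
  · obtain ⟨u, hu⟩ := exists_dot3_eq_content w
    rw [hw] at hu
    have := content_dvd_dot3 u ((n : ℤ) • w)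
    have e : dot3 u ((n : ℤ) • w) = n * dot3 u w := by
      simp only [dot3, Pi.smul_apply, smul_eq_mul]; ring
    rwa [e, hu, Nat.cast_one, mul_one] at this

/-- The sum of `Φ` over the unit steps of the lattice segment from `a` to `b`. -/
noncomputable def segmentSum (Φ : (Fin 3 → ℤ) → (Fin 3 → ℤ) → ℝ) (a b : Fin 3 → ℤ) : ℝ :=
  ∑ k ∈ range (content (b - a)), Φ (a + (k : ℤ) • (exists_eq_add_smul a b).choose)
    (a + (k + 1 : ℤ) • (exists_eq_add_smul a b).choose)

theorem segmentSum_add_smul (Φ : (Fin 3 → ℤ) → (Fin 3 → ℤ) → ℝ) (a : Fin 3 → ℤ)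
    {w : Fin 3 → ℤ} (hw : content w = 1) (n : ℕ) :
    segmentSum Φ a (a + (n : ℤ) • w)
      = ∑ k ∈ range n, Φ (a + (k : ℤ) • w) (a + (k + 1 : ℤ) • w) := by
  obtain ⟨-, h2⟩ := (exists_eq_add_smul a (a + (n : ℤ) • w)).choose_spec
  rw [segmentSum]
  set w' := (exists_eq_add_smul a (a + (n : ℤ) • w)).choose
  have hc : content (a + (n : ℤ) • w - a) = n := by
    rw [add_sub_cancel_left, content_natCast_smul hw]
  rw [hc] at h2 ⊢
  rcases Nat.eq_zero_or_pos n with rfl | hn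
  · simp
  · have : w = w' := by
      ext i
      have := congrFun h2 i
      simpa [hn.ne'] using this
    rw [← this]

theorem segmentSum_swap {Φ : (Fin 3 → ℤ) → (Fin 3 → ℤ) → ℝ} (hΦ : ∀ a b, Φ b a = -Φ a b)
    (a b : Fin 3 → ℤ) : segmentSum Φ b a = -segmentSum Φ a b := by
  obtain ⟨w, hw, hb⟩ := exists_eq_add_smul a b
  set n := content (b - a)
  have ha : a = b + (n : ℤ) • (-w) := by rw [hb]; simp
  conv_lhs => rw [ha]
  rw [segmentSum_add_smul Φ b (by rw [content_neg, hw])]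
  conv_rhs => rw [hb]
  rw [segmentSum_add_smul Φ a hw, ← sum_range_reflect, ← sum_neg_distrib]
  apply sum_congr rfl
  intro k hk
  rw [mem_range] at hk
  have hk' : ((n - 1 - k : ℕ) : ℤ) = n - 1 - k := by omega
  rw [← hΦ, hb, hk']
  congr 1 <;> · ext i; simp; ring

theorem segmentSum_add (Φ : (Fin 3 → ℤ) → (Fin 3 → ℤ) → ℝ) (a : Fin 3 → ℤ)
    {w : Fin 3 → ℤ} (hw : content w = 1) {k n : ℕ} (hkn : k ≤ n) :
    segmentSum Φ a (a + (n : ℤ) • w) = segmentSum Φ a (a + (k : ℤ) • w)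
      + segmentSum Φ (a + (k : ℤ) • w) (a + (n : ℤ) • w) := by
  obtain ⟨j, rfl⟩ := Nat.exists_eq_add_of_le hkn
  have : a + ((k + j : ℕ) : ℤ) • w = a + (k : ℤ) • w + (j : ℤ) • w := by
    push_cast; rw [add_smul, add_assoc]
  rw [segmentSum_add_smul Φ a hw, this, segmentSum_add_smul Φ a hw, segmentSum_add_smul Φ _ hw,
    sum_range_add]
  congr 1
  apply sum_congr rfl
  intro i _
  push_cast
  congr 1 <;> · ext; simp; ring

theorem segmentSum_add_of_between (Φ : (Fin 3 → ℤ) → (Fin 3 → ℤ) → ℝ) {a b m : Fin 3 → ℤ}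
    {α β : ℤ} (hα : 0 ≤ α) (hβ : 0 ≤ β) (h0 : 0 < α + β) (hm : (α + β) • m = α • a + β • b) :
    segmentSum Φ a b = segmentSum Φ a m + segmentSum Φ m b := by
  obtain ⟨w, hw, hb⟩ := exists_eq_add_smul a b
  set n := content (b - a)
  obtain ⟨u, hu⟩ := exists_dot3_eq_content w
  rw [hw, Nat.cast_one] at hu
  have hma : (α + β) • (m - a) = (β * n) • w := by
    rw [smul_sub, hm, hb, smul_add, add_smul, mul_smul]; abel
  have hk : (α + β) * dot3 u (m - a) = β * n := by
    have e1 : dot3 u ((α + β) • (m - a)) = (α + β) * dot3 u (m - a) := by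
      simp only [dot3, Pi.smul_apply, smul_eq_mul]; ring
    have e2 : dot3 u ((β * n) • w) = β * n * dot3 u w := by
      simp only [dot3, Pi.smul_apply, smul_eq_mul]; ring
    rw [← e1, hma, e2, hu, mul_one]
  set k := dot3 u (m - a)
  have hk0 : 0 ≤ k := by
    by_contra! hneg
    have : 0 ≤ β * n := by positivity
    nlinarith
  have hkn : k ≤ n := by
    by_contra! hneg
    have : 0 ≤ α * n := by positivity
    nlinarith
  have hmk : m = a + k • w := by
    rw [← hk, mul_smul] at hma
    have : m - a = k • w := smul_right_injective _ h0.ne' hma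
    rw [← this]; abel
  obtain ⟨j, hj⟩ := Int.eq_ofNat_of_zero_le hk0
  rw [hj] at hmk hkn
  rw [hmk, hb]
  exact segmentSum_add Φ a hw (by exact_mod_cast hkn)

theorem dot3_smul (k : ℤ) (u v : Fin 3 → ℤ) : dot3 u (k • v) = k * dot3 u v := by
  simp only [dot3, Pi.smul_apply, smul_eq_mul]; ring

theorem dot3_add (u v w : Fin 3 → ℤ) : dot3 u (v + w) = dot3 u v + dot3 u w := by
  simp only [dot3, Pi.add_apply]; ring

theorem dot3_sub (u v w : Fin 3 → ℤ) : dot3 u (v - w) = dot3 u v - dot3 u w := by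
  simp only [dot3, Pi.sub_apply]; ring

theorem det3_mul_dot3 (l a b c m : Fin 3 → ℤ) :
    det3 a b c * dot3 l m = det3 m b c * dot3 l a + det3 m c a * dot3 l b
      + det3 m a b * dot3 l c := by
  rw [← dot3_smul, det3_cramer, dot3_add, dot3_add, dot3_smul, dot3_smul, dot3_smul]

theorem exists_not_dvd_of_one_lt_det3 {a b c : Fin 3 → ℤ} (h : 1 < det3 a b c) :
    ∃ x, ¬ (det3 a b c ∣ det3 x b c ∧ det3 a b c ∣ det3 x c a ∧ det3 a b c ∣ det3 x a b) := by
  by_contra! hall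
  have hd (u v : Fin 3 → ℤ) (huv : ∀ x, det3 a b c ∣ det3 x u v) (i : Fin 3) :
      det3 a b c ∣ cross3 u v i := by
    have := huv (Pi.single i 1)
    fin_cases i <;> simpa [det3, dot3] using this
  choose u hu using hd b c fun x => (hall x).1
  choose v hv using hd c a fun x => (hall x).2.1
  choose w hw using hd a b fun x => (hall x).2.2
  have key : det3 (cross3 b c) (cross3 c a) (cross3 a b) = det3 a b c ^ 2 := by
    simp [det3_eq, cross3]; ring
  have key2 : det3 (cross3 b c) (cross3 c a) (cross3 a b) = det3 a b c ^ 3 * det3 u v w := by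
    rw [det3_eq (cross3 b c), det3_eq u]
    simp only [hu, hv, hw]
    ring
  have h3 : det3 a b c * det3 u v w = 1 := by
    have h2 : det3 a b c ^ 2 ≠ 0 := by positivity
    apply mul_left_cancel₀ h2
    linear_combination key - key2
  have := Int.eq_one_or_neg_one_of_mul_eq_one h3
  omega

/-- A lattice triangle at height one that is not unimodular contains a further lattice point. -/
theorem exists_lattice_point_of_one_lt_det3 {l a b c : Fin 3 → ℤ} (ha : dot3 l a = -1)
    (hb : dot3 l b = -1) (hc : dot3 l c = -1) (h : 1 < det3 a b c) :
    ∃ m, dot3 l m = -1 ∧ (0 ≤ det3 m b c ∧ det3 m b c < det3 a b c) ∧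
      (0 ≤ det3 m c a ∧ det3 m c a < det3 a b c) ∧ (0 ≤ det3 m a b ∧ det3 m a b < det3 a b c) := by
  obtain ⟨x, hx⟩ := exists_not_dvd_of_one_lt_det3 h
  set D := det3 a b c with hD
  have hD0 : 0 < D := by omega
  obtain ⟨x', h1, h2, h3⟩ : ∃ x', det3 x' b c = det3 x b c % D ∧ det3 x' c a = det3 x c a % D ∧
      det3 x' a b = det3 x a b % D := by
    refine ⟨x - ((det3 x b c / D) • a + (det3 x c a / D) • b + (det3 x a b / D) • c), ?_, ?_, ?_⟩
    · rw [Int.emod_def]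
      generalize det3 x b c / D = i
      generalize det3 x c a / D = j
      generalize det3 x a b / D = k
      rw [hD]
      simp only [det3_eq, Pi.sub_apply, Pi.add_apply, Pi.smul_apply, smul_eq_mul]; ring
    · rw [Int.emod_def]
      generalize det3 x b c / D = i
      generalize det3 x c a / D = j
      generalize det3 x a b / D = k
      rw [hD]
      simp only [det3_eq, Pi.sub_apply, Pi.add_apply, Pi.smul_apply, smul_eq_mul]; ring
    · rw [Int.emod_def]
      generalize det3 x b c / D = i
      generalize det3 x c a / D = j
      generalize det3 x a b / D = k
      rw [hD]
      simp only [det3_eq, Pi.sub_apply, Pi.add_apply, Pi.smul_apply, smul_eq_mul]; ring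
  have hl := det3_mul_dot3 l a b c x'
  rw [ha, hb, hc, ← hD] at hl
  rw [Int.dvd_iff_emod_eq_zero, Int.dvd_iff_emod_eq_zero, Int.dvd_iff_emod_eq_zero, ← h1, ← h2,
    ← h3] at hx
  have b1 := Int.emod_nonneg (det3 x b c) hD0.ne'
  have b2 := Int.emod_nonneg (det3 x c a) hD0.ne'
  have b3 := Int.emod_nonneg (det3 x a b) hD0.ne'
  have c1 := Int.emod_lt_of_pos (det3 x b c) hD0
  have c2 := Int.emod_lt_of_pos (det3 x c a) hD0
  have c3 := Int.emod_lt_of_pos (det3 x a b) hD0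
  rw [← h1] at b1 c1
  rw [← h2] at b2 c2
  rw [← h3] at b3 c3
  have hlow : dot3 l x' < 0 := by
    by_contra! hneg
    have : 0 ≤ D * dot3 l x' := by positivity
    omega
  have hhigh : -3 < dot3 l x' := by
    by_contra! hneg
    have : D * dot3 l x' ≤ D * (-3) := by gcongr
    omega
  obtain hcase | hcase : dot3 l x' = -1 ∨ dot3 l x' = -2 := by omega
  · exact ⟨x', hcase, ⟨b1, c1⟩, ⟨b2, c2⟩, ⟨b3, c3⟩⟩
  · rw [hcase] at hl
    have f1 : det3 (a + b + c - x') b c = D - det3 x' b c := by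
      rw [hD]; simp only [det3_eq, Pi.sub_apply, Pi.add_apply]; ring
    have f2 : det3 (a + b + c - x') c a = D - det3 x' c a := by
      rw [hD]; simp only [det3_eq, Pi.sub_apply, Pi.add_apply]; ring
    have f3 : det3 (a + b + c - x') a b = D - det3 x' a b := by
      rw [hD]; simp only [det3_eq, Pi.sub_apply, Pi.add_apply]; ring
    refine ⟨a + b + c - x', ?_, ?_, ?_, ?_⟩
    · rw [dot3_sub, dot3_add, dot3_add]; omega
    all_goals omega

theorem signIndicator_rotate (x y z : ℤ) : signIndicator y z x = signIndicator x y z := by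
  unfold signIndicator
  congr 1
  apply propext
  tauto

theorem signIndicator_subdivide {x y z r s t α β γ D : ℤ} (hα : 0 ≤ α) (hβ : 0 ≤ β) (hγ : 0 ≤ γ)
    (hsum : 0 < α + β + γ) (hD : 0 < D)
    (h : α * r + β * s + γ * t = 0) (hr : D * r = -β * x + γ * z) (hs : D * s = α * x - γ * y)
    (ht : D * t = -α * z + β * y) (hx : x ≠ 0) (hy : y ≠ 0) (hz : z ≠ 0) (hr0 : r ≠ 0)
    (hs0 : s ≠ 0) (ht0 : t ≠ 0) :
    signIndicator s y (-t) + signIndicator (-r) t z + signIndicator x (-s) r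
      = signIndicator x y z := by
  unfold signIndicator
  have sgn {D u : ℤ} (hD : 0 < D) (h : 0 ≤ D * u) : 0 ≤ u := by
    by_contra! hu; nlinarith
  have sgn' {D u : ℤ} (hD : 0 < D) (h : D * u ≤ 0) : u ≤ 0 := by
    by_contra! hu; nlinarith
  have a1 : ¬ (0 < r ∧ 0 < s ∧ 0 < t) := by
    rintro ⟨h1, h2, h3⟩
    have : (α + β + γ) * 1 ≤ α * r + β * s + γ * t := by nlinarith
    omega
  have a2 : ¬ (r < 0 ∧ s < 0 ∧ t < 0) := by
    rintro ⟨h1, h2, h3⟩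
    have : α * r + β * s + γ * t ≤ (α + β + γ) * (-1) := by nlinarith
    omega
  have b1 : 0 < x → z < 0 → r < 0 := fun h1 h2 =>
    lt_of_le_of_ne (sgn' hD (by rw [hr]; nlinarith)) hr0
  have b2 : x < 0 → 0 < z → 0 < r := fun h1 h2 =>
    lt_of_le_of_ne (sgn hD (by rw [hr]; nlinarith)) hr0.symm
  have b3 : 0 < x → y < 0 → 0 < s := fun h1 h2 =>
    lt_of_le_of_ne (sgn hD (by rw [hs]; nlinarith)) hs0.symm
  have b4 : x < 0 → 0 < y → s < 0 := fun h1 h2 =>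
    lt_of_le_of_ne (sgn' hD (by rw [hs]; nlinarith)) hs0
  have b5 : 0 < z → y < 0 → t < 0 := fun h1 h2 =>
    lt_of_le_of_ne (sgn' hD (by rw [ht]; nlinarith)) ht0
  have b6 : z < 0 → 0 < y → 0 < t := fun h1 h2 =>
    lt_of_le_of_ne (sgn hD (by rw [ht]; nlinarith)) ht0.symm
  clear h hr hs ht sgn sgn' hsum
  rcases lt_or_gt_of_ne hx with hx | hx <;> rcases lt_or_gt_of_ne hy with hy | hy <;>
    rcases lt_or_gt_of_ne hz with hz | hz <;> rcases lt_or_gt_of_ne hr0 with hr | hr <;>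
    rcases lt_or_gt_of_ne hs0 with hs | hs <;> rcases lt_or_gt_of_ne ht0 with ht | ht <;>
    first
    | omega
    | simp [hx, hy, hz, hr, hs, ht, hx.not_gt, hy.not_gt, hz.not_gt, hr.not_gt, hs.not_gt,
        ht.not_gt]

theorem segmentSum_of_det3_eq_one (Φ : (Fin 3 → ℤ) → (Fin 3 → ℤ) → ℝ) {a b c : Fin 3 → ℤ}
    (h : det3 a b c = 1) : segmentSum Φ a b = Φ a b := by
  have h1 : content (b - a) = 1 := by
    apply content_eq_of_dvd (by simp)
    have := content_dvd_dot3 (cross3 c a) (b - a)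
    have e : dot3 (cross3 c a) (b - a) = det3 a b c := by
      simp [det3_eq, dot3, cross3]; ring
    rwa [e, h] at this
  have := segmentSum_add_smul Φ a h1 1
  simpa using this

/-- If a unit triangle relation holds for unimodular lattice triangles in a planar region `P`,
it holds for all lattice triangles in `P`. -/
theorem segmentSum_triangle {Φ : (Fin 3 → ℤ) → (Fin 3 → ℤ) → ℝ} (hΦ : ∀ a b, Φ b a = -Φ a b)
    {P : Set (Fin 3 → ℤ)} {l p : Fin 3 → ℤ} (hl : ∀ a ∈ P, dot3 l a = -1)
    (hconv : ∀ a ∈ P, ∀ b ∈ P, ∀ c ∈ P, 0 < det3 a b c → ∀ m, dot3 l m = -1 → 0 ≤ det3 m b c →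
      0 ≤ det3 m c a → 0 ≤ det3 m a b → m ∈ P)
    (hgen : ∀ a ∈ P, ∀ b ∈ P, a ≠ b → det3 p a b ≠ 0)
    (hunit : ∀ a ∈ P, ∀ b ∈ P, ∀ c ∈ P, det3 a b c = 1 →
      Φ a b + Φ b c + Φ c a = 12 * signIndicator (det3 p a b) (det3 p b c) (det3 p c a))
    {a b c : Fin 3 → ℤ} (ha : a ∈ P) (hb : b ∈ P) (hc : c ∈ P) (hD : 0 < det3 a b c) :
    segmentSum Φ a b + segmentSum Φ b c + segmentSum Φ c a
      = 12 * signIndicator (det3 p a b) (det3 p b c) (det3 p c a) := by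
  induction hn : (det3 a b c).toNat using Nat.strong_induction_on generalizing a b c with
  | _ n ih =>
  obtain h1 | h1 : det3 a b c = 1 ∨ 1 < det3 a b c := by omega
  · rw [segmentSum_of_det3_eq_one Φ h1, segmentSum_of_det3_eq_one Φ ((det3_rotate a b c).trans h1),
      segmentSum_of_det3_eq_one Φ (((det3_rotate b c a).trans (det3_rotate a b c)).trans h1)]
    exact hunit a ha b hb c hc h1
  obtain ⟨m, hlm, ⟨hα, hα'⟩, ⟨hβ, hβ'⟩, ⟨hγ, hγ'⟩⟩ :=
    exists_lattice_point_of_one_lt_det3 (hl a ha) (hl b hb) (hl c hc) h1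
  have hm : m ∈ P := hconv a ha b hb c hc hD m hlm hα hβ hγ
  have hsum : det3 m b c + det3 m c a + det3 m a b = det3 a b c := by
    have := det3_mul_dot3 l a b c m
    rw [hlm, hl a ha, hl b hb, hl c hc] at this
    linarith
  have sub {u v w : Fin 3 → ℤ} (hu : u ∈ P) (hv : v ∈ P) (hw : w ∈ P)
      (huvw : det3 u v w = det3 a b c) (h0 : 0 ≤ det3 m v w) (h0' : det3 m v w < det3 a b c)
      (h2 : 0 ≤ det3 m w u) (h2' : det3 m w u < det3 a b c) (h3 : 0 ≤ det3 m u v)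
      (h3' : det3 m u v < det3 a b c) :
      segmentSum Φ m v + segmentSum Φ v w + segmentSum Φ w m
        = 12 * signIndicator (det3 p m v) (det3 p v w) (det3 p w m) := by
    rcases h0.eq_or_lt with h0 | h0
    · have hs : det3 m w u + det3 m u v = det3 a b c := by
        have := det3_mul_dot3 l u v w m
        rw [hlm, hl u hu, hl v hv, hl w hw] at this
        linarith
      have hcr := det3_cramer u v w m
      rw [← h0, zero_smul, zero_add, huvw, ← hs] at hcr
      rw [segmentSum_add_of_between Φ h2 h3 (by omega) hcr, segmentSum_swap hΦ v m,
        segmentSum_swap hΦ m w]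
      have hi : signIndicator (det3 p m v) (det3 p v w) (det3 p w m) = 0 := by
        have e : (det3 m w u + det3 m u v) * det3 p m v = -det3 m u v * det3 p v w := by
          have e1 : (det3 m w u + det3 m u v) * det3 p m v
              = det3 p ((det3 m w u + det3 m u v) • m) v := by
            simp only [det3_eq p, Pi.smul_apply, smul_eq_mul]; ring
          rw [e1, hcr]
          simp only [det3_eq p, Pi.smul_apply, smul_eq_mul, Pi.add_apply]; ring
        have hpos : 0 < det3 m u v := by omega
        rw [signIndicator, if_neg]
        rintro (⟨g1, g2, -⟩ | ⟨g1, g2, -⟩)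
        · have : 0 < (det3 m w u + det3 m u v) * det3 p m v := mul_pos (by omega) g1
          have : 0 < det3 m u v * det3 p v w := mul_pos hpos g2
          linarith
        · have : (det3 m w u + det3 m u v) * det3 p m v < 0 := mul_neg_of_pos_of_neg (by omega) g1
          have : det3 m u v * det3 p v w < 0 := mul_neg_of_pos_of_neg hpos g2
          linarith
      rw [hi]
      ring
    · exact ih _ (by omega) hm hv hw h0 rfl
  have s1 := sub ha hb hc rfl hα hα' hβ hβ' hγ hγ'
  have s2 := sub hb hc ha (det3_rotate a b c) hβ hβ' hγ hγ' hα hα'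
  have s3 := sub hc ha hb ((det3_rotate b c a).trans (det3_rotate a b c)) hγ hγ' hα hα' hβ hβ'
  have hma : m ≠ a := by rintro rfl; omega
  have hmb : m ≠ b := by
    rintro rfl
    have := det3_rotate a m c
    have := det3_rotate m c a
    omega
  have hmc : m ≠ c := by
    rintro rfl
    have := det3_rotate a b m
    have := det3_rotate b m a
    omega
  have hab : a ≠ b := by rintro rfl; simp only [det3_eq] at hD; ring_nf at hD; omega
  have hbc : b ≠ c := by rintro rfl; simp only [det3_eq] at hD; ring_nf at hD; omega
  have hca : c ≠ a := by rintro rfl; simp only [det3_eq] at hD; ring_nf at hD; omega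
  have hcr := det3_cramer a b c m
  have lin (v : Fin 3 → ℤ) : det3 a b c * det3 p m v = det3 m b c * det3 p a v
      + det3 m c a * det3 p b v + det3 m a b * det3 p c v := by
    have e1 : det3 a b c * det3 p m v = det3 p (det3 a b c • m) v := by
      simp only [det3_eq p, Pi.smul_apply, smul_eq_mul]; ring
    rw [e1, hcr]
    simp only [det3_eq p, Pi.smul_apply, smul_eq_mul, Pi.add_apply]; ring
  have z1 (v : Fin 3 → ℤ) : det3 p v v = 0 := by simp only [det3_eq]; ring
  have key := signIndicator_subdivide (x := det3 p a b) (y := det3 p b c) (z := det3 p c a)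
    (r := det3 p m a) (s := det3 p m b) (t := det3 p m c) hα hβ hγ (by omega) hD
    (by have := lin m
        rw [z1, det3_swap_right p m a, det3_swap_right p m b, det3_swap_right p m c] at this
        linarith)
    (by rw [lin, z1, det3_swap_right p a b]; ring)
    (by rw [lin, z1, det3_swap_right p b c]; ring)
    (by rw [lin, z1, det3_swap_right p c a]; ring)
    (hgen a ha b hb hab) (hgen b hb c hc hbc) (hgen c hc a ha hca)
    (hgen m hm a ha hma) (hgen m hm b hb hmb) (hgen m hm c hc hmc)
  rw [det3_swap_right p m c] at s1
  rw [det3_swap_right p m a, signIndicator_rotate] at s2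
  rw [det3_swap_right p m b, ← signIndicator_rotate] at s3
  have t1 := segmentSum_swap hΦ a m
  have t2 := segmentSum_swap hΦ b m
  have t3 := segmentSum_swap hΦ c m
  rw [← key]
  linarith

/-- The pairing of an integer vector with a real vector. -/
def pairing (a : Fin 3 → ℤ) (y : Fin 3 → ℝ) : ℝ := a 0 * y 0 + a 1 * y 1 + a 2 * y 2

/-- The cross product, as a real vector. -/
def crossReal (a b : Fin 3 → ℤ) : Fin 3 → ℝ := fun i => (cross3 a b i : ℝ)

theorem pairing_crossReal (v a b : Fin 3 → ℤ) : pairing v (crossReal a b) = det3 v a b := by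
  simp [pairing, crossReal, det3, dot3]

theorem pairing_add (v : Fin 3 → ℤ) (y z : Fin 3 → ℝ) :
    pairing v (y + z) = pairing v y + pairing v z := by
  simp only [pairing, Pi.add_apply]; ring

theorem pairing_sub (v : Fin 3 → ℤ) (y z : Fin 3 → ℝ) :
    pairing v (y - z) = pairing v y - pairing v z := by
  simp only [pairing, Pi.sub_apply]; ring

theorem pairing_neg (v : Fin 3 → ℤ) (y : Fin 3 → ℝ) : pairing v (-y) = -pairing v y := by
  simp only [pairing, Pi.neg_apply]; ring

theorem pairing_smul (v : Fin 3 → ℤ) (t : ℝ) (y : Fin 3 → ℝ) :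
    pairing v (t • y) = t * pairing v y := by
  simp only [pairing, Pi.smul_apply, smul_eq_mul]; ring

theorem det3_mul_pairing (a b c q : Fin 3 → ℤ) (y : Fin 3 → ℝ) :
    det3 a b c * pairing q y = det3 q b c * pairing a y + det3 q c a * pairing b y
      + det3 q a b * pairing c y := by
  simp only [det3_eq, pairing]; push_cast; ring

theorem eq_of_pairing_eq {a b c : Fin 3 → ℤ} (h : det3 a b c ≠ 0) {y z : Fin 3 → ℝ}
    (ha : pairing a y = pairing a z) (hb : pairing b y = pairing b z)
    (hc : pairing c y = pairing c z) : y = z := by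
  have hR : (det3 a b c : ℝ) ≠ 0 := by exact_mod_cast h
  have key (q : Fin 3 → ℤ) : pairing q y = pairing q z := by
    apply mul_left_cancel₀ hR
    rw [det3_mul_pairing a b c q y, det3_mul_pairing a b c q z, ha, hb, hc]
  ext i
  have := key (Pi.single i 1)
  fin_cases i <;> simpa [pairing] using this

/-- The polyhedron cut out by the inequalities `⟨v, y⟩ ≥ -ω v`, for `v ∈ V`. -/
def Feasible (V : Finset (Fin 3 → ℤ)) (ω : (Fin 3 → ℤ) → ℝ) (y : Fin 3 → ℝ) : Prop :=
  ∀ v ∈ V, -ω v ≤ pairing v y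

/-- An oriented triangle of the triangulation induced by the weights `ω`: three independent
vectors whose inequalities are simultaneously tight at a feasible point. -/
def IsTriangle (V : Finset (Fin 3 → ℤ)) (ω : (Fin 3 → ℤ) → ℝ) (a b c : Fin 3 → ℤ) : Prop :=
  (a ∈ V ∧ b ∈ V ∧ c ∈ V) ∧ 0 < det3 a b c ∧
    ∃ y, Feasible V ω y ∧ pairing a y = -ω a ∧ pairing b y = -ω b ∧ pairing c y = -ω c

/-- No four inequalities, three of them independent, are simultaneously tight. -/
def GenericWeight (V : Finset (Fin 3 → ℤ)) (ω : (Fin 3 → ℤ) → ℝ) : Prop :=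
  ∀ a ∈ V, ∀ b ∈ V, ∀ c ∈ V, ∀ d ∈ V, det3 a b c ≠ 0 → ∀ y, pairing a y = -ω a →
    pairing b y = -ω b → pairing c y = -ω c → pairing d y = -ω d → d = a ∨ d = b ∨ d = c

/-- The vectors of `V` positively span the space. -/
def PositivelySpans (V : Finset (Fin 3 → ℤ)) : Prop :=
  ∀ n : Fin 3 → ℝ, n ≠ 0 → ∃ v ∈ V, pairing v n < 0

section

variable {V : Finset (Fin 3 → ℤ)} {ω : (Fin 3 → ℤ) → ℝ}

theorem IsTriangle.rotate {a b c : Fin 3 → ℤ} (h : IsTriangle V ω a b c) :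
    IsTriangle V ω b c a := by
  obtain ⟨⟨ha, hb, hc⟩, hD, y, hy, h1, h2, h3⟩ := h
  exact ⟨⟨hb, hc, ha⟩, by rwa [det3_rotate], y, hy, h2, h3, h1⟩

theorem Feasible.exists_tight_on_ray (hV : PositivelySpans V) {y n : Fin 3 → ℝ}
    (hy : Feasible V ω y) (hn : n ≠ 0) :
    ∃ t : ℝ, 0 ≤ t ∧ ∃ c ∈ V, Feasible V ω (y + t • n) ∧ pairing c (y + t • n) = -ω c ∧
      pairing c n < 0 := by
  obtain ⟨v₀, hv₀, hv₀n⟩ := hV n hn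
  obtain ⟨c, hc, hmin⟩ := Finset.exists_min_image (V.filter fun v => pairing v n < 0)
    (fun v => (pairing v y + ω v) / (-pairing v n)) ⟨v₀, by simp [hv₀, hv₀n]⟩
  rw [mem_filter] at hc
  have hcn : 0 < -pairing c n := by linarith [hc.2]
  have ht : 0 ≤ (pairing c y + ω c) / (-pairing c n) :=
    div_nonneg (by linarith [hy c hc.1]) hcn.le
  refine ⟨(pairing c y + ω c) / (-pairing c n), ht, c, hc.1, ?_, ?_, hc.2⟩
  · intro v hv
    rw [pairing_add, pairing_smul]
    rcases lt_or_ge (pairing v n) 0 with h | h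
    · have h1 := hmin v (by simp [hv, h])
      have h2 := mul_le_mul_of_nonneg_right h1 (show 0 ≤ -pairing v n by linarith)
      rw [div_mul_cancel₀ _ (show -pairing v n ≠ 0 by linarith)] at h2
      linarith
    · have := mul_nonneg ht h
      linarith [hy v hv]
  · rw [pairing_add, pairing_smul]
    have := hc.2.ne
    field_simp
    ring

theorem crossReal_ne_zero {a b : Fin 3 → ℤ} (h : cross3 a b ≠ 0) : crossReal a b ≠ 0 := by
  contrapose! h
  ext i
  have := congrFun h i
  simpa [crossReal] using this

theorem Feasible.exists_isTriangle (hV : PositivelySpans V) {y : Fin 3 → ℝ}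
    (hy : Feasible V ω y) {a b : Fin 3 → ℤ} (hab : cross3 a b ≠ 0)
    (hay : pairing a y = -ω a) (hby : pairing b y = -ω b) :
    ∃ c ∈ V, 0 < det3 a b c ∧ ∃ t : ℝ, 0 ≤ t ∧ Feasible V ω (y - t • crossReal a b) ∧
      pairing a (y - t • crossReal a b) = -ω a ∧ pairing b (y - t • crossReal a b) = -ω b ∧
      pairing c (y - t • crossReal a b) = -ω c := by
  obtain ⟨t, ht, c, hc, h1, h2, h3⟩ := hy.exists_tight_on_ray hV
    (neg_ne_zero.mpr (crossReal_ne_zero hab))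
  rw [smul_neg, ← sub_eq_add_neg] at h1 h2
  rw [pairing_neg, pairing_crossReal] at h3
  refine ⟨c, hc, ?_, t, ht, h1, ?_, ?_, h2⟩
  · rw [← det3_rotate, ← det3_rotate]
    have : (0 : ℝ) < det3 c a b := by linarith
    exact_mod_cast this
  · rw [pairing_sub, pairing_smul, pairing_crossReal, hay,
      show det3 a a b = 0 by simp only [det3_eq]; ring]
    simp
  · rw [pairing_sub, pairing_smul, pairing_crossReal, hby,
      show det3 b a b = 0 by simp only [det3_eq]; ring]
    simp

theorem cross3_ne_zero_of_det3 {a b c : Fin 3 → ℤ} (h : det3 a b c ≠ 0) : cross3 a b ≠ 0 := by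
  contrapose! h
  rw [← det3_rotate, ← det3_rotate, det3, h]
  simp [dot3]

theorem cross3_swap_ne_zero {a b : Fin 3 → ℤ} (h : cross3 a b ≠ 0) : cross3 b a ≠ 0 := by
  have : cross3 a b = -cross3 b a := by
    ext i; fin_cases i <;> simp [cross3] <;> ring
  rwa [this, neg_ne_zero] at h

theorem IsTriangle.exists_adjacent (hV : PositivelySpans V) {a b c : Fin 3 → ℤ}
    (h : IsTriangle V ω a b c) : ∃ d, IsTriangle V ω b a d := by
  obtain ⟨⟨ha, hb, hc⟩, hD, y, hy, h1, h2, h3⟩ := h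
  obtain ⟨d, hd, hD', t, -, g0, g1, g2, g3⟩ := hy.exists_isTriangle hV
    (cross3_swap_ne_zero (cross3_ne_zero_of_det3 hD.ne')) h2 h1
  exact ⟨d, ⟨hb, ha, hd⟩, hD', _, g0, g1, g2, g3⟩

theorem sub_eq_smul_crossReal {a b c : Fin 3 → ℤ} (h : det3 a b c ≠ 0) {y z : Fin 3 → ℝ}
    (ha : pairing a y = pairing a z) (hb : pairing b y = pairing b z) :
    z = y + ((pairing c z - pairing c y) / det3 a b c) • crossReal a b := by
  have hR : (det3 a b c : ℝ) ≠ 0 := by exact_mod_cast h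
  apply eq_of_pairing_eq h
  · rw [pairing_add, pairing_smul, pairing_crossReal,
      show det3 a a b = 0 by simp only [det3_eq]; ring, ha]
    simp
  · rw [pairing_add, pairing_smul, pairing_crossReal,
      show det3 b a b = 0 by simp only [det3_eq]; ring, hb]
    simp
  · rw [pairing_add, pairing_smul, pairing_crossReal, ← det3_rotate c a b]
    field_simp
    ring

theorem IsTriangle.third_unique (hω : GenericWeight V ω) {a b c d : Fin 3 → ℤ}
    (h : IsTriangle V ω a b c) (h' : IsTriangle V ω a b d) : c = d := by
  obtain ⟨⟨ha, hb, hc⟩, hD, y, hy, h1, h2, h3⟩ := h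
  obtain ⟨⟨-, -, hd⟩, hD', z, hz, g1, g2, g3⟩ := h'
  have hDR : (0 : ℝ) < det3 a b c := by exact_mod_cast hD
  have hDR' : (0 : ℝ) < det3 a b d := by exact_mod_cast hD'
  have e := sub_eq_smul_crossReal hD.ne' (h1.trans g1.symm) (h2.trans g2.symm)
  set k := (pairing c z - pairing c y) / det3 a b c with hk
  have hk0 : 0 ≤ k := div_nonneg (by linarith [hz c hc]) hDR.le
  have hdz : pairing d z = pairing d y + k * det3 a b d := by
    conv_lhs => rw [e]
    rw [pairing_add, pairing_smul, pairing_crossReal, ← det3_rotate d a b]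
  have hk1 : k * det3 a b d ≤ 0 := by linarith [hy d hd]
  have hk2 : k = 0 := by nlinarith
  have hdy : pairing d y = -ω d := by rw [← g3, hdz, hk2]; ring
  rcases hω a ha b hb c hc d hd hD.ne' y h1 h2 h3 hdy with rfl | rfl | rfl
  · simp only [det3_eq] at hD'; ring_nf at hD'; omega
  · simp only [det3_eq] at hD'; ring_nf at hD'; omega
  · rfl

theorem exists_isTriangle (hV : PositivelySpans V) (hω : ∀ v ∈ V, 0 < ω v) :
    ∃ a b c, IsTriangle V ω a b c := by
  have h0 : Feasible V ω 0 := fun v hv => by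
    have : pairing v 0 = 0 := by simp [pairing]
    rw [this]; linarith [hω v hv]
  obtain ⟨t, -, a, ha, hy, hay, -⟩ := h0.exists_tight_on_ray hV
    (n := Pi.single 0 1) (by simp)
  set y := (0 : Fin 3 → ℝ) + t • Pi.single 0 1
  have ha0 : a ≠ 0 := by
    rintro rfl
    have := hω 0 ha
    simp [pairing] at hay
    linarith
  obtain ⟨u, hu⟩ : ∃ u, cross3 a u ≠ 0 := by
    by_contra! hall
    apply ha0
    have g0 := congrFun (hall (Pi.single 1 1))
    have g1 := congrFun (hall (Pi.single 2 1))
    have i0 := g0 0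
    have i1 := g0 2
    have i2 := g1 1
    have i3 := g1 0
    simp [cross3] at i0 i1 i2 i3
    ext i
    fin_cases i <;> simp [*]
  obtain ⟨s, -, b, hb, hz, hbz, hbn⟩ := hy.exists_tight_on_ray hV (crossReal_ne_zero hu)
  have hab : cross3 a b ≠ 0 := by
    intro h0
    have : det3 b a u = dot3 u (cross3 b a) := det3_rotate u b a
    have h1 : cross3 b a = -cross3 a b := by
      ext i; fin_cases i <;> simp [cross3] <;> ring
    rw [pairing_crossReal, this, h1, h0] at hbn
    simp [dot3] at hbn
  have haz : pairing a (y + s • crossReal a u) = -ω a := by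
    rw [pairing_add, pairing_smul, pairing_crossReal, hay,
      show det3 a a u = 0 by simp only [det3_eq]; ring]
    simp
  obtain ⟨c, hc, hD, t, -, g0, g1, g2, g3⟩ := hz.exists_isTriangle hV hab haz hbz
  exact ⟨a, b, c, ⟨ha, hb, hc⟩, hD, _, g0, g1, g2, g3⟩

theorem exists_isTriangle_mem_cone (hV : PositivelySpans V) (hω : ∀ v ∈ V, 0 < ω v)
    (hgen : GenericWeight V ω) {q : Fin 3 → ℤ}
    (hq : ∀ a b c, IsTriangle V ω a b c → det3 q a b ≠ 0) :
    ∃ a b c, IsTriangle V ω a b c ∧ 0 < det3 q a b ∧ 0 < det3 q b c ∧ 0 < det3 q c a := by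
  classical
  let cost : (Fin 3 → ℤ) × (Fin 3 → ℤ) × (Fin 3 → ℤ) → ℝ := fun x =>
    (det3 q x.2.1 x.2.2 * ω x.1 + det3 q x.2.2 x.1 * ω x.2.1 + det3 q x.1 x.2.1 * ω x.2.2)
      / det3 x.1 x.2.1 x.2.2
  have cost_eq {a b c : Fin 3 → ℤ} (hD : 0 < det3 a b c) {y : Fin 3 → ℝ}
      (h1 : pairing a y = -ω a) (h2 : pairing b y = -ω b) (h3 : pairing c y = -ω c) :
      cost (a, b, c) = -pairing q y := by
    have hR : (det3 a b c : ℝ) ≠ 0 := by exact_mod_cast hD.ne'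
    have := det3_mul_pairing a b c q y
    rw [h1, h2, h3] at this
    simp only [cost]
    field_simp
    linarith
  obtain ⟨a₀, b₀, c₀, h₀⟩ := exists_isTriangle hV hω
  obtain ⟨⟨a, b, c⟩, hx, hmax⟩ := Finset.exists_max_image
    ((V ×ˢ V ×ˢ V).filter fun x => IsTriangle V ω x.1 x.2.1 x.2.2) cost
    ⟨(a₀, b₀, c₀), by simp only [mem_filter, mem_product]; exact ⟨h₀.1, h₀⟩⟩
  rw [mem_filter] at hx
  have hT : IsTriangle V ω a b c := hx.2
  have step {u v w : Fin 3 → ℤ} (h : IsTriangle V ω u v w)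
      (hcost : cost (u, v, w) = cost (a, b, c)) : 0 < det3 q u v := by
    apply lt_of_le_of_ne _ (hq u v w h).symm
    obtain ⟨⟨hu, hv, hw⟩, hD, y, hy, h1, h2, h3⟩ := id h
    obtain ⟨d, hd, hD', t, ht, g0, g1, g2, g3⟩ := hy.exists_isTriangle hV
      (cross3_swap_ne_zero (cross3_ne_zero_of_det3 hD.ne')) h2 h1
    have hvud : IsTriangle V ω v u d := ⟨⟨hv, hu, hd⟩, hD', _, g0, g1, g2, g3⟩
    have hle := hmax (v, u, d) (by simp only [mem_filter, mem_product]; exact ⟨hvud.1, hvud⟩)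
    rw [← hcost, cost_eq hD' g1 g2 g3, cost_eq hD h1 h2 h3, pairing_sub, pairing_smul,
      pairing_crossReal, det3_swap_right] at hle
    have ht0 : t ≠ 0 := by
      rintro rfl
      rw [zero_smul, sub_zero] at g3
      rcases hgen u hu v hv w hw d hd hD.ne' y h1 h2 h3 g3 with rfl | rfl | rfl
      · simp only [det3_eq] at hD'; ring_nf at hD'; omega
      · simp only [det3_eq] at hD'; ring_nf at hD'; omega
      · rw [det3_swap] at hD'; omega
    have htp : 0 < t := lt_of_le_of_ne ht ht0.symm
    push_cast at hle
    have : (0 : ℝ) ≤ det3 q u v := by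
      by_contra! hneg
      have := mul_neg_of_pos_of_neg htp hneg
      linarith
    exact_mod_cast this
  obtain ⟨-, hD, y, hy, h1, h2, h3⟩ := id hT
  refine ⟨a, b, c, hT, step hT rfl, step hT.rotate ?_, step hT.rotate.rotate ?_⟩
  · rw [cost_eq hD h1 h2 h3, cost_eq hT.rotate.2.1 h2 h3 h1]
  · rw [cost_eq hD h1 h2 h3, cost_eq hT.rotate.rotate.2.1 h3 h1 h2]

theorem IsTriangle.eq_rotation_of_mem_cone (hgen : GenericWeight V ω) {q a b c u v w : Fin 3 → ℤ}
    (h : IsTriangle V ω a b c) (hx : 0 < det3 q a b) (hy : 0 < det3 q b c) (hz : 0 < det3 q c a)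
    (h' : IsTriangle V ω u v w) (hx' : 0 < det3 q u v) (hy' : 0 < det3 q v w)
    (hz' : 0 < det3 q w u) :
    (u = a ∧ v = b ∧ w = c) ∨ (u = b ∧ v = c ∧ w = a) ∨ (u = c ∧ v = a ∧ w = b) := by
  obtain ⟨⟨ha, hb, hc⟩, hD, y, hyf, h1, h2, h3⟩ := h
  obtain ⟨⟨hu, hv, hw⟩, hD', z, hzf, g1, g2, g3⟩ := h'
  have le {a b c : Fin 3 → ℤ} (ha : a ∈ V) (hb : b ∈ V) (hc : c ∈ V) (hD : 0 < det3 a b c)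
      (hx : 0 < det3 q a b) (hy : 0 < det3 q b c) (hz : 0 < det3 q c a) {y z : Fin 3 → ℝ}
      (h1 : pairing a y = -ω a) (h2 : pairing b y = -ω b) (h3 : pairing c y = -ω c)
      (hzf : Feasible V ω z) : pairing q y ≤ pairing q z ∧
        (pairing q y = pairing q z → pairing a z = -ω a ∧ pairing b z = -ω b ∧
          pairing c z = -ω c) := by
    have hDR : (0 : ℝ) < det3 a b c := by exact_mod_cast hD
    have hxR : (0 : ℝ) < det3 q a b := by exact_mod_cast hx
    have hyR : (0 : ℝ) < det3 q b c := by exact_mod_cast hy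
    have hzR : (0 : ℝ) < det3 q c a := by exact_mod_cast hz
    have e1 := det3_mul_pairing a b c q y
    have e2 := det3_mul_pairing a b c q z
    rw [h1, h2, h3] at e1
    have k1 := mul_nonneg hyR.le (show 0 ≤ pairing a z + ω a by linarith [hzf a ha])
    have k2 := mul_nonneg hzR.le (show 0 ≤ pairing b z + ω b by linarith [hzf b hb])
    have k3 := mul_nonneg hxR.le (show 0 ≤ pairing c z + ω c by linarith [hzf c hc])
    constructor
    · apply le_of_mul_le_mul_left _ hDR
      linarith
    · intro heq
      rw [heq, e2] at e1
      have z1 : (det3 q b c : ℝ) * (pairing a z + ω a) = 0 := by linarith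
      have z2 : (det3 q c a : ℝ) * (pairing b z + ω b) = 0 := by linarith
      have z3 : (det3 q a b : ℝ) * (pairing c z + ω c) = 0 := by linarith
      have y1 := (mul_eq_zero.mp z1).resolve_left hyR.ne'
      have y2 := (mul_eq_zero.mp z2).resolve_left hzR.ne'
      have y3 := (mul_eq_zero.mp z3).resolve_left hxR.ne'
      exact ⟨by linarith, by linarith, by linarith⟩
  have l1 := le ha hb hc hD hx hy hz h1 h2 h3 hzf
  have l2 := le hu hv hw hD' hx' hy' hz' g1 g2 g3 hyf
  obtain ⟨k1, k2, k3⟩ := l2.2 (le_antisymm l2.1 l1.1)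
  have m1 := hgen a ha b hb c hc u hu hD.ne' y h1 h2 h3 k1
  have m2 := hgen a ha b hb c hc v hv hD.ne' y h1 h2 h3 k2
  have m3 := hgen a ha b hb c hc w hw hD.ne' y h1 h2 h3 k3
  have n1 : u ≠ v := by rintro rfl; simp only [det3_eq] at hD'; ring_nf at hD'; omega
  have n2 : v ≠ w := by rintro rfl; simp only [det3_eq] at hD'; ring_nf at hD'; omega
  have n3 : w ≠ u := by rintro rfl; simp only [det3_eq] at hD'; ring_nf at hD'; omega
  have o1 : ¬ (u = b ∧ v = a ∧ w = c) := by
    rintro ⟨rfl, rfl, rfl⟩; rw [det3_swap] at hD'; omega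
  have o2 : ¬ (u = a ∧ v = c ∧ w = b) := by
    rintro ⟨rfl, rfl, rfl⟩; rw [det3_swap_right] at hD'; omega
  have o3 : ¬ (u = c ∧ v = b ∧ w = a) := by
    rintro ⟨rfl, rfl, rfl⟩; rw [det3_swap, det3_rotate] at hD'; omega
  grind

end

section

variable {V : Finset (Fin 3 → ℤ)} {ω : (Fin 3 → ℤ) → ℝ}

theorem content_cross3_of_dot3_eq {l a b : Fin 3 → ℤ} (ha : dot3 l a = -1) (hb : dot3 l b = -1) :
    content (cross3 a b) = content (b - a) := by
  apply content_eq_of_dvd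
  · have h (i) : (content (b - a) : ℤ) ∣ b i - a i := content_dvd (b - a) i
    obtain ⟨x, hx⟩ := h 0
    obtain ⟨y, hy⟩ := h 1
    obtain ⟨z, hz⟩ := h 2
    rw [sub_eq_iff_eq_add] at hx hy hz
    intro i
    fin_cases i
    · exact ⟨a 1 * z - a 2 * y, by simp only [cross3, hx, hy, hz]; simp; ring⟩
    · exact ⟨a 2 * x - a 0 * z, by simp only [cross3, hx, hy, hz]; simp; ring⟩
    · exact ⟨a 0 * y - a 1 * x, by simp only [cross3, hx, hy, hz]; simp; ring⟩
  · apply dvd_content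
    intro i
    have h := content_dvd (cross3 a b)
    have e : (b - a) i = cross3 l (cross3 a b) i := by
      have e0 : cross3 l (cross3 a b) = dot3 l b • a - dot3 l a • b := by
        ext i; fin_cases i <;> simp [cross3, dot3] <;> ring
      rw [e0, ha, hb]
      simp; ring
    rw [e]
    fin_cases i
    · exact ((h 2).mul_left _).sub ((h 1).mul_left _)
    · exact ((h 0).mul_left _).sub ((h 2).mul_left _)
    · exact ((h 1).mul_left _).sub ((h 0).mul_left _)

theorem eq_of_cross3_eq_zero {l a b : Fin 3 → ℤ} (ha : dot3 l a = -1) (hb : dot3 l b = -1)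
    (h : cross3 a b = 0) : a = b := by
  have := content_cross3_of_dot3_eq ha hb
  rw [h, content_eq_zero.mpr rfl, eq_comm, content_eq_zero, sub_eq_zero] at this
  exact this.symm

theorem eq_of_dot3_eq {a b c l l' : Fin 3 → ℤ} (h : det3 a b c ≠ 0) (ha : dot3 l a = dot3 l' a)
    (hb : dot3 l b = dot3 l' b) (hc : dot3 l c = dot3 l' c) : l = l' := by
  have key (q : Fin 3 → ℤ) : dot3 l q = dot3 l' q := by
    apply mul_left_cancel₀ h
    rw [det3_mul_dot3 l, det3_mul_dot3 l', ha, hb, hc]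
  ext i
  have := key (Pi.single i 1)
  fin_cases i <;> simpa [dot3] using this

theorem signIndicator_eq_add (x y z : ℤ) : signIndicator x y z
    = (if 0 < x ∧ 0 < y ∧ 0 < z then 1 else 0) + (if x < 0 ∧ y < 0 ∧ z < 0 then 1 else 0) := by
  unfold signIndicator
  split_ifs <;> first | (exfalso; omega) | norm_num

/-- The summand on a pair of lattice points in the facet with normal `l`. -/
noncomputable def facetTerm (p l a b : Fin 3 → ℤ) : ℝ :=
  -(dot3 l p) * (1 / (det3 p a b : ℝ)) - edgeTerm p a b

theorem segmentSum_facetTerm (p l a b : Fin 3 → ℤ) :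
    segmentSum (facetTerm p l) a b = -(dot3 l p) * segmentSum (fun u v => 1 / (det3 p u v : ℝ)) a b
      - segmentSum (edgeTerm p) a b := by
  simp only [segmentSum, facetTerm]
  rw [sum_sub_distrib, mul_sum]

theorem inv_det3_swap (p a b : Fin 3 → ℤ) : 1 / (det3 p b a : ℝ) = -(1 / (det3 p a b : ℝ)) := by
  rw [det3_swap_right]; push_cast; rw [one_div, one_div, inv_neg]

theorem segmentSum_inv_det3 {p a b : Fin 3 → ℤ} (h : det3 p a b ≠ 0) :
    segmentSum (fun u v => 1 / (det3 p u v : ℝ)) a b = content (b - a) ^ 2 / det3 p a b := by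
  obtain ⟨w, hw, hb⟩ := exists_eq_add_smul a b
  set n := content (b - a)
  have hdet : det3 p a b = n * det3 p a w := by
    rw [hb]; simp only [det3_eq, Pi.add_apply, Pi.smul_apply, smul_eq_mul]; ring
  have hn : (n : ℝ) ≠ 0 := by
    rintro h0
    apply h
    rw [hdet, show n = 0 by exact_mod_cast h0]; simp
  have hk (k : ℕ) : det3 p (a + (k : ℤ) • w) (a + (k + 1 : ℤ) • w) = det3 p a w := by
    simp only [det3_eq, Pi.add_apply, Pi.smul_apply, smul_eq_mul]; ring
  rw [hdet, hb, segmentSum_add_smul _ _ hw]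
  simp only [hk, sum_const, card_range, nsmul_eq_mul]
  push_cast
  have : (det3 p a w : ℝ) ≠ 0 := by
    intro h0
    apply h
    rw [hdet, show det3 p a w = 0 by exact_mod_cast h0]; simp
  field_simp

/-- Over all rotations of triangles, exactly six contain `p` or `-p` in their cone. -/
theorem sum_signIndicator (hV : PositivelySpans V) (hω : ∀ v ∈ V, 0 < ω v)
    (hgen : GenericWeight V ω) {p : Fin 3 → ℤ}
    (hp : ∀ a b c, IsTriangle V ω a b c → det3 p a b ≠ 0)
    {T : Finset ((Fin 3 → ℤ) × (Fin 3 → ℤ) × (Fin 3 → ℤ))}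
    (hT : ∀ x, x ∈ T ↔ IsTriangle V ω x.1 x.2.1 x.2.2) :
    ∑ x ∈ T, signIndicator (det3 p x.1 x.2.1) (det3 p x.2.1 x.2.2) (det3 p x.2.2 x.1) = 6 := by
  have key (q : Fin 3 → ℤ) (hq : ∀ a b c, IsTriangle V ω a b c → det3 q a b ≠ 0) :
      ∑ x ∈ T, (if 0 < det3 q x.1 x.2.1 ∧ 0 < det3 q x.2.1 x.2.2 ∧ 0 < det3 q x.2.2 x.1
        then (1 : ℝ) else 0) = 3 := by
    obtain ⟨a, b, c, h, h1, h2, h3⟩ := exists_isTriangle_mem_cone hV hω hgen hq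
    have hD := h.2.1
    have hset : T.filter (fun x => 0 < det3 q x.1 x.2.1 ∧ 0 < det3 q x.2.1 x.2.2 ∧
        0 < det3 q x.2.2 x.1) = {(a, b, c), (b, c, a), (c, a, b)} := by
      ext ⟨u, v, w⟩
      simp only [mem_filter, hT, mem_insert, mem_singleton, Prod.mk.injEq]
      constructor
      · rintro ⟨h', g1, g2, g3⟩
        exact h.eq_rotation_of_mem_cone hgen h1 h2 h3 h' g1 g2 g3
      · rintro (⟨rfl, rfl, rfl⟩ | ⟨rfl, rfl, rfl⟩ | ⟨rfl, rfl, rfl⟩)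
        · exact ⟨h, h1, h2, h3⟩
        · exact ⟨h.rotate, h2, h3, h1⟩
        · exact ⟨h.rotate.rotate, h3, h1, h2⟩
    have n1 : a ≠ b := by rintro rfl; simp only [det3_eq] at hD; ring_nf at hD; omega
    have n2 : b ≠ c := by rintro rfl; simp only [det3_eq] at hD; ring_nf at hD; omega
    have n3 : c ≠ a := by rintro rfl; simp only [det3_eq] at hD; ring_nf at hD; omega
    rw [← sum_filter, hset, sum_const, card_eq_three.mpr ⟨(a, b, c), (b, c, a), (c, a, b), ?_, ?_,
      ?_, rfl⟩]
    · norm_num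
    all_goals simp only [ne_eq, Prod.mk.injEq]; tauto
  have hneg (u v : Fin 3 → ℤ) : det3 (-p) u v = -det3 p u v := by
    simp only [det3_eq, Pi.neg_apply]; ring
  have k1 := key p hp
  have k2 := key (-p) fun a b c h => by rw [hneg]; exact neg_ne_zero.mpr (hp a b c h)
  simp only [hneg, neg_pos] at k2
  simp only [signIndicator_eq_add]
  rw [sum_add_distrib, k1, k2]
  norm_num

/-- The lattice points of a polytope, as far as convexity within a facet is concerned. -/
def ConvexInFacets (D : Set (Fin 3 → ℤ)) : Prop :=
  ∀ l, ∀ a ∈ D, ∀ b ∈ D, ∀ c ∈ D, dot3 l a = -1 → dot3 l b = -1 → dot3 l c = -1 →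
    0 < det3 a b c → ∀ m, dot3 l m = -1 → 0 ≤ det3 m b c → 0 ≤ det3 m c a → 0 ≤ det3 m a b → m ∈ D

theorem sum_edges_segmentSum (hV : PositivelySpans V) (hω : ∀ v ∈ V, 0 < ω v)
    (hgen : GenericWeight V ω) {D : Set (Fin 3 → ℤ)} (hVD : ∀ v ∈ V, v ∈ D)
    (hD : ConvexInFacets D) {p : Fin 3 → ℤ}
    (hp : ∀ a ∈ D, ∀ b ∈ D, cross3 a b ≠ 0 → det3 p a b ≠ 0)
    {N : (Fin 3 → ℤ) → (Fin 3 → ℤ) → (Fin 3 → ℤ)}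
    (hN : ∀ a b c, IsTriangle V ω a b c →
      dot3 (N a b) a = -1 ∧ dot3 (N a b) b = -1 ∧ dot3 (N a b) c = -1)
    {A : Finset ((Fin 3 → ℤ) × (Fin 3 → ℤ))}
    (hA : ∀ x, x ∈ A ↔ ∃ c, IsTriangle V ω x.1 x.2 c) :
    ∑ x ∈ A, segmentSum (facetTerm p (N x.1 x.2)) x.1 x.2 = 24 := by
  classical
  let T := (V ×ˢ V ×ˢ V).filter fun x => IsTriangle V ω x.1 x.2.1 x.2.2
  have hT (x) : x ∈ T ↔ IsTriangle V ω x.1 x.2.1 x.2.2 := by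
    simp only [T, mem_filter, mem_product, and_iff_right_iff_imp]
    exact fun h => h.1
  have hNrot {a b c : Fin 3 → ℤ} (h : IsTriangle V ω a b c) : N b c = N a b := by
    obtain ⟨h1, h2, h3⟩ := hN _ _ _ h
    obtain ⟨g1, g2, g3⟩ := hN _ _ _ h.rotate
    exact eq_of_dot3_eq h.2.1.ne' (g3.trans h1.symm) (g1.trans h2.symm) (g2.trans h3.symm)
  let f : (Fin 3 → ℤ) × (Fin 3 → ℤ) × (Fin 3 → ℤ) → ℝ := fun x =>
    segmentSum (facetTerm p (N x.1 x.2.1)) x.1 x.2.1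
  have hAT : ∑ x ∈ A, segmentSum (facetTerm p (N x.1 x.2)) x.1 x.2 = ∑ x ∈ T, f x := by
    symm
    refine sum_bij (fun x _ => (x.1, x.2.1)) ?_ ?_ ?_ ?_
    · exact fun x hx => (hA _).mpr ⟨_, (hT x).mp hx⟩
    · rintro ⟨a, b, c⟩ hx ⟨a', b', c'⟩ hx' h
      simp only [Prod.mk.injEq] at h
      obtain ⟨rfl, rfl⟩ := h
      rw [hT] at hx hx'
      exact congrArg (fun c => (a, b, c)) (hx.third_unique hgen hx')
    · rintro ⟨a, b⟩ hx
      obtain ⟨c, hc⟩ := (hA _).mp hx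
      exact ⟨(a, b, c), (hT _).mpr hc, rfl⟩
    · exact fun _ _ => rfl
  have hrot (g : (Fin 3 → ℤ) × (Fin 3 → ℤ) × (Fin 3 → ℤ) → ℝ) :
      ∑ x ∈ T, g (x.2.1, x.2.2, x.1) = ∑ x ∈ T, g x := by
    refine sum_nbij' (fun x => (x.2.1, x.2.2, x.1)) (fun x => (x.2.2, x.1, x.2.1)) ?_ ?_ ?_ ?_ ?_
    · exact fun x hx => (hT _).mpr ((hT x).mp hx).rotate
    · exact fun x hx => (hT _).mpr ((hT x).mp hx).rotate.rotate
    · exact fun _ _ => rfl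
    · exact fun _ _ => rfl
    · exact fun _ _ => rfl
  have hsum : ∑ x ∈ T, (f x + f (x.2.1, x.2.2, x.1) + f (x.2.2, x.1, x.2.1)) = 12 * 6 := by
    rw [← sum_signIndicator hV hω hgen (fun a b c h => hp a (hVD a h.1.1) b (hVD b h.1.2.1)
      (cross3_ne_zero_of_det3 h.2.1.ne')) hT, mul_sum]
    refine sum_congr rfl ?_
    rintro ⟨a, b, c⟩ hx
    rw [hT] at hx
    have hx : IsTriangle V ω a b c := hx
    obtain ⟨h1, h2, h3⟩ := hN _ _ _ hx
    simp only [f]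
    rw [hNrot hx.rotate, hNrot hx]
    have hne {u v : Fin 3 → ℤ} (hu : u ∈ {m ∈ D | dot3 (N a b) m = -1})
        (hv : v ∈ {m ∈ D | dot3 (N a b) m = -1}) (huv : u ≠ v) : det3 p u v ≠ 0 :=
      hp u hu.1 v hv.1 fun h => huv (eq_of_cross3_eq_zero hu.2 hv.2 h)
    refine segmentSum_triangle (P := {m ∈ D | dot3 (N a b) m = -1}) ?_ (fun m hm => hm.2) ?_ ?_ ?_
      ⟨hVD _ hx.1.1, h1⟩ ⟨hVD _ hx.1.2.1, h2⟩ ⟨hVD _ hx.1.2.2, h3⟩ hx.2.1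
    · intro u v
      rw [facetTerm, facetTerm, inv_det3_swap, edgeTerm_swap]; ring
    · exact fun u hu v hv w hw hdet m hm g1 g2 g3 =>
        ⟨hD _ u hu.1 v hv.1 w hw.1 hu.2 hv.2 hw.2 hdet m hm g1 g2 g3, hm⟩
    · exact fun u hu v hv huv => hne hu hv huv
    · intro u hu v hv w hw hdet
      have n1 : u ≠ v := by rintro rfl; simp only [det3_eq] at hdet; ring_nf at hdet; omega
      have n2 : v ≠ w := by rintro rfl; simp only [det3_eq] at hdet; ring_nf at hdet; omega
      have n3 : w ≠ u := by rintro rfl; simp only [det3_eq] at hdet; ring_nf at hdet; omega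
      have e := edgeTerm_triangle hdet (hne hu hv n1) (hne hv hw n2) (hne hw hu n3)
      have hl := det3_mul_dot3 (N a b) u v w p
      rw [hdet, hu.2, hv.2, hw.2] at hl
      have hl' : ((det3 p u v + det3 p v w + det3 p w u : ℤ) : ℝ) = -(dot3 (N a b) p : ℝ) := by
        have : det3 p u v + det3 p v w + det3 p w u = -dot3 (N a b) p := by linarith
        exact_mod_cast this
      rw [hl'] at e
      simp only [facetTerm]
      linarith
  rw [sum_add_distrib, sum_add_distrib, hrot, ← hrot (fun x => f (x.2.2, x.1, x.2.1))] at hsum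
  rw [hAT]
  have : ∑ x ∈ T, f (x.1, x.2.1, x.2.2) = ∑ x ∈ T, f x := rfl
  linarith

theorem sum_edges_content (hV : PositivelySpans V) (hω : ∀ v ∈ V, 0 < ω v)
    (hgen : GenericWeight V ω) {D : Set (Fin 3 → ℤ)} (hVD : ∀ v ∈ V, v ∈ D)
    (hD : ConvexInFacets D) {p : Fin 3 → ℤ}
    (hp : ∀ a ∈ D, ∀ b ∈ D, cross3 a b ≠ 0 → det3 p a b ≠ 0)
    {N : (Fin 3 → ℤ) → (Fin 3 → ℤ) → (Fin 3 → ℤ)}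
    (hN : ∀ a b c, IsTriangle V ω a b c →
      dot3 (N a b) a = -1 ∧ dot3 (N a b) b = -1 ∧ dot3 (N a b) c = -1)
    (hNV : ∀ a b c, IsTriangle V ω a b c → ∀ v ∈ V, -1 ≤ dot3 (N a b) v)
    {A : Finset ((Fin 3 → ℤ) × (Fin 3 → ℤ))}
    (hA : ∀ x, x ∈ A ↔ ∃ c, IsTriangle V ω x.1 x.2 c) :
    ∑ x ∈ A, content (x.2 - x.1) * content (N x.2 x.1 - N x.1 x.2) = 48 := by
  have h24 := sum_edges_segmentSum hV hω hgen hVD hD hp hN hA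
  simp only [segmentSum_facetTerm] at h24
  have hswap {M : Type} [AddCommMonoid M] (g : (Fin 3 → ℤ) × (Fin 3 → ℤ) → M) :
      ∑ x ∈ A, g (x.2, x.1) = ∑ x ∈ A, g x := by
    refine sum_nbij' Prod.swap Prod.swap ?_ ?_ ?_ ?_ ?_
    · rintro x hx
      obtain ⟨c, hc⟩ := (hA x).mp hx
      exact (hA _).mpr (hc.exists_adjacent hV)
    · rintro x hx
      obtain ⟨c, hc⟩ := (hA x).mp hx
      exact (hA _).mpr (hc.exists_adjacent hV)
    · exact fun _ _ => rfl
    · exact fun _ _ => rfl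
    · exact fun _ _ => rfl
  have hG : ∑ x ∈ A, segmentSum (edgeTerm p) x.1 x.2 = 0 := by
    have h1 := hswap fun x => segmentSum (edgeTerm p) x.1 x.2
    have h2 : ∑ x ∈ A, segmentSum (edgeTerm p) x.2 x.1
        = -∑ x ∈ A, segmentSum (edgeTerm p) x.1 x.2 := by
      rw [← sum_neg_distrib]
      exact sum_congr rfl fun x _ => segmentSum_swap (edgeTerm_swap p) _ _
    linarith
  rw [sum_sub_distrib, hG, sub_zero] at h24
  have h24' := hswap fun x => -(dot3 (N x.1 x.2) p : ℝ)
    * segmentSum (fun u v => 1 / (det3 p u v : ℝ)) x.1 x.2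
  rw [h24] at h24'
  have h48 := congrArg₂ (· + ·) h24 h24'
  simp only [← sum_add_distrib] at h48
  have : ((∑ x ∈ A, content (x.2 - x.1) * content (N x.2 x.1 - N x.1 x.2) : ℕ) : ℝ) = 48 := by
    rw [show (48 : ℝ) = 24 + 24 by norm_num, ← h48]
    push_cast
    refine sum_congr rfl ?_
    rintro ⟨a, b⟩ hx
    obtain ⟨c, hc⟩ := (hA _).mp hx
    obtain ⟨d, hd⟩ := hc.exists_adjacent hV
    simp only at hc hd ⊢
    obtain ⟨l1, l2, l3⟩ := hN _ _ _ hc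
    obtain ⟨m1, m2, m3⟩ := hN _ _ _ hd
    have hdet : det3 p a b ≠ 0 := hp a (hVD a hc.1.1) b (hVD b hc.1.2.1)
      (cross3_ne_zero_of_det3 hc.2.1.ne')
    have hdetR : (det3 p a b : ℝ) ≠ 0 := by exact_mod_cast hdet
    have hcv := hNV _ _ _ hd c hc.1.2.2
    have hcontent := content_cross3_of_dot3_eq l1 l2
    have hD0 := hc.2.1
    rw [segmentSum_swap (inv_det3_swap p) a b, segmentSum_inv_det3 hdet]
    generalize N a b = l at *
    generalize N b a = m at *
    -- `m - l` is a multiple of the cross product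
    have hprop : det3 a b c • (m - l) = (dot3 m c - dot3 l c) • cross3 a b := by
      have e : det3 a b c • (m - l) = dot3 (m - l) a • cross3 b c + dot3 (m - l) b • cross3 c a
          + dot3 (m - l) c • cross3 a b := by
        ext i; fin_cases i <;> simp [cross3, dot3, det3_eq] <;> ring
      have e1 (q) : dot3 (m - l) q = dot3 m q - dot3 l q := by
        simp only [dot3, Pi.sub_apply]; ring
      rw [e, e1, e1, e1, l1, l2, m1, m2]; simp
    have hk : 0 ≤ dot3 m c - dot3 l c := by omega
    obtain ⟨k, hk'⟩ := Int.eq_ofNat_of_zero_le hk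
    obtain ⟨D0, hD0'⟩ := Int.eq_ofNat_of_zero_le hD0.le
    rw [hk', hD0'] at hprop
    have hcs (n : ℕ) (v : Fin 3 → ℤ) : content ((n : ℤ) • v) = n * content v := by
      obtain ⟨w, hw, hv⟩ := exists_eq_add_smul 0 v
      rw [sub_zero, zero_add] at hv
      conv_lhs => rw [hv, smul_smul, ← Nat.cast_mul]
      exact content_natCast_smul hw _
    have hct := congrArg content hprop
    rw [hcs, hcs, hcontent] at hct
    have hdp : (D0 : ℤ) * (dot3 m p - dot3 l p) = k * det3 p a b := by
      have := congrArg (dot3 p) hprop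
      simp only [dot3, Pi.smul_apply, smul_eq_mul, Pi.sub_apply] at this
      simp only [det3, dot3]
      linarith
    have hctR : (D0 : ℝ) * content (m - l) = k * content (b - a) := by exact_mod_cast hct
    have hdpR : (D0 : ℝ) * (dot3 m p - dot3 l p) = k * det3 p a b := by exact_mod_cast hdp
    have hD0R : (D0 : ℝ) ≠ 0 := by
      have : (D0 : ℤ) ≠ 0 := by omega
      exact_mod_cast this
    have : (content (m - l) : ℝ) * det3 p a b = content (b - a) * (dot3 m p - dot3 l p) := by
      apply mul_left_cancel₀ hD0R
      linear_combination det3 p a b * hctR - content (b - a) * hdpR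
    field_simp
    linear_combination (content (b - a) : ℝ) * this
  exact_mod_cast this

end

section

variable {V : Finset (Fin 3 → ℤ)} {ω : (Fin 3 → ℤ) → ℝ}

open Polynomial in
theorem eventually_eval_ne_zero {P : ℝ[X]} (hP : P ≠ 0) :
    ∀ᶠ t in nhdsWithin (0 : ℝ) (Set.Ioi 0), P.eval t ≠ 0 := by
  have hfin : Set.Finite ({t | P.IsRoot t} \ {0}) := (P.finite_setOfPred_isRoot hP).sdiff
  have h1 : ∀ᶠ t in nhdsWithin (0 : ℝ) (Set.Ioi 0), t ∈ ({t | P.IsRoot t} \ {0})ᶜ :=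
    nhdsWithin_le_nhds (hfin.isClosed.isOpen_compl.mem_nhds (by simp))
  filter_upwards [h1, self_mem_nhdsWithin] with t ht ht0 h
  exact ht ⟨h, (ht0 : 0 < t).ne'⟩

/-- The excess of the inequality at `d` over the vertex where those at `a`, `b`, `c` are tight,
scaled by the determinant. -/
def excess (ω : (Fin 3 → ℤ) → ℝ) (a b c d : Fin 3 → ℤ) : ℝ :=
  det3 a b c * ω d - (det3 d b c * ω a + det3 d c a * ω b + det3 d a b * ω c)

theorem det3_mul_pairing_add {a b c : Fin 3 → ℤ} {y : Fin 3 → ℝ} (ha : pairing a y = -ω a)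
    (hb : pairing b y = -ω b) (hc : pairing c y = -ω c) (d : Fin 3 → ℤ) :
    det3 a b c * (pairing d y + ω d) = excess ω a b c d := by
  rw [mul_add, det3_mul_pairing, ha, hb, hc, excess]; ring

theorem exists_pairing_eq {a b c : Fin 3 → ℤ} (h : det3 a b c ≠ 0) (α β γ : ℝ) :
    ∃ y, pairing a y = α ∧ pairing b y = β ∧ pairing c y = γ := by
  have hR : (det3 a b c : ℝ) ≠ 0 := by exact_mod_cast h
  refine ⟨(det3 a b c : ℝ)⁻¹ • (α • crossReal b c + β • crossReal c a + γ • crossReal a b),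
    ?_, ?_, ?_⟩ <;>
  simp only [pairing_smul, pairing_add, pairing_crossReal]
  · rw [show det3 a c a = 0 by simp only [det3_eq]; ring,
      show det3 a a b = 0 by simp only [det3_eq]; ring]
    push_cast
    field_simp
    ring
  · rw [det3_rotate a b c, show det3 b b c = 0 by simp only [det3_eq]; ring,
      show det3 b a b = 0 by simp only [det3_eq]; ring]
    push_cast
    field_simp
    ring
  · rw [show det3 c a b = det3 a b c by simp only [det3_eq]; ring,
      show det3 c b c = 0 by simp only [det3_eq]; ring,
      show det3 c c a = 0 by simp only [det3_eq]; ring]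
    push_cast
    field_simp
    ring

/-- Two distinct points of `V` spanning an edge of the convex hull of `V`. -/
def IsEdgePair (V : Finset (Fin 3 → ℤ)) (a b : Fin 3 → ℤ) : Prop :=
  a ∈ V ∧ b ∈ V ∧ a ≠ b ∧ ∃ y, Feasible V 1 y ∧ ∀ v ∈ V, pairing v y = -1 ↔ v = a ∨ v = b

theorem cross3_ne_zero_of_pairing {a b : Fin 3 → ℤ} (hab : a ≠ b) {y : Fin 3 → ℝ}
    (ha : pairing a y = -1) (hb : pairing b y = -1) : cross3 a b ≠ 0 := by
  intro h
  apply hab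
  have g0 := congrFun h 0
  have g1 := congrFun h 1
  have g2 := congrFun h 2
  simp only [cross3, Matrix.cons_val, Pi.zero_apply] at g0 g1 g2
  have g0' : (a 1 * b 2 - a 2 * b 1 : ℝ) = 0 := by exact_mod_cast g0
  have g1' : (a 2 * b 0 - a 0 * b 2 : ℝ) = 0 := by exact_mod_cast g1
  have g2' : (a 0 * b 1 - a 1 * b 0 : ℝ) = 0 := by exact_mod_cast g2
  simp only [pairing] at ha hb
  have key : ∀ i, (a i : ℝ) = b i := by
    intro i
    fin_cases i <;> simp only [Fin.zero_eta, Fin.mk_one, Fin.reduceFinMk]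
    · linear_combination (a 0 : ℝ) * hb - (b 0 : ℝ) * ha - y 1 * g2' + y 2 * g1'
    · linear_combination (a 1 : ℝ) * hb - (b 1 : ℝ) * ha + y 0 * g2' - y 2 * g0'
    · linear_combination (a 2 : ℝ) * hb - (b 2 : ℝ) * ha - y 0 * g1' + y 1 * g0'
  ext i
  exact_mod_cast key i

theorem det3_cross3_ne_zero {a b : Fin 3 → ℤ} (h : cross3 a b ≠ 0) :
    det3 a b (cross3 a b) ≠ 0 := by
  contrapose! h
  have e : det3 a b (cross3 a b) = cross3 a b 0 ^ 2 + cross3 a b 1 ^ 2 + cross3 a b 2 ^ 2 := by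
    simp [det3_eq, cross3]; ring
  rw [e] at h
  have k0 := sq_nonneg (cross3 a b 0)
  have k1 := sq_nonneg (cross3 a b 1)
  have k2 := sq_nonneg (cross3 a b 2)
  ext i
  fin_cases i <;> simp only [Fin.zero_eta, Fin.mk_one, Fin.reduceFinMk, Pi.zero_apply] <;>
    exact pow_eq_zero_iff (two_ne_zero) |>.mp (by linarith)

/-- A generic perturbation of the constant weight `1` refines the facets to triangles and keeps
the edges. -/
theorem exists_genericWeight (V : Finset (Fin 3 → ℤ)) : ∃ ω : (Fin 3 → ℤ) → ℝ,
    (∀ v ∈ V, 0 < ω v) ∧ GenericWeight V ω ∧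
    (∀ a b c, IsTriangle V ω a b c → ∃ y, Feasible V 1 y ∧ pairing a y = -1 ∧ pairing b y = -1 ∧
      pairing c y = -1) ∧
    ∀ a b, IsEdgePair V a b → ∃ y, Feasible V ω y ∧ pairing a y = -ω a ∧ pairing b y = -ω b := by
  classical
  obtain ⟨k, hk, hk0⟩ : ∃ k : (Fin 3 → ℤ) → ℕ, Function.Injective k ∧ ∀ v, k v ≠ 0 := by
    obtain ⟨f, hf⟩ := Countable.exists_injective_nat (Fin 3 → ℤ)
    exact ⟨fun v => f v + 1, fun u v h => hf (by simpa using h), fun v => by simp⟩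
  let W : ℝ → (Fin 3 → ℤ) → ℝ := fun t v => 1 + t ^ k v
  have hW0 : W 0 = 1 := by
    ext v; simp [W, hk0 v]
  have hcont (v) : Continuous fun t => W t v := by fun_prop
  have hexc (a b c d) : Continuous fun t => excess (W t) a b c d := by
    simp only [excess]; fun_prop
  have E1 : ∀ᶠ t in nhdsWithin (0 : ℝ) (Set.Ioi 0), ∀ v ∈ V, 0 < W t v := by
    filter_upwards [self_mem_nhdsWithin] with t ht v _
    have : 0 < t ^ k v := pow_pos ht _
    simp only [W]; linarith
  have E2 : ∀ᶠ t in nhdsWithin (0 : ℝ) (Set.Ioi 0), ∀ a ∈ V, ∀ b ∈ V, ∀ c ∈ V, ∀ d ∈ V,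
      det3 a b c ≠ 0 → d ≠ a → d ≠ b → d ≠ c → excess (W t) a b c d ≠ 0 := by
    simp only [Filter.eventually_all_finset]
    intro a _ b _ c _ d _
    by_cases h : det3 a b c ≠ 0 ∧ d ≠ a ∧ d ≠ b ∧ d ≠ c
    · obtain ⟨h, h1, h2, h3⟩ := h
      open Polynomial in
      let P : ℝ[X] := C (det3 a b c : ℝ) * (1 + X ^ k d) - (C (det3 d b c : ℝ) * (1 + X ^ k a)
        + C (det3 d c a : ℝ) * (1 + X ^ k b) + C (det3 d a b : ℝ) * (1 + X ^ k c))
      have hP : P ≠ 0 := by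
        intro h0
        have := congrArg (fun Q => Polynomial.coeff Q (k d)) h0
        simp only [P, Polynomial.coeff_sub, Polynomial.coeff_add, Polynomial.coeff_C_mul,
          Polynomial.coeff_one, Polynomial.coeff_X_pow, hk0 d, hk.eq_iff, h1, h2, h3,
          Polynomial.coeff_zero] at this
        simp at this
        exact h this
      filter_upwards [eventually_eval_ne_zero hP] with t ht _ _ _ _
      convert ht using 1
      simp [P, excess, W]
    · refine Filter.Eventually.of_forall fun t h0 h1 h2 h3 => ?_
      exact absurd ⟨h0, h1, h2, h3⟩ h
  have E3 : ∀ᶠ t in nhdsWithin (0 : ℝ) (Set.Ioi 0), ∀ a ∈ V, ∀ b ∈ V, ∀ c ∈ V, ∀ d ∈ V,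
      0 ≤ excess (W t) a b c d → 0 ≤ excess 1 a b c d := by
    simp only [Filter.eventually_all_finset]
    intro a _ b _ c _ d _
    by_cases h : 0 ≤ excess 1 a b c d
    · exact Filter.Eventually.of_forall fun _ _ => h
    · rw [← hW0] at h
      filter_upwards [nhdsWithin_le_nhds ((hexc a b c d).tendsto 0 (Iio_mem_nhds (not_le.mp h)))]
        with t ht h'
      exact absurd ht (not_lt.mpr h')
  have E4 : ∀ᶠ t in nhdsWithin (0 : ℝ) (Set.Ioi 0), ∀ a ∈ V, ∀ b ∈ V, IsEdgePair V a b →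
      ∃ y, Feasible V (W t) y ∧ pairing a y = -W t a ∧ pairing b y = -W t b := by
    simp only [Filter.eventually_all_finset]
    intro a ha b hb
    by_cases h : IsEdgePair V a b
    · obtain ⟨-, -, hab, y, hy, hyv⟩ := h
      have hay := (hyv a ha).mpr (Or.inl rfl)
      have hby := (hyv b hb).mpr (Or.inr rfl)
      have hdet := det3_cross3_ne_zero (cross3_ne_zero_of_pairing hab hay hby)
      obtain ⟨z₁, h1a, h1b, -⟩ := exists_pairing_eq hdet (-1) 0 0
      obtain ⟨z₂, h2a, h2b, -⟩ := exists_pairing_eq hdet 0 (-1) 0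
      have hev : ∀ᶠ t in nhdsWithin (0 : ℝ) (Set.Ioi 0), ∀ v ∈ V, v ≠ a → v ≠ b →
          0 < pairing v (y + t ^ k a • z₁ + t ^ k b • z₂) + W t v := by
        simp only [Filter.eventually_all_finset]
        intro v hv
        by_cases hvab : v = a ∨ v = b
        · exact Filter.Eventually.of_forall fun _ h1 h2 => absurd hvab (by tauto)
        · have hc : Continuous fun t : ℝ => pairing v (y + t ^ k a • z₁ + t ^ k b • z₂) + W t v := by
            simp only [pairing_add, pairing_smul]; fun_prop
          have h0 : 0 < pairing v (y + (0 : ℝ) ^ k a • z₁ + (0 : ℝ) ^ k b • z₂) + W 0 v := by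
            rw [hW0]
            simp only [ne_eq, hk0, not_false_eq_true, zero_pow, zero_smul, add_zero, Pi.one_apply]
            have := lt_of_le_of_ne (hy v hv) fun h => hvab ((hyv v hv).mp h.symm)
            simp only [Pi.one_apply] at this
            linarith
          filter_upwards [nhdsWithin_le_nhds (hc.tendsto 0 (Ioi_mem_nhds h0))] with t ht _ _
          exact ht
      filter_upwards [hev] with t ht _
      have ea : pairing a (y + t ^ k a • z₁ + t ^ k b • z₂) = -W t a := by
        simp only [pairing_add, pairing_smul, hay, h1a, h2a, W]; ring
      have eb : pairing b (y + t ^ k a • z₁ + t ^ k b • z₂) = -W t b := by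
        simp only [pairing_add, pairing_smul, hby, h1b, h2b, W]; ring
      refine ⟨_, fun v hv => ?_, ea, eb⟩
      by_cases hva : v = a
      · rw [hva, ea]
      by_cases hvb : v = b
      · rw [hvb, eb]
      linarith [ht v hv hva hvb]
    · exact Filter.Eventually.of_forall fun t h' => absurd h' h
  obtain ⟨t, h1, h2, h3, h4⟩ := (E1.and (E2.and (E3.and E4))).exists
  refine ⟨W t, h1, ?_, ?_, fun a b h => h4 a h.1 b h.2.1 h⟩
  · intro a ha b hb c hc d hd hdet y hay hby hcy hdy
    by_contra! hne
    apply h2 a ha b hb c hc d hd hdet hne.1 hne.2.1 hne.2.2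
    rw [← det3_mul_pairing_add hay hby hcy, hdy]
    simp
  · rintro a b c ⟨⟨ha, hb, hc⟩, hdet, y, hy, hay, hby, hcy⟩
    have hR : (0 : ℝ) < det3 a b c := by exact_mod_cast hdet
    obtain ⟨z, hza, hzb, hzc⟩ := exists_pairing_eq hdet.ne' (-1) (-1) (-1)
    refine ⟨z, fun v hv => ?_, hza, hzb, hzc⟩
    have k1 : 0 ≤ excess (W t) a b c v := by
      rw [← det3_mul_pairing_add hay hby hcy]
      exact mul_nonneg hR.le (by linarith [hy v hv])
    have k2 := h3 a ha b hb c hc v hv k1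
    rw [← det3_mul_pairing_add (ω := 1) hza hzb hzc] at k2
    have := nonneg_of_mul_nonneg_right k2 hR
    linarith

open Polynomial in
theorem exists_det3_ne_zero {D : Set (Fin 3 → ℤ)} (hD : D.Finite) :
    ∃ p : Fin 3 → ℤ, ∀ a ∈ D, ∀ b ∈ D, cross3 a b ≠ 0 → det3 p a b ≠ 0 := by
  classical
  let P : (Fin 3 → ℤ) → ℤ[X] := fun u => C (u 0) + C (u 1) * X + C (u 2) * X ^ 2
  have hP (u) (hu : u ≠ 0) : P u ≠ 0 := by
    contrapose! hu
    ext i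
    have := congrArg (fun Q => Polynomial.coeff Q i) hu
    fin_cases i <;> simpa [P, coeff_C, coeff_X, coeff_X_pow, -eq_intCast] using this
  have hfin : Set.Finite (⋃ x ∈ (D ×ˢ D) ∩ {x | cross3 x.1 x.2 ≠ 0},
      {n : ℤ | (P (cross3 x.1 x.2)).IsRoot n}) :=
    ((hD.prod hD).inter_of_left _).biUnion fun x hx => (P _).finite_setOfPred_isRoot (hP _ hx.2)
  obtain ⟨n, hn⟩ := hfin.exists_notMem
  refine ⟨![1, n, n ^ 2], fun a ha b hb hab h => hn ?_⟩
  simp only [Set.mem_iUnion]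
  refine ⟨(a, b), ⟨⟨ha, hb⟩, hab⟩, ?_⟩
  rw [Set.mem_ofPred_eq, IsRoot.def]
  rw [← h]
  simp [P, det3, dot3]
  ring

end

/-- An integer vector, as a point of `ℝ³`. -/
def latticeVec (v : Fin 3 → ℤ) : Fin 3 → ℝ := fun i => (v i : ℝ)

theorem latticeVec_injective : Function.Injective latticeVec := fun u v h => by
  ext i
  exact Int.cast_injective (congrFun h i)

theorem isLatticePoint_iff {x : Fin 3 → ℝ} : IsLatticePoint x ↔ ∃ v, latticeVec v = x := by
  constructor
  · intro h
    choose v hv using h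
    exact ⟨v, funext fun i => (hv i).symm⟩
  · rintro ⟨v, rfl⟩ i
    exact ⟨v i, rfl⟩

theorem dotp_latticeVec (v : Fin 3 → ℤ) (y : Fin 3 → ℝ) : dotp (latticeVec v) y = pairing v y := by
  simp [dotp, Fin.sum_univ_three, pairing, latticeVec]

theorem pairing_latticeVec (v l : Fin 3 → ℤ) : pairing v (latticeVec l) = dot3 l v := by
  simp only [pairing, latticeVec, dot3]; push_cast; ring

/-- The standard dot product with a fixed vector, as a linear functional. -/
def dotpLinear (y : Fin 3 → ℝ) : (Fin 3 → ℝ) →ₗ[ℝ] ℝ where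
  toFun x := dotp x y
  map_add' x z := by simp [dotp, Fin.sum_univ_three]; ring
  map_smul' t x := by simp [dotp, Fin.sum_univ_three]; ring

theorem dotpLinear_apply (x y : Fin 3 → ℝ) : dotpLinear y x = dotp x y := rfl

/-- `V` is the vertex set of the lattice polytope `Δ`. -/
def IsVertexSet (V : Finset (Fin 3 → ℤ)) (Δ : Set (Fin 3 → ℝ)) : Prop :=
  (∀ v ∈ V, latticeVec v ∈ Δ.extremePoints ℝ) ∧ Δ = convexHull ℝ (latticeVec '' V)

theorem IsLatticePolytope.exists_isVertexSet {Δ : Set (Fin 3 → ℝ)} (h : IsLatticePolytope Δ) :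
    ∃ V, IsVertexSet V Δ := by
  obtain ⟨S, hfin, hS, rfl⟩ := h
  have hsub : (convexHull ℝ S).extremePoints ℝ ⊆ S := extremePoints_convexHull_subset
  have hfin' := hfin.subset hsub
  have hpre := hfin'.preimage (latticeVec_injective.injOn)
  refine ⟨hpre.toFinset, fun v hv => by simpa using hv, ?_⟩
  have himg : latticeVec '' (hpre.toFinset : Set (Fin 3 → ℤ))
      = (convexHull ℝ S).extremePoints ℝ := by
    rw [Set.Finite.coe_toFinset, Set.image_preimage_eq_of_subset]
    intro x hx
    obtain ⟨v, hv⟩ := isLatticePoint_iff.mp (hS x (hsub hx))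
    exact ⟨v, hv⟩
  rw [himg, ← (hfin'.isClosed_convexHull ℝ).closure_eq, closure_convexHull_extremePoints
    (hfin.isCompact_convexHull ℝ) (convex_convexHull ℝ S)]

section

variable {V : Finset (Fin 3 → ℤ)} {Δ : Set (Fin 3 → ℝ)}

theorem IsVertexSet.mem (h : IsVertexSet V Δ) {v : Fin 3 → ℤ} (hv : v ∈ V) : latticeVec v ∈ Δ :=
  (h.1 v hv).1

theorem IsVertexSet.convex (h : IsVertexSet V Δ) : Convex ℝ Δ := by
  rw [h.2]; exact convex_convexHull ℝ _

theorem IsVertexSet.dotp_le_iff (h : IsVertexSet V Δ) {y : Fin 3 → ℝ} {c : ℝ} :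
    (∀ x ∈ Δ, dotp x y ≤ c) ↔ ∀ v ∈ V, pairing v y ≤ c := by
  constructor
  · intro h' v hv
    rw [← dotp_latticeVec]
    exact h' _ (h.mem hv)
  · intro h' x hx
    rw [h.2] at hx
    refine convexHull_min ?_ (convex_halfSpace_le (dotpLinear y).isLinear c) hx
    rintro _ ⟨v, hv, rfl⟩
    simpa [dotpLinear_apply, dotp_latticeVec] using h' v hv

theorem dotp_neg (x y : Fin 3 → ℝ) : dotp x (-y) = -dotp x y := by
  simp [dotp]

theorem IsVertexSet.mem_dualSet_iff (h : IsVertexSet V Δ) {y : Fin 3 → ℝ} :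
    y ∈ dualSet Δ ↔ Feasible V 1 y := by
  have := h.dotp_le_iff (y := -y) (c := 1)
  simp only [dotp_neg, pairing_neg] at this
  simp only [dualSet, Set.mem_ofPred_eq, Feasible, Pi.one_apply]
  constructor
  · intro h' v hv
    linarith [this.mp (fun x hx => by linarith [h' x hx]) v hv]
  · intro h' x hx
    linarith [this.mpr (fun v hv => by linarith [h' v hv]) x hx]

theorem IsVertexSet.face_eq (h : IsVertexSet V Δ) {y : Fin 3 → ℝ} {c : ℝ}
    (hy : ∀ v ∈ V, pairing v y ≤ c) :
    {x ∈ Δ | dotp x y = c} = convexHull ℝ (latticeVec '' {v ∈ V | pairing v y = c}) := by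
  classical
  apply Set.Subset.antisymm
  · rintro x ⟨hx, hxc⟩
    rw [h.2, ← Finset.coe_image, Finset.mem_convexHull] at hx
    obtain ⟨w, hw0, hw1, hwx⟩ := hx
    rw [Finset.centerMass_eq_of_sum_1 _ _ hw1] at hwx
    simp only [id] at hwx
    have hle : ∀ z ∈ V.image latticeVec, 0 ≤ w z * (c - dotp z y) := by
      intro z hz
      obtain ⟨v, hv, rfl⟩ := Finset.mem_image.mp hz
      rw [dotp_latticeVec]
      exact mul_nonneg (hw0 _ hz) (by linarith [hy v hv])
    have hsum : ∑ z ∈ V.image latticeVec, w z * (c - dotp z y) = 0 := by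
      have : dotpLinear y x = ∑ z ∈ V.image latticeVec, w z * dotp z y := by
        rw [← hwx, map_sum]
        simp [dotpLinear_apply]
      rw [dotpLinear_apply, hxc] at this
      simp only [mul_sub]
      rw [sum_sub_distrib, ← sum_mul, hw1, ← this]
      ring
    rw [sum_eq_zero_iff_of_nonneg hle] at hsum
    rw [← hwx, ← sum_filter_of_ne (p := fun z => dotp z y = c)]
    · refine (convex_convexHull ℝ _).sum_mem (fun z hz => hw0 z (mem_filter.mp hz).1) ?_ ?_
      · rw [sum_filter_of_ne, hw1]
        intro z hz hne
        have := (mul_eq_zero.mp (hsum z hz)).resolve_left hne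
        linarith
      · intro z hz
        rw [mem_filter] at hz
        obtain ⟨v, hv, rfl⟩ := Finset.mem_image.mp hz.1
        refine subset_convexHull ℝ _ ⟨v, ⟨hv, ?_⟩, rfl⟩
        rw [← dotp_latticeVec]; exact hz.2
    · intro z hz hne
      have : w z ≠ 0 := fun h0 => hne (by rw [h0, zero_smul])
      have := (mul_eq_zero.mp (hsum z hz)).resolve_left this
      linarith
  · refine convexHull_min ?_ ?_
    · rintro _ ⟨v, hv, rfl⟩
      exact ⟨h.mem hv.1, by rw [dotp_latticeVec]; exact hv.2⟩
    · exact h.convex.inter (convex_hyperplane (dotpLinear y).isLinear c)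

theorem IsVertexSet.not_collinear (h : IsVertexSet V Δ) {a b c : Fin 3 → ℤ} (ha : a ∈ V)
    (hb : b ∈ V) (hc : c ∈ V) (hab : a ≠ b) (hbc : b ≠ c) (hca : c ≠ a) :
    ¬ Collinear ℝ {latticeVec a, latticeVec b, latticeVec c} := by
  intro hcol
  have key {u v w : Fin 3 → ℤ} (hu : u ∈ V) (hv : v ∈ V) (hw : w ∈ V) (huv : u ≠ v) (hvw : v ≠ w) :
      ¬ Wbtw ℝ (latticeVec u) (latticeVec v) (latticeVec w) := by
    intro hb
    rw [← mem_segment_iff_wbtw] at hb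
    rcases (mem_extremePoints_iff_forall_segment.mp (h.1 v hv)).2 _ (h.mem hu) _ (h.mem hw) hb
      with h | h
    · exact huv (latticeVec_injective h)
    · exact hvw (latticeVec_injective h).symm
  rcases hcol.wbtw_or_wbtw_or_wbtw with h' | h' | h'
  · exact key ha hb hc hab hbc h'
  · exact key hb hc ha hbc hca h'
  · exact key hc ha hb hca hab h'

theorem IsVertexSet.positivelySpans (h : IsVertexSet V Δ) (h0 : (0 : Fin 3 → ℝ) ∈ interior Δ) :
    PositivelySpans V := by
  intro n hn
  by_contra! hall
  have hle := h.dotp_le_iff (y := -n) (c := 0) |>.mpr fun v hv => by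
    rw [pairing_neg]; linarith [hall v hv]
  have hev : ∀ᶠ t : ℝ in nhdsWithin 0 (Set.Ioi 0), t • (-n) ∈ Δ := by
    have hc : Continuous fun t : ℝ => t • (-n) := by fun_prop
    apply nhdsWithin_le_nhds
    apply hc.tendsto 0
    simpa using mem_interior_iff_mem_nhds.mp h0
  obtain ⟨t, ht, ht0⟩ := (hev.and self_mem_nhdsWithin).exists
  have h1 := hle _ ht
  rw [← dotpLinear_apply, map_smul, dotpLinear_apply, smul_eq_mul] at h1
  have ht0 : (0 : ℝ) < t := ht0
  have h2 : 0 < dotp (-n) (-n) := by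
    simp only [dotp]
    have hne : (-n) ≠ 0 := neg_ne_zero.mpr hn
    obtain ⟨i, hi⟩ := Function.ne_iff.mp hne
    refine sum_pos' (fun i _ => mul_self_nonneg _) ⟨i, mem_univ _, ?_⟩
    exact mul_self_pos.mpr hi
  nlinarith

theorem IsVertexSet.finite_setOf_latticeVec_mem (h : IsVertexSet V Δ) : {m | latticeVec m ∈ Δ}.Finite := by
  have hc : IsCompact Δ := by
    rw [h.2]; exact (V.finite_toSet.image _).isCompact_convexHull ℝ
  obtain ⟨R, hR⟩ := hc.isBounded.exists_norm_le
  obtain ⟨M, hM⟩ := exists_nat_ge R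
  refine (Set.finite_Icc (fun _ : Fin 3 => -(M : ℤ)) (fun _ => (M : ℤ))).subset fun m hm => ?_
  have hb (i) : |(m i : ℝ)| ≤ M :=
    ((norm_le_pi_norm (latticeVec m) i).trans (hR _ hm)).trans hM
  have hb' (i) : |m i| ≤ M := by exact_mod_cast hb i
  exact ⟨fun i => (abs_le.mp (hb' i)).1, fun i => (abs_le.mp (hb' i)).2⟩

theorem convexInFacets_of_convex (h : Convex ℝ Δ) : ConvexInFacets {m | latticeVec m ∈ Δ} := by
  intro l a ha b hb c hc la lb lc hD m lm h1 h2 h3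
  have hsum : det3 m b c + det3 m c a + det3 m a b = det3 a b c := by
    have := det3_mul_dot3 l a b c m
    rw [la, lb, lc, lm] at this
    linarith
  have hcr := det3_cramer a b c m
  have hD' : (0 : ℝ) < det3 a b c := by exact_mod_cast hD
  have hsum' : (det3 m b c + det3 m c a + det3 m a b : ℝ) = det3 a b c := by exact_mod_cast hsum
  have e : latticeVec m = (det3 m b c / det3 a b c : ℝ) • latticeVec a
      + (det3 m c a / det3 a b c : ℝ) • latticeVec b
      + (det3 m a b / det3 a b c : ℝ) • latticeVec c := by
    ext i
    have := congrFun hcr i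
    simp only [Pi.smul_apply, Pi.add_apply, smul_eq_mul] at this
    have : (det3 a b c * m i : ℝ) = det3 m b c * a i + det3 m c a * b i + det3 m a b * c i := by
      exact_mod_cast this
    simp only [latticeVec, Pi.smul_apply, Pi.add_apply, smul_eq_mul]
    field_simp
    linarith
  have h1' : (0 : ℝ) ≤ det3 m b c := by exact_mod_cast h1
  have h2' : (0 : ℝ) ≤ det3 m c a := by exact_mod_cast h2
  have h3' : (0 : ℝ) ≤ det3 m a b := by exact_mod_cast h3
  change latticeVec m ∈ Δ
  have := h.sum_mem (t := univ) (w := ![(det3 m b c / det3 a b c : ℝ), det3 m c a / det3 a b c,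
    det3 m a b / det3 a b c]) (z := ![latticeVec a, latticeVec b, latticeVec c]) ?_ ?_ ?_
  · rw [e]
    simpa [Fin.sum_univ_three] using this
  · intro i _
    fin_cases i <;> simp <;> positivity
  · simp [Fin.sum_univ_three]
    field_simp
    exact hsum'
  · intro i _
    fin_cases i
    exacts [ha, hb, hc]

end

theorem faceDim_segment {a b : Fin 3 → ℝ} (hab : a ≠ b) : faceDim (segment ℝ a b) = 1 := by
  rw [faceDim, ← convexHull_pair, ← direction_affineSpan, affineSpan_convexHull,
    direction_affineSpan, vectorSpan_pair_rev]
  exact finrank_span_singleton (sub_ne_zero.mpr hab.symm)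

theorem faceDim_eq_three {Δ : Set (Fin 3 → ℝ)} (h0 : (interior Δ).Nonempty) : faceDim Δ = 3 := by
  rw [faceDim, ← direction_affineSpan, affineSpan_eq_top_of_nonempty_interior
    (h0.mono (interior_mono (subset_convexHull ℝ Δ))), AffineSubspace.direction_top, finrank_top]
  simp

section

variable {V : Finset (Fin 3 → ℤ)} {Δ : Set (Fin 3 → ℝ)}

theorem isFaceOf_of_feasible (h : IsVertexSet V Δ) {y : Fin 3 → ℝ} (hy : Feasible V 1 y)
    {a : Fin 3 → ℤ} (ha : a ∈ V) (hay : pairing a y = -1) :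
    IsFaceOf {x ∈ Δ | dotp x (-y) = 1} Δ := by
  refine ⟨⟨latticeVec a, h.mem ha, ?_⟩, -y, 1, ?_, rfl⟩
  · rw [dotp_latticeVec, pairing_neg, hay, neg_neg]
  · rw [h.dotp_le_iff]
    intro v hv
    have := hy v hv
    rw [Pi.one_apply] at this
    rw [pairing_neg]
    linarith

theorem IsEdgePair.isFaceOf (h : IsVertexSet V Δ) {a b : Fin 3 → ℤ} (hab : IsEdgePair V a b) :
    IsFaceOf (segment ℝ (latticeVec a) (latticeVec b)) Δ ∧
      faceDim (segment ℝ (latticeVec a) (latticeVec b)) = 1 := by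
  obtain ⟨ha, hb, hne, y, hy, hyv⟩ := hab
  refine ⟨?_, faceDim_segment (latticeVec_injective.ne hne)⟩
  have e : {x ∈ Δ | dotp x (-y) = 1} = segment ℝ (latticeVec a) (latticeVec b) := by
    rw [h.face_eq, ← convexHull_pair]
    · congr 1
      rw [← Set.image_pair]
      congr 1
      ext v
      simp only [pairing_neg, Set.mem_ofPred_eq, Set.mem_insert_iff, Set.mem_singleton_iff]
      constructor
      · rintro ⟨hv, hv'⟩
        exact (hyv v hv).mp (by linarith)
      · intro hv
        have hvV : v ∈ V := by rcases hv with rfl | rfl <;> assumption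
        exact ⟨hvV, by rw [(hyv v hvV).mpr hv, neg_neg]⟩
    · intro v hv
      have := hy v hv
      rw [Pi.one_apply] at this
      rw [pairing_neg]
      linarith
  rw [← e]
  exact isFaceOf_of_feasible h hy ha ((hyv a ha).mpr (Or.inl rfl))

theorem exists_isEdgePair (h : IsVertexSet V Δ) (h0 : (0 : Fin 3 → ℝ) ∈ interior Δ)
    {F : Set (Fin 3 → ℝ)} (hF : IsFaceOf F Δ) (hdim : faceDim F = 1) :
    ∃ a b, IsEdgePair V a b ∧ F = segment ℝ (latticeVec a) (latticeVec b) := by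
  classical
  obtain ⟨hne, u, c, hle, rfl⟩ := hF
  have hleV := h.dotp_le_iff.mp hle
  have hc : 0 < c := by
    have hc0 : 0 ≤ c := by simpa [dotp] using hle 0 (interior_subset h0)
    rcases hc0.eq_or_lt with rfl | hc
    · exfalso
      by_cases hu : u = 0
      · have : {x ∈ Δ | dotp x u = 0} = Δ := by
          ext x; simp [hu, dotp]
        rw [this, faceDim_eq_three ⟨0, h0⟩] at hdim
        omega
      · obtain ⟨v, hv, hv'⟩ := h.positivelySpans h0 (-u) (neg_ne_zero.mpr hu)
        rw [pairing_neg] at hv'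
        linarith [hleV v hv]
    · exact hc
  have hface := h.face_eq hleV
  have hcol : Collinear ℝ {x ∈ Δ | dotp x u = c} := by
    rw [collinear_iff_finrank_le_one]
    exact hdim.le
  obtain ⟨S, hS⟩ : ∃ S : Finset (Fin 3 → ℤ), S = V.filter fun v => pairing v u = c := ⟨_, rfl⟩
  have hSF : ∀ v ∈ S, latticeVec v ∈ {x ∈ Δ | dotp x u = c} := fun v hv => by
    rw [hS, mem_filter] at hv
    exact ⟨h.mem hv.1, by rw [dotp_latticeVec]; exact hv.2⟩
  have hSV : ∀ v ∈ S, v ∈ V := fun v hv => by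
    rw [hS] at hv; exact (mem_filter.mp hv).1
  have hface' : {x ∈ Δ | dotp x u = c} = convexHull ℝ (latticeVec '' S) := by
    rw [hface, hS, coe_filter]
  have hcard : S.card = 2 := by
    have h1 : S.card ≤ 2 := by
      by_contra! hlt
      obtain ⟨a, b, d, ha, hb, hd, hab, had, hbd⟩ := Finset.two_lt_card_iff.mp hlt
      refine h.not_collinear (hSV a ha) (hSV b hb) (hSV d hd) hab hbd had.symm (hcol.subset ?_)
      rintro x (rfl | rfl | rfl)
      exacts [hSF a ha, hSF b hb, hSF _ hd]
    have h2 : 1 < S.card := by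
      by_contra! hlt
      have hsub : (latticeVec '' (S : Set (Fin 3 → ℤ))).Subsingleton :=
        (Finset.card_le_one_iff_subsingleton.mp hlt).image _
      rw [hface', faceDim, ← direction_affineSpan, affineSpan_convexHull, direction_affineSpan,
        vectorSpan_of_subsingleton ℝ hsub] at hdim
      simp at hdim
    omega
  obtain ⟨a, b, hab, hSab⟩ := Finset.card_eq_two.mp hcard
  have hmem (v) : (v ∈ V ∧ pairing v u = c) ↔ v = a ∨ v = b := by
    rw [← mem_filter (p := fun v => pairing v u = c), ← hS, hSab]; simp
  have ha := (hmem a).mpr (Or.inl rfl)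
  have hb := (hmem b).mpr (Or.inr rfl)
  refine ⟨a, b, ⟨ha.1, hb.1, hab, (-c⁻¹) • u, ?_, ?_⟩, ?_⟩
  · intro v hv
    rw [pairing_smul, Pi.one_apply, neg_mul, neg_le_neg_iff, inv_mul_le_iff₀ hc, mul_one]
    exact hleV v hv
  · intro v hv
    rw [← hmem, pairing_smul, neg_mul, neg_inj, inv_mul_eq_one₀ hc.ne']
    exact ⟨fun h => ⟨hv, h.symm⟩, fun h => h.2.symm⟩
  · rw [hface', hSab, ← convexHull_pair, ← Set.image_pair]
    simp

theorem IsReflexive.exists_facet_normal (hΔ : IsReflexive Δ) (h : IsVertexSet V Δ)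
    {y : Fin 3 → ℝ} (hy : Feasible V 1 y) {a b c : Fin 3 → ℤ} (ha : a ∈ V) (hb : b ∈ V)
    (hc : c ∈ V) (hdet : det3 a b c ≠ 0) (hay : pairing a y = -1) (hby : pairing b y = -1)
    (hcy : pairing c y = -1) :
    ∃ l, dot3 l a = -1 ∧ dot3 l b = -1 ∧ dot3 l c = -1 ∧ ∀ v ∈ V, -1 ≤ dot3 l v := by
  have hR : (det3 a b c : ℝ) ≠ 0 := by exact_mod_cast hdet
  have hmem {v : Fin 3 → ℤ} (hv : v ∈ V) (hvy : pairing v y = -1) :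
      latticeVec v ∈ {x ∈ Δ | dotp x (-y) = 1} :=
    ⟨h.mem hv, by rw [dotp_latticeVec, pairing_neg, hvy, neg_neg]⟩
  have hdim : faceDim {x ∈ Δ | dotp x (-y) = 1} = 2 := by
    apply le_antisymm
    · have hne : dotpLinear y ≠ 0 := fun h0 => by
        have := dotp_latticeVec a y
        rw [← dotpLinear_apply, h0, hay] at this
        simp at this
      have hker := Module.Dual.finrank_ker_add_one_of_ne_zero (f := dotpLinear y) hne
      rw [Module.finrank_fin_fun] at hker
      have hle : vectorSpan ℝ {x ∈ Δ | dotp x (-y) = 1} ≤ LinearMap.ker (dotpLinear y) := by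
        rw [vectorSpan, Submodule.span_le]
        rintro _ ⟨x, hx, z, hz, rfl⟩
        have hx2 := hx.2
        have hz2 := hz.2
        rw [dotp_neg] at hx2 hz2
        simp only [vsub_eq_sub, SetLike.mem_coe, LinearMap.mem_ker, map_sub, dotpLinear_apply]
        linarith
      have := Submodule.finrank_mono hle
      rw [faceDim]
      omega
    · have hli : LinearIndependent ℝ ![latticeVec b - latticeVec a, latticeVec c - latticeVec a] := by
        rw [LinearIndependent.pair_iff]
        intro s t hst
        have e1 := congrArg (dotpLinear (crossReal c a)) hst
        have e2 := congrArg (dotpLinear (crossReal a b)) hst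
        simp only [map_add, map_smul, map_sub, dotpLinear_apply, dotp_latticeVec,
          pairing_crossReal, map_zero, smul_eq_mul] at e1 e2
        rw [det3_rotate a b c, show det3 a c a = 0 by simp only [det3_eq]; ring,
          show det3 c c a = 0 by simp only [det3_eq]; ring] at e1
        rw [show det3 c a b = det3 a b c by simp only [det3_eq]; ring,
          show det3 a a b = 0 by simp only [det3_eq]; ring,
          show det3 b a b = 0 by simp only [det3_eq]; ring] at e2
        constructor
        · simpa [hR] using e1
        · simpa [hR] using e2
      have hspan := finrank_span_eq_card hli
      rw [Fintype.card_fin] at hspan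
      refine hspan.ge.trans (Submodule.finrank_mono ?_)
      rw [Submodule.span_le]
      rintro _ ⟨i, rfl⟩
      fin_cases i
      · exact vsub_mem_vectorSpan ℝ (hmem hb hby) (hmem ha hay)
      · exact vsub_mem_vectorSpan ℝ (hmem hc hcy) (hmem ha hay)
  obtain ⟨l, hl⟩ := hΔ.2.2 _ (isFaceOf_of_feasible h hy ha hay) (by rw [hdim])
  have hl' {v : Fin 3 → ℤ} (hv : v ∈ V) (hvy : pairing v y = -1) :
      pairing v (latticeVec l) = -1 := by
    rw [← dotp_latticeVec]
    exact hl (hmem hv hvy)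
  have hly : latticeVec l = y := eq_of_pairing_eq hdet ((hl' ha hay).trans hay.symm)
    ((hl' hb hby).trans hby.symm) ((hl' hc hcy).trans hcy.symm)
  rw [← hly] at hay hby hcy hy
  simp only [Feasible, pairing_latticeVec, Pi.one_apply] at hay hby hcy hy
  exact ⟨l, by exact_mod_cast hay, by exact_mod_cast hby, by exact_mod_cast hcy,
    fun v hv => by exact_mod_cast hy v hv⟩

/-- An edge along which two triangles in different facets meet is an edge of the polytope. -/
theorem isEdgePair_of_dot3 (h : IsVertexSet V Δ) {a b l m : Fin 3 → ℤ} (ha : a ∈ V) (hb : b ∈ V)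
    (hab : a ≠ b) (hlm : l ≠ m) (la : dot3 l a = -1) (lb : dot3 l b = -1) (ma : dot3 m a = -1)
    (mb : dot3 m b = -1) (hl : ∀ v ∈ V, -1 ≤ dot3 l v) (hm : ∀ v ∈ V, -1 ≤ dot3 m v) :
    IsEdgePair V a b := by
  have hpair (v : Fin 3 → ℤ) : pairing v ((1 / 2 : ℝ) • (latticeVec l + latticeVec m))
      = (dot3 l v + dot3 m v) / 2 := by
    rw [pairing_smul, pairing_add, pairing_latticeVec, pairing_latticeVec]; ring
  refine ⟨ha, hb, hab, (1 / 2 : ℝ) • (latticeVec l + latticeVec m), fun v hv => ?_, fun v hv => ?_⟩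
  · rw [hpair, Pi.one_apply]
    have h1 : (-1 : ℝ) ≤ dot3 l v := by exact_mod_cast hl v hv
    have h2 : (-1 : ℝ) ≤ dot3 m v := by exact_mod_cast hm v hv
    linarith
  · rw [hpair]
    constructor
    · intro hv'
      have hsum : (dot3 l v + dot3 m v : ℝ) = -2 := by linarith
      have hsum : dot3 l v + dot3 m v = -2 := by exact_mod_cast hsum
      have lv : dot3 l v = -1 := by linarith [hl v hv, hm v hv]
      have mv : dot3 m v = -1 := by linarith [hl v hv, hm v hv]
      by_contra! hne
      refine h.not_collinear ha hb hv hab hne.2.symm hne.1 ?_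
      have hdet0 : det3 a b v = 0 := by
        by_contra hdet
        exact hlm (eq_of_dot3_eq hdet (la.trans ma.symm) (lb.trans mb.symm) (lv.trans mv.symm))
      have hk := det3_cross3_ne_zero (a := a) (b := b) fun h0 => hab (eq_of_cross3_eq_zero la lb h0)
      have hcr := det3_cramer a b (cross3 a b) v
      have hv0 : det3 v a b = 0 := by rw [← hdet0]; simp only [det3_eq]; ring
      rw [hv0, zero_smul, add_zero] at hcr
      have hone := det3_mul_dot3 l a b (cross3 a b) v
      rw [la, lb, lv, hv0, zero_mul, add_zero] at hone
      generalize det3 a b (cross3 a b) = k at *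
      generalize det3 v b (cross3 a b) = s at *
      generalize det3 v (cross3 a b) a = t at *
      have hkR : (k : ℝ) ≠ 0 := by exact_mod_cast hk
      have hst : (s : ℝ) = k - t := by
        have : s = k - t := by linarith
        exact_mod_cast this
      rw [collinear_iff_of_mem (p₀ := latticeVec a) (by simp)]
      refine ⟨latticeVec b - latticeVec a, ?_⟩
      rintro x (rfl | rfl | rfl)
      · exact ⟨0, by simp⟩
      · exact ⟨1, by simp⟩
      · refine ⟨t / k, ?_⟩
        ext i
        have := congrFun hcr i
        simp only [Pi.smul_apply, Pi.add_apply, smul_eq_mul] at this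
        have : (k * v i : ℝ) = s * a i + t * b i := by exact_mod_cast this
        simp only [latticeVec, vadd_eq_add, Pi.add_apply, Pi.smul_apply, Pi.sub_apply, smul_eq_mul]
        field_simp
        rw [hst] at this
        linarith
    · rintro (rfl | rfl)
      · rw [la, ma]; norm_num
      · rw [lb, mb]; norm_num

theorem ncard_latticePoints_segment (a b : Fin 3 → ℤ) :
    Set.ncard {x ∈ segment ℝ (latticeVec a) (latticeVec b) | IsLatticePoint x}
      = content (b - a) + 1 := by
  obtain ⟨w, hw, hb⟩ := exists_eq_add_smul a b
  set n := content (b - a)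
  obtain ⟨u, hu⟩ := exists_dot3_eq_content w
  rw [hw] at hu
  have hinj : Function.Injective fun k : ℕ => latticeVec (a + (k : ℤ) • w) := by
    intro j k hjk
    have h1 := congrArg (dot3 u) (latticeVec_injective hjk)
    rw [dot3_add, dot3_add, dot3_smul, dot3_smul, hu] at h1
    push_cast at h1
    omega
  have hset : {x ∈ segment ℝ (latticeVec a) (latticeVec b) | IsLatticePoint x}
      = (fun k : ℕ => latticeVec (a + (k : ℤ) • w)) '' (range (n + 1) : Set ℕ) := by
    ext x
    simp only [Set.mem_ofPred_eq, Set.mem_image, coe_range, Set.mem_Iio, segment_eq_image']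
    constructor
    · rintro ⟨⟨t, ⟨ht0, ht1⟩, rfl⟩, hx⟩
      obtain ⟨v, hv⟩ := isLatticePoint_iff.mp hx
      have hvi (i) : (v i : ℝ) = a i + t * (n * w i) := by
        have h1 := congrFun hv i
        rw [hb] at h1
        simp only [latticeVec, Pi.add_apply, Pi.smul_apply, Pi.sub_apply, smul_eq_mul] at h1
        push_cast at h1
        rw [h1]; ring
      have hk : (dot3 u (v - a) : ℝ) = t * n := by
        have hu' : (u 0 * w 0 + u 1 * w 1 + u 2 * w 2 : ℝ) = 1 := by
          simp only [dot3] at hu; exact_mod_cast hu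
        simp only [dot3, Pi.sub_apply]
        push_cast
        rw [hvi, hvi, hvi]
        linear_combination t * n * hu'
      have hn : (0 : ℝ) ≤ n := Nat.cast_nonneg _
      have k0 : 0 ≤ dot3 u (v - a) := by
        have : (0 : ℝ) ≤ dot3 u (v - a) := by rw [hk]; positivity
        exact_mod_cast this
      obtain ⟨k, hk'⟩ := Int.eq_ofNat_of_zero_le k0
      rw [hk'] at hk
      push_cast at hk
      refine ⟨k, ?_, ?_⟩
      · have : (k : ℝ) ≤ n := by rw [hk]; nlinarith
        have : k ≤ n := by exact_mod_cast this
        omega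
      · rw [← hv]
        ext i
        simp only [latticeVec, Pi.add_apply, Pi.smul_apply, smul_eq_mul]
        push_cast
        rw [hvi, hk]; ring
    · rintro ⟨k, hk, rfl⟩
      refine ⟨⟨k / n, ?_, ?_⟩, isLatticePoint_iff.mpr ⟨_, rfl⟩⟩
      · have : (k : ℝ) ≤ n := by exact_mod_cast Nat.lt_succ_iff.mp hk
        exact ⟨by positivity, div_le_one_of_le₀ this (Nat.cast_nonneg _)⟩
      · ext i
        rw [hb]
        simp only [latticeVec, Pi.add_apply, Pi.smul_apply, Pi.sub_apply, smul_eq_mul]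
        push_cast
        rcases Nat.eq_zero_or_pos n with h0 | hpos
        · have : k = 0 := by omega
          simp [this]
        · have : (n : ℝ) ≠ 0 := by positivity
          field_simp
          ring
  rw [hset, Set.ncard_image_of_injective _ hinj, Set.ncard_coe_finset, card_range]

theorem dualFace_segment (h : IsVertexSet V Δ) {a b c d l m : Fin 3 → ℤ} (hc : c ∈ V) (hd : d ∈ V)
    (hdet : 0 < det3 a b c) (hdet' : 0 < det3 b a d) (la : dot3 l a = -1) (lb : dot3 l b = -1)
    (lc : dot3 l c = -1) (ma : dot3 m a = -1) (mb : dot3 m b = -1) (md : dot3 m d = -1)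
    (hl : ∀ v ∈ V, -1 ≤ dot3 l v) (hm : ∀ v ∈ V, -1 ≤ dot3 m v) :
    dualFace Δ (segment ℝ (latticeVec a) (latticeVec b))
      = segment ℝ (latticeVec l) (latticeVec m) := by
  have hchar (y : Fin 3 → ℝ) : y ∈ dualFace Δ (segment ℝ (latticeVec a) (latticeVec b)) ↔
      Feasible V 1 y ∧ pairing a y = -1 ∧ pairing b y = -1 := by
    simp only [dualFace, Set.mem_ofPred_eq, h.mem_dualSet_iff]
    refine and_congr_right fun _ => ⟨fun h' => ⟨?_, ?_⟩, fun h' => ?_⟩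
    · rw [← dotp_latticeVec]; exact h' _ (left_mem_segment _ _ _)
    · rw [← dotp_latticeVec]; exact h' _ (right_mem_segment _ _ _)
    · rintro x ⟨s, t, -, -, hst, rfl⟩
      rw [← dotpLinear_apply, map_add, map_smul, map_smul, dotpLinear_apply, dotpLinear_apply,
        dotp_latticeVec, dotp_latticeVec, h'.1, h'.2]
      simp only [smul_eq_mul]
      linarith
  have pl (v : Fin 3 → ℤ) : pairing v (latticeVec l) = dot3 l v := pairing_latticeVec v l
  have pm (v : Fin 3 → ℤ) : pairing v (latticeVec m) = dot3 m v := pairing_latticeVec v m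
  apply Set.Subset.antisymm
  · intro y hy
    obtain ⟨hf, hay, hby⟩ := (hchar y).mp hy
    have hDR : (0 : ℝ) < det3 a b c := by exact_mod_cast hdet
    have hDR' : (0 : ℝ) < det3 b a d := by exact_mod_cast hdet'
    have e1 := sub_eq_smul_crossReal hdet.ne' (y := latticeVec l) (z := y)
      (by rw [pl, la, hay]; norm_num) (by rw [pl, lb, hby]; norm_num)
    have e2 := sub_eq_smul_crossReal hdet'.ne' (y := latticeVec m) (z := y)
      (by rw [pm, mb, hby]; norm_num) (by rw [pm, ma, hay]; norm_num)
    have hswap : crossReal b a = -crossReal a b := by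
      ext i; fin_cases i <;> simp [crossReal, cross3] <;> ring
    have hfc := hf c hc
    have hfd := hf d hd
    rw [Pi.one_apply] at hfc hfd
    have s0 : 0 ≤ (pairing c y - pairing c (latticeVec l)) / det3 a b c :=
      div_nonneg (by rw [pl, lc]; push_cast; linarith) hDR.le
    have t0 : 0 ≤ (pairing d y - pairing d (latticeVec m)) / det3 b a d :=
      div_nonneg (by rw [pm, md]; push_cast; linarith) hDR'.le
    generalize (pairing c y - pairing c (latticeVec l)) / det3 a b c = s at *
    generalize (pairing d y - pairing d (latticeVec m)) / det3 b a d = t at *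
    rw [hswap] at e2
    have e3 : latticeVec m = latticeVec l + (s + t) • crossReal a b := by
      have : latticeVec m = y + t • crossReal a b := by rw [e2]; simp
      rw [this, e1]; module
    rw [segment_eq_image']
    rcases (add_nonneg s0 t0).eq_or_lt with h0 | h0
    · refine ⟨0, by simp, ?_⟩
      have : s = 0 := by linarith
      rw [e1, this]
      simp
    · refine ⟨s / (s + t), ⟨by positivity, div_le_one_of_le₀ (by linarith) h0.le⟩, ?_⟩
      simp only
      rw [e3, e1, add_sub_cancel_left, smul_smul, div_mul_cancel₀ _ h0.ne']
  · rintro y ⟨s, t, hs, ht, hst, rfl⟩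
    rw [hchar]
    simp only [Feasible, pairing_add, pairing_smul, pl, pm, la, lb, ma, mb, Pi.one_apply]
    push_cast
    refine ⟨fun v hv => ?_, by linarith, by linarith⟩
    have h1 : (-1 : ℝ) ≤ dot3 l v := by exact_mod_cast hl v hv
    have h2 : (-1 : ℝ) ≤ dot3 m v := by exact_mod_cast hm v hv
    nlinarith

theorem eq_or_eq_swap_of_segment_eq (h : IsVertexSet V Δ) {a b c d : Fin 3 → ℤ} (ha : a ∈ V)
    (hb : b ∈ V) (hc : c ∈ V) (hd : d ∈ V) (hcd : c ≠ d)
    (hseg : segment ℝ (latticeVec c) (latticeVec d) = segment ℝ (latticeVec a) (latticeVec b)) :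
    (c = a ∧ d = b) ∨ (c = b ∧ d = a) := by
  have key {v : Fin 3 → ℤ} (hv : v ∈ V)
      (hv' : latticeVec v ∈ segment ℝ (latticeVec a) (latticeVec b)) : v = a ∨ v = b := by
    rcases (mem_extremePoints_iff_forall_segment.mp (h.1 v hv)).2 _ (h.mem ha) _ (h.mem hb) hv'
      with h | h
    · exact Or.inl (latticeVec_injective h).symm
    · exact Or.inr (latticeVec_injective h).symm
  have k1 := key hc (hseg ▸ left_mem_segment _ _ _)
  have k2 := key hd (hseg ▸ right_mem_segment _ _ _)
  grind

end

/-- For a 3-dimensional reflexive polytope `Δ` with dual `Δ*`,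
the sum over all edges (1-dimensional faces) `Θ` of `Δ` of `d(Θ) · d(Θ*)` equals `24`,
where `d(S)` is the number of lattice points of the segment `S` minus one and
`Θ* = {y ∈ Δ* | ⟨x, y⟩ = -1 for all x ∈ Θ}`. -/
theorem sum_over_edges_dTheta_mul_dThetaStar_eq_24 (Δ : Set (Fin 3 → ℝ))
    (h : IsReflexive Δ)
    (E : Finset (Set (Fin 3 → ℝ)))
    (hE : ∀ F : Set (Fin 3 → ℝ), F ∈ E ↔ IsFaceOf F Δ ∧ faceDim F = 1) :
    ∑ Θ ∈ E, ((Set.ncard {x ∈ Θ | IsLatticePoint x} : ℤ) - 1) *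
        ((Set.ncard {y ∈ dualFace Δ Θ | IsLatticePoint y} : ℤ) - 1) = 24 := by
  classical
  obtain ⟨V, hV⟩ := h.1.exists_isVertexSet
  have hspan := hV.positivelySpans h.2.1
  obtain ⟨ω, hω, hgen, hfacet, hedge⟩ := exists_genericWeight V
  obtain ⟨p, hp⟩ := exists_det3_ne_zero hV.finite_setOf_latticeVec_mem
  have hnormal : ∀ a b, ∃ l, ∀ c, IsTriangle V ω a b c →
      dot3 l a = -1 ∧ dot3 l b = -1 ∧ dot3 l c = -1 ∧ ∀ v ∈ V, -1 ≤ dot3 l v := by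
    intro a b
    by_cases hex : ∃ c, IsTriangle V ω a b c
    · obtain ⟨c, hc⟩ := hex
      obtain ⟨y, hy, hay, hby, hcy⟩ := hfacet a b c hc
      obtain ⟨l, hl⟩ := h.exists_facet_normal hV hy hc.1.1 hc.1.2.1 hc.1.2.2 hc.2.1.ne' hay hby hcy
      refine ⟨l, fun d hd => ?_⟩
      rwa [← hc.third_unique hgen hd]
    · exact ⟨0, fun c hc => absurd ⟨c, hc⟩ hex⟩
  choose N hN using hnormal
  let A := (V ×ˢ V).filter fun x => ∃ c, IsTriangle V ω x.1 x.2 c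
  have hA (x) : x ∈ A ↔ ∃ c, IsTriangle V ω x.1 x.2 c := by
    simp only [A, mem_filter, mem_product, and_iff_right_iff_imp]
    rintro ⟨c, hc⟩
    exact ⟨hc.1.1, hc.1.2.1⟩
  have h48 := sum_edges_content hspan hω hgen (fun v hv => hV.mem hv)
    (convexInFacets_of_convex hV.convex) hp
    (fun a b c hc => ⟨(hN a b c hc).1, (hN a b c hc).2.1, (hN a b c hc).2.2.1⟩)
    (fun a b c hc => (hN a b c hc).2.2.2) hA
  have hAne {a b : Fin 3 → ℤ} (hab : (a, b) ∈ A) : a ≠ b := by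
    obtain ⟨c, hc⟩ := (hA _).mp hab
    rintro rfl
    have := hc.2.1
    simp only [det3_eq] at this
    ring_nf at this
    omega
  let edgeSegment : (Fin 3 → ℤ) × (Fin 3 → ℤ) → Set (Fin 3 → ℝ) := fun x =>
    segment ℝ (latticeVec x.1) (latticeVec x.2)
  let edgeProduct : (Fin 3 → ℤ) × (Fin 3 → ℤ) → ℕ := fun x =>
    content (x.2 - x.1) * content (N x.2 x.1 - N x.1 x.2)
  have hfilter : ∑ x ∈ A.filter (fun x => edgeSegment x ∈ E), edgeProduct x =
      ∑ x ∈ A, edgeProduct x := by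
    apply sum_filter_of_ne
    rintro ⟨a, b⟩ hx hne
    have hab := hAne hx
    obtain ⟨c, hc⟩ := (hA _).mp hx
    obtain ⟨d, hd⟩ := hc.exists_adjacent hspan
    obtain ⟨l1, l2, l3, l4⟩ := hN _ _ _ hc
    obtain ⟨m1, m2, m3, m4⟩ := hN _ _ _ hd
    refine (hE _).mpr (IsEdgePair.isFaceOf hV (isEdgePair_of_dot3 hV hc.1.1 hc.1.2.1 hab ?_
      l1 l2 m2 m1 l4 m4))
    intro heq
    apply hne
    have : content (N b a - N a b) = 0 := by
      rw [content_eq_zero, sub_eq_zero]; exact heq.symm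
    simp [edgeProduct, this]
  have hfiber : ∑ Θ ∈ E, ∑ x ∈ A.filter (fun x => edgeSegment x ∈ E) with edgeSegment x = Θ,
      (edgeProduct x : ℤ) = 48 := by
    rw [sum_fiberwise_of_maps_to (fun x hx => (mem_filter.mp hx).2), ← Nat.cast_sum, hfilter]
    exact_mod_cast h48
  have htwice : ∀ Θ ∈ E, ∑ x ∈ A.filter (fun x => edgeSegment x ∈ E) with edgeSegment x = Θ,
      (edgeProduct x : ℤ) = 2 * (((Set.ncard {x ∈ Θ | IsLatticePoint x} : ℤ) - 1) *
        ((Set.ncard {y ∈ dualFace Δ Θ | IsLatticePoint y} : ℤ) - 1)) := by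
    intro Θ hΘ
    obtain ⟨a, b, hab, rfl⟩ := exists_isEdgePair hV h.2.1 ((hE Θ).mp hΘ).1 ((hE Θ).mp hΘ).2
    obtain ⟨y, hy, hay, hby⟩ := hedge a b hab
    obtain ⟨ha, hb, hne, z, hz, hzv⟩ := hab
    have hcross : cross3 a b ≠ 0 := cross3_ne_zero_of_pairing hne ((hzv a ha).mpr (Or.inl rfl))
      ((hzv b hb).mpr (Or.inr rfl))
    obtain ⟨c, hc, hD, t, -, g0, g1, g2, g3⟩ := hy.exists_isTriangle hspan hcross hay hby
    have hT : IsTriangle V ω a b c := ⟨⟨ha, hb, hc⟩, hD, _, g0, g1, g2, g3⟩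
    obtain ⟨d, hT'⟩ := hT.exists_adjacent hspan
    obtain ⟨l1, l2, l3, l4⟩ := hN _ _ _ hT
    obtain ⟨m1, m2, m3, m4⟩ := hN _ _ _ hT'
    have hset : (A.filter (fun x => edgeSegment x ∈ E)).filter
        (fun x => edgeSegment x = segment ℝ (latticeVec a) (latticeVec b)) = {(a, b), (b, a)} := by
      ext ⟨u, v⟩
      simp only [mem_filter, mem_insert, mem_singleton, Prod.mk.injEq]
      constructor
      · rintro ⟨⟨hx, -⟩, hs⟩
        obtain ⟨w, hw⟩ := (hA _).mp hx
        exact eq_or_eq_swap_of_segment_eq hV ha hb hw.1.1 hw.1.2.1 (hAne hx) hs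
      · rintro (⟨rfl, rfl⟩ | ⟨rfl, rfl⟩)
        · exact ⟨⟨(hA _).mpr ⟨c, hT⟩, hΘ⟩, rfl⟩
        · refine ⟨⟨(hA _).mpr ⟨d, hT'⟩, ?_⟩, segment_symm _ _ _⟩
          simp only [edgeSegment]
          rwa [segment_symm]
    rw [hset, sum_pair (by simp [hne]), dualFace_segment hV hc hT'.1.2.2 hD hT'.2.1 l1 l2 l3
      m2 m1 m3 l4 m4, ncard_latticePoints_segment, ncard_latticePoints_segment]
    have e1 : content (a - b) = content (b - a) := by rw [← content_neg, neg_sub]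
    have e2 : content (N a b - N b a) = content (N b a - N a b) := by rw [← content_neg, neg_sub]
    simp only [edgeProduct, e1, e2]
    push_cast
    ring
  rw [sum_congr rfl htwice, ← mul_sum] at hfiber
  linarith
end

section
/- Let Δ ⊂ ℝ² be a 2-dimensional reflexive polytope (reflexive polygon) and Δ* its dual reflexive polygon. Then the number of points of ℤ² on the boundary of Δ plus the number of points of ℤ² on the boundary of Δ* equals 12; i.e., if ∂Δ contains exactly k lattice points, then ∂Δ* contains exactly 12 − k lattice points. -/
open Finset

/-- The dot product on `ℤ²`. -/
def intPairing (x y : ℤ × ℤ) : ℤ := x.1 * y.1 + x.2 * y.2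

/-- The determinant of two vectors of `ℤ²`. -/
def intDet (x y : ℤ × ℤ) : ℤ := x.1 * y.2 - x.2 * y.1

/-- Two finite sets of nonzero lattice points of the plane, each of which consists of all the
nonzero lattice points of the polar of the other. -/
structure PolarPair (S D : Finset (ℤ × ℤ)) : Prop where
  mem_left : ∀ x, x ∈ S ↔ x ≠ 0 ∧ ∀ y ∈ D, -1 ≤ intPairing x y
  mem_right : ∀ y, y ∈ D ↔ y ≠ 0 ∧ ∀ x ∈ S, -1 ≤ intPairing x y

/-- No two members of `S` spanning the lattice have their sum in `S`. -/
def NoUnimodularSum (S : Finset (ℤ × ℤ)) : Prop :=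
  ∀ u ∈ S, ∀ w ∈ S, intDet u w = 1 → u + w ∉ S

lemma intPairing_comm (x y : ℤ × ℤ) : intPairing x y = intPairing y x := by
  simp only [intPairing]; ring

namespace PolarPair

variable {S D : Finset (ℤ × ℤ)}

lemma symm (h : PolarPair S D) : PolarPair D S :=
  ⟨fun x => by simpa only [intPairing_comm x] using h.mem_right x,
    fun x => by simpa only [intPairing_comm _ x] using h.mem_left x⟩

lemma ne_zero (h : PolarPair S D) {x : ℤ × ℤ} (hx : x ∈ S) : x ≠ 0 := ((h.mem_left x).1 hx).1

lemma neg_one_le (h : PolarPair S D) {x y : ℤ × ℤ} (hx : x ∈ S) (hy : y ∈ D) :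
    -1 ≤ intPairing x y := ((h.mem_left x).1 hx).2 y hy

lemma eq_zero_of_nonneg (h : PolarPair S D) {z : ℤ × ℤ}
    (hz : ∀ y ∈ D, 0 ≤ intPairing z y) : z = 0 := by
  by_contra hne
  have hinj : Function.Injective fun n : ℕ => ((n : ℤ) + 1) • z := by
    intro m n hmn
    have := smul_left_injective ℤ hne hmn
    omega
  refine Set.infinite_of_injective_forall_mem hinj (s := (S : Set (ℤ × ℤ))) (fun n => ?_)
    S.finite_toSet
  refine (h.mem_left _).2 ⟨smul_ne_zero (by omega) hne, fun y hy => ?_⟩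
  have := mul_nonneg (by positivity : (0 : ℤ) ≤ n + 1) (hz y hy)
  simp only [intPairing, Prod.smul_fst, Prod.smul_snd, smul_eq_mul] at this ⊢
  linarith

lemma neg_le_mul_intPairing (h : PolarPair S D) {x₁ x₂ z y : ℤ × ℤ} {n a b : ℤ}
    (h₁ : x₁ ∈ S) (h₂ : x₂ ∈ S) (ha : 0 ≤ a) (hb : 0 ≤ b)
    (e : n • z = a • x₁ + b • x₂) (hy : y ∈ D) : -(a + b) ≤ n * intPairing z y := by
  have e₁ := congrArg Prod.fst e
  have e₂ := congrArg Prod.snd e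
  have := mul_le_mul_of_nonneg_left (h.neg_one_le h₁ hy) ha
  have := mul_le_mul_of_nonneg_left (h.neg_one_le h₂ hy) hb
  simp only [intPairing, Prod.smul_fst, Prod.smul_snd, smul_eq_mul, Prod.fst_add,
    Prod.snd_add] at *
  have : n * (z.1 * y.1 + z.2 * y.2) = (n * z.1) * y.1 + (n * z.2) * y.2 := by ring
  rw [this, e₁, e₂]
  linarith

lemma eq_zero_of_smul_eq (h : PolarPair S D) {x₁ x₂ z : ℤ × ℤ} (n a b : ℤ)
    (h₁ : x₁ ∈ S) (h₂ : x₂ ∈ S) (ha : 0 ≤ a) (hb : 0 ≤ b) (hn : a + b < n)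
    (e : n • z = a • x₁ + b • x₂) : z = 0 := by
  refine h.eq_zero_of_nonneg fun y hy => ?_
  have := h.neg_le_mul_intPairing h₁ h₂ ha hb e hy
  by_contra hlt
  nlinarith

lemma mem_of_smul_eq (h : PolarPair S D) {x₁ x₂ z : ℤ × ℤ} (n a b : ℤ)
    (h₁ : x₁ ∈ S) (h₂ : x₂ ∈ S) (ha : 0 ≤ a) (hb : 0 ≤ b) (hn : a + b ≤ n) (hn₀ : 0 < n)
    (hz : z ≠ 0) (e : n • z = a • x₁ + b • x₂) : z ∈ S := by
  refine (h.mem_left z).2 ⟨hz, fun y hy => ?_⟩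
  have := h.neg_le_mul_intPairing h₁ h₂ ha hb e hy
  by_contra hlt
  nlinarith

lemma exists_intDet_eq_one (h : PolarPair S D) {v : ℤ × ℤ} (hv : v ∈ S) :
    ∃ u ∈ S, intDet v u = 1 := by
  have hv₀ := h.ne_zero hv
  have hcop : IsCoprime v.1 v.2 := by
    rw [Int.isCoprime_iff_gcd_eq_one]
    have hpos : 0 < Int.gcd v.1 v.2 := by
      refine Int.gcd_pos_iff.2 ?_
      by_contra! hc
      exact hv₀ (Prod.ext hc.1 hc.2)
    by_contra hne
    obtain ⟨a, ha⟩ := Int.gcd_dvd_left v.1 v.2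
    obtain ⟨b, hb⟩ := Int.gcd_dvd_right v.1 v.2
    have hab : ((a, b) : ℤ × ℤ) = 0 :=
      h.eq_zero_of_smul_eq (Int.gcd v.1 v.2) 1 0 hv hv (by simp) (by simp) (by omega)
        (Prod.ext (by simpa using ha.symm) (by simpa using hb.symm))
    simp only [Prod.mk_eq_zero] at hab
    exact hv₀ (Prod.ext (by simpa [hab.1] using ha) (by simpa [hab.2] using hb))
  obtain ⟨a, b, hab⟩ := hcop
  obtain ⟨x, hx, hdet⟩ : ∃ x ∈ S, 0 < intDet v x := by
    by_contra! hc
    have := h.symm.eq_zero_of_nonneg (z := (v.2, -v.1)) fun x hx => by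
      have := hc x hx
      simp only [intPairing, intDet] at *
      linarith
    simp only [Prod.mk_eq_zero, neg_eq_zero] at this
    exact hv₀ (Prod.ext this.2 this.1)
  set d := intDet v x with hd
  set k := x.1 * a + x.2 * b with hk
  have hmod := Int.mul_ediv_add_emod (-k) d
  set m := (-k) / d
  refine ⟨(-b - m * v.1, a - m * v.2), ?_, ?_⟩
  · have hdet₁ : intDet v (-b - m * v.1, a - m * v.2) = 1 := by
      simp only [intDet]; linear_combination hab
    refine h.mem_of_smul_eq d 1 ((-k) % d) hx hv zero_le_one (Int.emod_nonneg _ hdet.ne')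
      (by have := Int.emod_lt_of_pos (-k) hdet; omega) hdet ?_ ?_
    · intro hz
      rw [hz] at hdet₁
      simp [intDet] at hdet₁
    · have hr : (-k) % d = -k - d * m := by linarith
      rw [hr]
      ext
      · simp only [Prod.smul_fst, Prod.fst_add, smul_eq_mul, hd, hk, intDet]
        linear_combination x.1 * hab
      · simp only [Prod.smul_snd, Prod.snd_add, smul_eq_mul, hd, hk, intDet]
        linear_combination x.2 * hab
  · simp only [intDet]; linear_combination hab

/-- Passing to the coordinates of a basis `v, u` of `ℤ²`. -/
lemma exists_change_of_basis (h : PolarPair S D) {v u : ℤ × ℤ} (hvu : intDet v u = 1) :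
    ∃ S' D', PolarPair S' D' ∧ S'.card = S.card ∧ D'.card = D.card ∧
      ∀ a b : ℤ, (a, b) ∈ S' ↔ a • v + b • u ∈ S := by
  simp only [intDet] at hvu
  let f : ℤ × ℤ ≃ ℤ × ℤ :=
    { toFun x := (x.1 * u.2 - x.2 * u.1, v.1 * x.2 - v.2 * x.1)
      invFun p := p.1 • v + p.2 • u
      left_inv x := by
        ext
        · simp only [Prod.smul_fst, Prod.fst_add, smul_eq_mul]; linear_combination x.1 * hvu
        · simp only [Prod.smul_snd, Prod.snd_add, smul_eq_mul]; linear_combination x.2 * hvu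
      right_inv p := by
        ext
        · simp only [Prod.smul_fst, Prod.fst_add, Prod.smul_snd, Prod.snd_add, smul_eq_mul]
          linear_combination p.1 * hvu
        · simp only [Prod.smul_fst, Prod.fst_add, Prod.smul_snd, Prod.snd_add, smul_eq_mul]
          linear_combination p.2 * hvu }
  let g : ℤ × ℤ ≃ ℤ × ℤ :=
    { toFun y := (intPairing v y, intPairing u y)
      invFun p := (u.2 * p.1 - v.2 * p.2, v.1 * p.2 - u.1 * p.1)
      left_inv y := by
        ext
        · simp only [intPairing]; linear_combination y.1 * hvu
        · simp only [intPairing]; linear_combination y.2 * hvu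
      right_inv p := by
        ext
        · simp only [intPairing]; linear_combination p.1 * hvu
        · simp only [intPairing]; linear_combination p.2 * hvu }
  have hfg (x y : ℤ × ℤ) : intPairing (f x) (g y) = intPairing x y := by
    simp only [f, g, Equiv.coe_fn_mk, intPairing]
    linear_combination (x.1 * y.1 + x.2 * y.2) * hvu
  have hf₀ (x : ℤ × ℤ) : f x = 0 ↔ x = 0 :=
    f.injective.eq_iff' (by ext <;> simp [f])
  have hg₀ (y : ℤ × ℤ) : g y = 0 ↔ y = 0 :=
    g.injective.eq_iff' (by ext <;> simp [g, intPairing])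
  refine ⟨S.map f.toEmbedding, D.map g.toEmbedding, ⟨fun x => ?_, fun y => ?_⟩,
    Finset.card_map _, Finset.card_map _, fun a b => ?_⟩
  · obtain ⟨x, rfl⟩ := f.surjective x
    simp only [Finset.mem_map_equiv, Equiv.symm_apply_apply, h.mem_left x, ne_eq, hf₀]
    refine and_congr_right fun _ => g.forall_congr fun y => ?_
    simp only [Equiv.symm_apply_apply, hfg]
  · obtain ⟨y, rfl⟩ := g.surjective y
    simp only [Finset.mem_map_equiv, Equiv.symm_apply_apply, h.mem_right y, ne_eq, hg₀]
    refine and_congr_right fun _ => f.forall_congr fun x => ?_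
    simp only [Equiv.symm_apply_apply, hfg]
  · rw [Finset.mem_map_equiv]
    rfl

lemma sum_mem_of_pos_mem (h : PolarPair S D) {u w : ℤ × ℤ} {p q : ℤ} (hu : u ∈ S) (hw : w ∈ S)
    (hsum : u + w ≠ 0) (hp : 0 < p) (hq : 0 < q) (hx : p • u + q • w ∈ S) : u + w ∈ S := by
  rcases le_total p q with hpq | hpq
  · exact h.mem_of_smul_eq q 1 (q - p) hx hu (by omega) (by omega) (by omega) hq hsum (by module)
  · exact h.mem_of_smul_eq p 1 (p - q) hx hw (by omega) (by omega) (by omega) hp hsum (by module)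

/-- Deleting the point `(1, 1)`, if it is a vertex with neighbours `(1, 0)` and `(0, 1)`. -/
lemma erase (h : PolarPair S D) (h₁ : ((1, 0) : ℤ × ℤ) ∈ S) (h₂ : ((0, 1) : ℤ × ℤ) ∈ S)
    (h₁₂ : ((1, 1) : ℤ × ℤ) ∈ S) (h₃ : ((2, 1) : ℤ × ℤ) ∉ S) (h₄ : ((1, 2) : ℤ × ℤ) ∉ S) :
    PolarPair (S.erase (1, 1)) (insert (-1, -1) D) := by
  have key : ∀ x ∈ S, x ≠ (1, 1) → x.1 + x.2 ≤ 1 := by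
    rintro ⟨a, b⟩ hx hne
    by_contra! hab
    simp only [ne_eq, Prod.mk.injEq] at hne hab
    have C₁ : ¬ b ≤ 0 := fun hb => by
      have := h.eq_zero_of_smul_eq (z := (1, 0)) a 1 (-b) hx h₂ (by omega) (by omega)
        (by omega) (by ext <;> simp)
      simp at this
    have C₂ : ¬ a ≤ 0 := fun ha => by
      have := h.eq_zero_of_smul_eq (z := (0, 1)) b 1 (-a) hx h₁ (by omega) (by omega)
        (by omega) (by ext <;> simp)
      simp at this
    have C₃ : ¬ (2 ≤ b ∧ b ≤ a) := fun ⟨hb, hba⟩ => by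
      have := h.eq_zero_of_smul_eq (z := (1, 1)) a 1 (a - b) hx h₂ (by omega) (by omega)
        (by omega) (by ext <;> simp)
      simp at this
    have C₄ : ¬ (2 ≤ a ∧ a ≤ b) := fun ⟨ha, hab⟩ => by
      have := h.eq_zero_of_smul_eq (z := (1, 1)) b 1 (b - a) hx h₁ (by omega) (by omega)
        (by omega) (by ext <;> simp)
      simp at this
    have C₅ : ¬ (b = 1 ∧ 2 ≤ a) := fun ⟨hb, ha⟩ => by
      refine h₃ (h.mem_of_smul_eq (a - 1) 1 (a - 2) hx h₁₂ (by omega) (by omega)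
        (by omega) (by omega) (by simp) ?_)
      ext <;> simp [hb] <;> ring
    have C₆ : ¬ (a = 1 ∧ 2 ≤ b) := fun ⟨ha, hb⟩ => by
      refine h₄ (h.mem_of_smul_eq (b - 1) 1 (b - 2) hx h₁₂ (by omega) (by omega)
        (by omega) (by omega) (by simp) ?_)
      ext <;> simp [ha] <;> ring
    omega
  refine ⟨fun x => ?_, fun y => ?_⟩
  · simp only [Finset.mem_erase, Finset.mem_insert, forall_eq_or_imp, h.mem_left x]
    constructor
    · rintro ⟨hne, hx₀, hx⟩
      have := key x ((h.mem_left x).2 ⟨hx₀, hx⟩) hne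
      exact ⟨hx₀, by simp only [intPairing]; linarith, hx⟩
    · rintro ⟨hx₀, hx₁, hx⟩
      refine ⟨?_, hx₀, hx⟩
      rintro rfl
      simp [intPairing] at hx₁
  · simp only [Finset.mem_erase, Finset.mem_insert]
    constructor
    · rintro (rfl | hy)
      · refine ⟨by simp, fun x hx => ?_⟩
        have := key x hx.2 hx.1
        simp only [intPairing]; linarith
      · exact ⟨h.symm.ne_zero hy, fun x hx => h.neg_one_le hx.2 hy⟩
    · rintro ⟨hy₀, hy⟩
      by_cases hy₁ : -1 ≤ intPairing (1, 1) y
      · refine .inr ((h.mem_right y).2 ⟨hy₀, fun x hx => ?_⟩)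
        rcases eq_or_ne x (1, 1) with rfl | hne
        · exact hy₁
        · exact hy x ⟨hne, hx⟩
      · have a₁ := hy (1, 0) ⟨by simp, h₁⟩
        have a₂ := hy (0, 1) ⟨by simp, h₂⟩
        simp only [intPairing] at a₁ a₂ hy₁
        left
        ext
        · show y.1 = -1
          omega
        · show y.2 = -1
          omega

lemma exists_vertex_of_add_two_smul_mem (h : PolarPair S D) {u w : ℤ × ℤ} (hu : u ∈ S)
    (hw : w ∈ S) (hdet : intDet u w ≠ 0) (hs : u + (2 : ℤ) • w ∈ S) :
    ∃ n : ℤ, u + n • w ∈ S ∧ (u + n • w) + w ∈ S ∧ (2 : ℤ) • (u + n • w) + w ∉ S ∧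
      (u + n • w) + (2 : ℤ) • w ∉ S := by
  have hne (n : ℤ) : u + n • w ≠ 0 := by
    intro h₀
    have e₁ := congrArg Prod.fst h₀
    have e₂ := congrArg Prod.snd h₀
    simp only [Prod.fst_add, Prod.smul_fst, Prod.snd_add, Prod.smul_snd, smul_eq_mul,
      Prod.fst_zero, Prod.snd_zero] at e₁ e₂
    refine hdet ?_
    simp only [intDet]
    linear_combination w.2 * e₁ - w.1 * e₂
  have hex : ∃ n : ℕ, u + ((n : ℤ) + 3) • w ∉ S := by
    by_contra! hc
    refine Set.infinite_of_injective_forall_mem (f := fun n : ℕ => u + ((n : ℤ) + 3) • w)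
      (fun m n hmn => ?_) hc S.finite_toSet
    have := smul_left_injective ℤ (h.ne_zero hw) (add_left_cancel hmn)
    omega
  classical
  obtain ⟨n, hn, hmin⟩ : ∃ n : ℕ, u + ((n : ℤ) + 3) • w ∉ S ∧ u + ((n : ℤ) + 2) • w ∈ S := by
    refine ⟨Nat.find hex, Nat.find_spec hex, ?_⟩
    rcases Nat.eq_zero_or_eq_succ_pred (Nat.find hex) with h₀ | h₀
    · simpa [h₀] using hs
    · have := Nat.find_min hex (m := (Nat.find hex).pred) (by omega)
      rw [not_not] at this
      rw [h₀]
      convert this using 3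
      push_cast
      ring
  refine ⟨n + 1, ?_, ?_, fun hx => ?_, ?_⟩
  · exact h.mem_of_smul_eq (n + 2) 1 (n + 1) hu hmin (by omega) (by omega) (by omega) (by omega)
      (hne _) (by module)
  · convert hmin using 1
    module
  · refine hne (n + 1) (h.eq_zero_of_smul_eq (2 * n + 3) (n + 1) 1 hx hu (by omega) (by omega)
      (by omega) (by module))
  · convert hn using 2
    module

/-- If `S` has a unimodular sum, then it has one that is a vertex next to both summands. -/
lemma exists_unimodular_vertex (h : PolarPair S D) (hS : ¬ NoUnimodularSum S) :
    ∃ u ∈ S, ∃ w ∈ S, intDet u w = 1 ∧ u + w ∈ S ∧ (2 : ℤ) • u + w ∉ S ∧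
      u + (2 : ℤ) • w ∉ S := by
  simp only [NoUnimodularSum, not_forall, not_not] at hS
  obtain ⟨u, hu, w, hw, hdet, hs⟩ := hS
  by_cases hA : (2 : ℤ) • u + w ∈ S
  · rw [add_comm] at hA
    obtain ⟨n, h₁, h₂, h₃, h₄⟩ := h.exists_vertex_of_add_two_smul_mem hw hu
      (by simp only [intDet] at *; intro h₀; linarith) hA
    refine ⟨u, hu, _, h₁, ?_, by rwa [add_comm], by rwa [add_comm], by rwa [add_comm]⟩
    simp only [intDet, Prod.fst_add, Prod.smul_fst, Prod.snd_add, Prod.smul_snd,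
      smul_eq_mul] at *
    linear_combination hdet
  by_cases hB : u + (2 : ℤ) • w ∈ S
  · obtain ⟨n, h₁, h₂, h₃, h₄⟩ := h.exists_vertex_of_add_two_smul_mem hu hw (by omega) hB
    refine ⟨_, h₁, w, hw, ?_, h₂, h₃, h₄⟩
    simp only [intDet, Prod.fst_add, Prod.smul_fst, Prod.snd_add, Prod.smul_snd,
      smul_eq_mul] at *
    linear_combination hdet
  · exact ⟨u, hu, w, hw, hdet, hs, hA, hB⟩

lemma mem_right_iff_of_subset_box (h : PolarPair S D) {B : Finset (ℤ × ℤ)}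
    (hB : ∀ y, (∀ x ∈ S, -1 ≤ intPairing x y) → y ∈ B) :
    D = B.filter fun y => y ≠ 0 ∧ ∀ x ∈ S, -1 ≤ intPairing x y := by
  ext y
  rw [Finset.mem_filter, h.mem_right y]
  exact ⟨fun hy => ⟨hB y hy.2, hy⟩, fun hy => hy.2⟩

lemma fst_le_of_mem_row (h : PolarPair S D) (hS : NoUnimodularSum S)
    (h₁ : ((1, 0) : ℤ × ℤ) ∈ S) {a b t : ℤ} (ht : t = 1 ∨ t = -1)
    (ha : (a, t) ∈ S) (hb : (b, t) ∈ S) : b ≤ a := by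
  by_contra! hab
  have hm : (a + 1, t) ∈ S := by
    refine h.mem_of_smul_eq (b - a) 1 (b - a - 1) hb ha (by omega) (by omega) (by omega)
      (by omega) (by simp; omega) ?_
    ext <;> simp <;> ring
  rcases ht with rfl | rfl
  · refine hS _ h₁ _ ha (by simp [intDet]) ?_
    convert hm using 1
    simp [add_comm]
  · refine hS _ ha _ h₁ (by simp [intDet]) ?_
    convert hm using 1
    simp

lemma not_mem_of_two_le (h : PolarPair S D) (hS : NoUnimodularSum S)
    (h₁ : ((1, 0) : ℤ × ℤ) ∈ S) (h₂ : ((-1, 0) : ℤ × ℤ) ∈ S) {p t n : ℤ}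
    (ht : t = 1 ∨ t = -1) (hn : 2 ≤ n) : (p, n * t) ∉ S := by
  intro hx
  obtain ⟨m, r, hp, hr₁, hr₂⟩ : ∃ m r : ℤ, p = n * m + r ∧ 0 ≤ r ∧ r < n :=
    ⟨p / n, p % n, (Int.mul_ediv_add_emod p n).symm, Int.emod_nonneg _ (by omega),
      Int.emod_lt_of_pos _ (by omega)⟩
  have e₁ : n • ((m, t) : ℤ × ℤ) = (1 : ℤ) • (p, n * t) + r • ((-1, 0) : ℤ × ℤ) := by
    ext <;> simp [hp]
  have e₂ : n • ((m + 1, t) : ℤ × ℤ) = (1 : ℤ) • (p, n * t) + (n - r) • ((1, 0) : ℤ × ℤ) := by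
    ext <;> simp [hp]; ring
  by_cases hr : 1 + r < n
  · have := h.eq_zero_of_smul_eq n 1 r hx h₂ (by omega) hr₁ hr e₁
    simp at this
    omega
  by_cases hr' : 1 + (n - r) < n
  · have := h.eq_zero_of_smul_eq n 1 (n - r) hx h₁ (by omega) (by omega) hr' e₂
    simp at this
    omega
  · have a₁ := h.mem_of_smul_eq n 1 r hx h₂ (by omega) hr₁ (by omega) (by omega)
      (by simp; omega) e₁
    have a₂ := h.mem_of_smul_eq n 1 (n - r) hx h₁ (by omega) (by omega) (by omega) (by omega)
      (by simp; omega) e₂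
    have := h.fst_le_of_mem_row hS h₁ ht a₁ a₂
    omega

theorem card_add_card_of_antipodal (h : PolarPair S D) (hS : NoUnimodularSum S)
    (h₁ : ((1, 0) : ℤ × ℤ) ∈ S) (h₂ : ((0, 1) : ℤ × ℤ) ∈ S) (h₃ : ((-1, 0) : ℤ × ℤ) ∈ S) :
    S.card + D.card = 12 := by
  obtain ⟨⟨c, d⟩, h₄, hd⟩ := h.exists_intDet_eq_one h₃
  obtain rfl : d = -1 := by simp [intDet] at hd; omega
  have hSeq : S = {(1, 0), (-1, 0), (0, 1), (c, -1)} := by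
    ext ⟨p, q⟩
    simp only [Finset.mem_insert, Finset.mem_singleton, Prod.mk.injEq]
    constructor
    · intro hx
      have C₁ : ¬ 2 ≤ q := fun hq =>
        h.not_mem_of_two_le hS h₁ h₃ (.inl rfl) hq (by simpa using hx)
      have C₂ : ¬ 2 ≤ -q := fun hq =>
        h.not_mem_of_two_le hS h₁ h₃ (.inr rfl) hq (by simpa using hx)
      have C₃ : q = 1 → p = 0 := by
        rintro rfl
        exact le_antisymm (h.fst_le_of_mem_row hS h₁ (.inl rfl) h₂ hx)
          (h.fst_le_of_mem_row hS h₁ (.inl rfl) hx h₂)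
      have C₄ : q = -1 → p = c := by
        rintro rfl
        exact le_antisymm (h.fst_le_of_mem_row hS h₁ (.inr rfl) h₄ hx)
          (h.fst_le_of_mem_row hS h₁ (.inr rfl) hx h₄)
      have C₅ : q = 0 → p = 1 ∨ p = -1 := by
        rintro rfl
        have hp : p ≠ 0 := by
          rintro rfl
          exact h.ne_zero hx rfl
        by_contra! hc
        rcases lt_or_gt_of_ne hp with hlt | hlt
        · exact h.ne_zero h₃ (h.eq_zero_of_smul_eq (-p) 1 0 hx hx (by omega) le_rfl
            (by omega) (by ext <;> simp))
        · exact h.ne_zero h₁ (h.eq_zero_of_smul_eq p 1 0 hx hx (by omega) le_rfl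
            (by omega) (by ext <;> simp))
      omega
    · rintro (⟨rfl, rfl⟩ | ⟨rfl, rfl⟩ | ⟨rfl, rfl⟩ | ⟨rfl, rfl⟩) <;> assumption
  have hc₁ : ¬ 3 ≤ c := fun hc => by
    have := h.eq_zero_of_smul_eq (z := (1, 0)) c 1 1 h₄ h₂ (by omega) (by omega) (by omega)
      (by ext <;> simp)
    simp at this
  have hc₂ : ¬ c ≤ -3 := fun hc => by
    have := h.eq_zero_of_smul_eq (z := (-1, 0)) (-c) 1 1 h₄ h₂ (by omega) (by omega) (by omega)
      (by ext <;> simp)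
    simp at this
  have hc₃ : c ≠ 1 := by
    rintro rfl
    exact hS _ h₄ _ h₂ (by simp [intDet]) (by simpa using h₁)
  have hc₄ : c ≠ -1 := by
    rintro rfl
    exact hS _ h₂ _ h₄ (by simp [intDet]) (by simpa using h₃)
  have hD := h.mem_right_iff_of_subset_box (B := Finset.Icc (-1) 1 ×ˢ Finset.Icc (-1) 3) (by
    rintro ⟨a, b⟩ hy
    have a₁ := hy _ h₁
    have a₂ := hy _ h₂
    have a₃ := hy _ h₃
    have a₄ := hy _ h₄
    simp only [intPairing] at a₁ a₂ a₃ a₄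
    simp only [Finset.mem_product, Finset.mem_Icc]
    obtain rfl | rfl | rfl : c = -2 ∨ c = 0 ∨ c = 2 := by omega
    all_goals omega)
  rw [hD, hSeq]
  obtain rfl | rfl | rfl : c = -2 ∨ c = 0 ∨ c = 2 := by omega
  all_goals decide

theorem card_add_card_of_simplex (h : PolarPair S D) (hS : NoUnimodularSum S)
    (h₁ : ((1, 0) : ℤ × ℤ) ∈ S) (h₂ : ((0, 1) : ℤ × ℤ) ∈ S) (h₃ : ((-1, -1) : ℤ × ℤ) ∈ S) :
    S.card + D.card = 12 := by
  have hSeq : S = {(1, 0), (0, 1), (-1, -1)} := by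
    ext ⟨p, q⟩
    simp only [Finset.mem_insert, Finset.mem_singleton, Prod.mk.injEq]
    constructor
    · intro hx
      have hne := h.ne_zero hx
      simp only [ne_eq, Prod.mk_eq_zero] at hne
      have cone {u w : ℤ × ℤ} (hu : u ∈ S) (hw : w ∈ S) (hdet : intDet u w = 1) (a b : ℤ)
          (ha : 0 < a) (hb : 0 < b) (e : (p, q) = a • u + b • w) : False := by
        refine hS u hu w hw hdet (h.sum_mem_of_pos_mem hu hw (fun h₀ => ?_) ha hb (e ▸ hx))
        have e₁ := congrArg Prod.fst h₀
        have e₂ := congrArg Prod.snd h₀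
        simp only [Prod.fst_add, Prod.snd_add, Prod.fst_zero, Prod.snd_zero] at e₁ e₂
        have : intDet u w = 0 := by
          simp only [intDet]; linear_combination w.2 * e₁ - w.1 * e₂
        omega
      have C₁ : ¬ (0 < p ∧ 0 < q) := fun hc =>
        cone h₁ h₂ (by simp [intDet]) p q hc.1 hc.2 (by ext <;> simp)
      have C₂ : ¬ (p < 0 ∧ p < q) := fun hc =>
        cone h₂ h₃ (by simp [intDet]) (q - p) (-p) (by omega) (by omega) (by ext <;> simp)
      have C₃ : ¬ (q < 0 ∧ q < p) := fun hc =>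
        cone h₃ h₁ (by simp [intDet]) (-q) (p - q) (by omega) (by omega) (by ext <;> simp)
      have ray {u : ℤ × ℤ} (hu : u ∈ S) (n : ℤ) : (p, q) = n • u → ¬ 2 ≤ n := fun e hn =>
        h.ne_zero hu (h.eq_zero_of_smul_eq n 1 0 hx hx (by omega) le_rfl (by omega) (by simp [e]))
      have C₄ : q = 0 → ¬ 2 ≤ p := fun hq => ray h₁ p (by simp [hq])
      have C₅ : p = 0 → ¬ 2 ≤ q := fun hp => ray h₂ q (by simp [hp])
      have C₆ : p = q → ¬ 2 ≤ -p := fun hp => ray h₃ (-p) (by simp [hp])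
      omega
    · rintro (⟨rfl, rfl⟩ | ⟨rfl, rfl⟩ | ⟨rfl, rfl⟩) <;> assumption
  have hD := h.mem_right_iff_of_subset_box (B := Finset.Icc (-1) 2 ×ˢ Finset.Icc (-1) 2) (by
    rintro ⟨a, b⟩ hy
    have a₁ := hy _ h₁
    have a₂ := hy _ h₂
    have a₃ := hy _ h₃
    simp only [intPairing] at a₁ a₂ a₃
    simp only [Finset.mem_product, Finset.mem_Icc]
    omega)
  rw [hD, hSeq]
  decide

lemma exists_simplex (h : PolarPair S D) (hS : NoUnimodularSum S) (hne : S.Nonempty)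
    (hneg : ∀ v ∈ S, -v ∉ S) : ∃ v ∈ S, ∃ u ∈ S, intDet v u = 1 ∧ -v - u ∈ S := by
  by_contra! hc
  have step : ∀ v ∈ S, ∀ u ∈ S, intDet v u = 1 → u + (u - v) ∈ S := by
    intro v hv u hu hdet
    obtain ⟨w, hw, huw⟩ := h.exists_intDet_eq_one hu
    set b := intDet v w with hb
    have ew : w = b • u - v := by
      simp only [intDet] at *
      ext
      · simp only [hb, Prod.fst_sub, Prod.smul_fst, smul_eq_mul]
        linear_combination (-v.1) * huw - w.1 * hdet
      · simp only [hb, Prod.snd_sub, Prod.smul_snd, smul_eq_mul]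
        linear_combination (-v.2) * huw - w.2 * hdet
    have C₁ : ¬ 3 ≤ b := fun hb₃ => h.ne_zero hu <|
      h.eq_zero_of_smul_eq b 1 1 hv hw (by omega) (by omega) (by omega) (by rw [ew]; module)
    have C₂ : b ≠ 1 := fun hb₁ => hS v hv w hw hb₁ (by rw [ew, hb₁]; simpa using hu)
    have C₃ : b ≠ 0 := fun hb₀ => hneg v hv (by simpa [ew, hb₀] using hw)
    have C₄ : b ≠ -1 := fun hb₀ => hc v hv u hu hdet (by
      convert hw using 1
      rw [ew, hb₀]
      module)
    have C₅ : ¬ b ≤ -2 := fun hb₂ => hneg u hu <|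
      h.mem_of_smul_eq (-b) 1 1 hv hw (by omega) (by omega) (by omega) (by omega)
        (neg_ne_zero.2 (h.ne_zero hu)) (by rw [ew]; module)
    obtain hb₂ : b = 2 := by omega
    convert hw using 1
    rw [ew, hb₂]
    module
  obtain ⟨v, hv⟩ := hne
  obtain ⟨u, hu, hdet⟩ := h.exists_intDet_eq_one hv
  have hvu : u - v ≠ 0 := by
    rw [sub_ne_zero]
    rintro rfl
    simp [intDet, mul_comm] at hdet
  have hall : ∀ n : ℕ, v + (n : ℤ) • (u - v) ∈ S ∧ v + ((n : ℤ) + 1) • (u - v) ∈ S := by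
    intro n
    induction n with
    | zero => simpa using ⟨hv, hu⟩
    | succ n ih =>
      refine ⟨by simpa using ih.2, ?_⟩
      push_cast
      convert step _ ih.1 _ ih.2 ?_ using 1
      · module
      · simp only [intDet, Prod.fst_add, Prod.snd_add, Prod.smul_fst, Prod.smul_snd,
          Prod.fst_sub, Prod.snd_sub, smul_eq_mul] at *
        linear_combination hdet
  refine Set.infinite_of_injective_forall_mem (f := fun n : ℕ => v + (n : ℤ) • (u - v))
    (fun m n hmn => ?_) (fun n => (hall n).1) S.finite_toSet
  exact_mod_cast smul_left_injective ℤ hvu (add_left_cancel hmn)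

lemma intDet_comb {v u : ℤ × ℤ} (hvu : intDet v u = 1) (x y : ℤ × ℤ) :
    intDet (x.1 • v + x.2 • u) (y.1 • v + y.2 • u) = intDet x y := by
  simp only [intDet, Prod.fst_add, Prod.snd_add, Prod.smul_fst, Prod.smul_snd,
    smul_eq_mul] at *
  linear_combination (x.1 * y.2 - x.2 * y.1) * hvu

lemma card_add_card_of_noUnimodularSum (h : PolarPair S D) (hS : NoUnimodularSum S) :
    S.card + D.card = 12 := by
  have hne : S.Nonempty := by
    by_contra! hne
    have := h.symm.eq_zero_of_nonneg (z := (1, 0)) (by simp [hne])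
    simp at this
  have transfer {v u : ℤ × ℤ} (hvu : intDet v u = 1) {S' : Finset (ℤ × ℤ)}
      (hmem : ∀ a b : ℤ, (a, b) ∈ S' ↔ a • v + b • u ∈ S) : NoUnimodularSum S' := by
    intro x hx y hy hxy hs
    refine hS _ ((hmem _ _).1 hx) _ ((hmem _ _).1 hy) (by rw [intDet_comb hvu, hxy]) ?_
    convert (hmem _ _).1 hs using 1
    module
  by_cases hneg : ∀ v ∈ S, -v ∉ S
  · obtain ⟨v, hv, u, hu, hvu, hw⟩ := h.exists_simplex hS hne hneg
    obtain ⟨S', D', h', hcS, hcD, hmem⟩ := h.exists_change_of_basis hvu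
    rw [← hcS, ← hcD]
    refine h'.card_add_card_of_simplex (transfer hvu hmem) ?_ ?_ ?_ <;> rw [hmem]
    · simpa using hv
    · simpa using hu
    · convert hw using 1
      module
  · push Not at hneg
    obtain ⟨v, hv, hnv⟩ := hneg
    obtain ⟨u, hu, hvu⟩ := h.exists_intDet_eq_one hv
    obtain ⟨S', D', h', hcS, hcD, hmem⟩ := h.exists_change_of_basis hvu
    rw [← hcS, ← hcD]
    refine h'.card_add_card_of_antipodal (transfer hvu hmem) ?_ ?_ ?_ <;> rw [hmem]
    · simpa using hv
    · simpa using hu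
    · simpa using hnv

theorem card_add_card (h : PolarPair S D) : S.card + D.card = 12 := by
  induction hn : S.card using Nat.strong_induction_on generalizing S D with
  | _ n ih =>
  subst hn
  by_cases hS : NoUnimodularSum S
  · exact h.card_add_card_of_noUnimodularSum hS
  obtain ⟨u, hu, w, hw, hdet, hs, hs₁, hs₂⟩ := h.exists_unimodular_vertex hS
  obtain ⟨S', D', h', hcS, hcD, hmem⟩ := h.exists_change_of_basis hdet
  have h₁₂ : ((1, 1) : ℤ × ℤ) ∈ S' := by rw [hmem]; simpa using hs
  have h'' := h'.erase (by rw [hmem]; simpa using hu) (by rw [hmem]; simpa using hw) h₁₂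
    (by rw [hmem]; simpa using hs₁) (by rw [hmem]; simpa using hs₂)
  have hnot : ((-1, -1) : ℤ × ℤ) ∉ D' := fun hy => by
    have := h'.neg_one_le h₁₂ hy
    simp [intPairing] at this
  have := Finset.card_erase_add_one h₁₂
  have := Finset.card_insert_of_notMem hnot
  have := ih _ (by omega) h'' rfl
  omega

end PolarPair

/-- The point of `ℝ²` with the given integer coordinates. -/
def intVec (p : ℤ × ℤ) : Fin 2 → ℝ := ![(p.1 : ℝ), (p.2 : ℝ)]

lemma intVec_injective : Function.Injective intVec := by
  intro p q hpq
  have h₀ := congrFun hpq 0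
  have h₁ := congrFun hpq 1
  simp only [intVec, Matrix.cons_val_zero, Matrix.cons_val_one, Int.cast_inj] at h₀ h₁
  exact Prod.ext h₀ h₁

lemma intVec_eq_zero {p : ℤ × ℤ} : intVec p = 0 ↔ p = 0 :=
  intVec_injective.eq_iff' (by ext i; fin_cases i <;> simp [intVec])

lemma isLatticePoint_iff_exists_intVec {x : Fin 2 → ℝ} :
    IsLatticePoint x ↔ ∃ p, intVec p = x := by
  constructor
  · intro hx
    obtain ⟨a, ha⟩ := hx 0
    obtain ⟨b, hb⟩ := hx 1
    refine ⟨(a, b), ?_⟩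
    ext i
    fin_cases i <;> simp [intVec, ha, hb]
  · rintro ⟨p, rfl⟩ i
    fin_cases i
    · exact ⟨p.1, by simp [intVec]⟩
    · exact ⟨p.2, by simp [intVec]⟩

lemma dotp_intVec (p q : ℤ × ℤ) : dotp (intVec p) (intVec q) = (intPairing p q : ℝ) := by
  simp [dotp, intVec, intPairing, Fin.sum_univ_two]

section dotp

variable {n : ℕ}

lemma dotp_comm (x y : Fin n → ℝ) : dotp x y = dotp y x := by
  simp only [dotp, mul_comm]

lemma dotp_add_right (x y z : Fin n → ℝ) : dotp x (y + z) = dotp x y + dotp x z := by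
  simp only [dotp, Pi.add_apply, mul_add, Finset.sum_add_distrib]

lemma dotp_smul_right (x y : Fin n → ℝ) (c : ℝ) : dotp x (c • y) = c * dotp x y := by
  simp only [dotp, Pi.smul_apply, smul_eq_mul, Finset.mul_sum]
  exact Finset.sum_congr rfl fun i _ => by ring

lemma dotp_add_left (x y z : Fin n → ℝ) : dotp (x + y) z = dotp x z + dotp y z := by
  simp only [dotp_comm _ z, dotp_add_right]

lemma dotp_smul_left (x y : Fin n → ℝ) (c : ℝ) : dotp (c • x) y = c * dotp x y := by
  simp only [dotp_comm _ y, dotp_smul_right]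

lemma dotp_zero_left (y : Fin n → ℝ) : dotp 0 y = 0 := by
  simp [dotp]

lemma continuous_dotp_left (y : Fin n → ℝ) : Continuous fun x => dotp x y := by
  unfold dotp
  fun_prop

lemma continuous_dotp_right (x : Fin n → ℝ) : Continuous fun y => dotp x y := by
  unfold dotp
  fun_prop

lemma convex_setOf_le_dotp (y : Fin n → ℝ) (c : ℝ) : Convex ℝ {x | c ≤ dotp x y} :=
  convex_halfSpace_ge ⟨fun _ _ => dotp_add_left _ _ _, fun _ _ => dotp_smul_left _ _ _⟩ c

lemma forall_mem_convexHull_le_dotp {V : Set (Fin n → ℝ)} {y : Fin n → ℝ} {c : ℝ}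
    (h : ∀ v ∈ V, c ≤ dotp v y) : ∀ x ∈ convexHull ℝ V, c ≤ dotp x y :=
  fun _ hx => convexHull_min (t := {x | c ≤ dotp x y}) h (convex_setOf_le_dotp y c) hx

/-- A vector having nonnegative products with a neighbourhood of `0` vanishes. -/
lemma eq_zero_of_forall_dotp_nonneg {K : Set (Fin n → ℝ)} (hK : (0 : Fin n → ℝ) ∈ interior K)
    {z : Fin n → ℝ} (hz : ∀ x ∈ K, 0 ≤ dotp x z) : z = 0 := by
  have hlim : Filter.Tendsto (fun t : ℝ => t • z) (nhds 0) (nhds 0) := by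
    have : Continuous fun t : ℝ => t • z := by fun_prop
    simpa using this.tendsto 0
  have hev : ∀ᶠ t : ℝ in nhdsWithin 0 (Set.Iio 0), t • z ∈ K :=
    (hlim.eventually (mem_interior_iff_mem_nhds.1 hK)).filter_mono nhdsWithin_le_nhds
  obtain ⟨t, htK, ht⟩ := (hev.and self_mem_nhdsWithin).exists
  have h₁ := hz _ htK
  rw [dotp_smul_left] at h₁
  have h₂ : dotp z z ≤ 0 := by
    have ht : t < 0 := ht
    by_contra! hpos
    nlinarith
  have h₃ : dotp z z = 0 := le_antisymm h₂ (Finset.sum_nonneg fun i _ => mul_self_nonneg _)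
  rw [dotp, Finset.sum_eq_zero_iff_of_nonneg fun i _ => mul_self_nonneg _] at h₃
  ext i
  simpa using h₃ i (Finset.mem_univ i)

/-- A lower bound `-1` on a linear functional over a set is strict at interior points. -/
lemma neg_one_lt_dotp_of_mem_interior {K : Set (Fin n → ℝ)} {x y : Fin n → ℝ}
    (hx : x ∈ interior K) (hy : ∀ z ∈ K, -1 ≤ dotp z y) : -1 < dotp x y := by
  have hlim : Filter.Tendsto (fun t : ℝ => (1 + t) • x) (nhds 0) (nhds x) := by
    have : Continuous fun t : ℝ => (1 + t) • x := by fun_prop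
    simpa using this.tendsto 0
  have hev : ∀ᶠ t : ℝ in nhdsWithin 0 (Set.Ioi 0), (1 + t) • x ∈ K :=
    (hlim.eventually (mem_interior_iff_mem_nhds.1 hx)).filter_mono nhdsWithin_le_nhds
  obtain ⟨t, htK, ht⟩ := (hev.and self_mem_nhdsWithin).exists
  have h₁ := hy _ htK
  rw [dotp_smul_left] at h₁
  have ht : 0 < t := ht
  by_contra! hle
  nlinarith

lemma dualSet_eq_iInter (K : Set (Fin n → ℝ)) : dualSet K = ⋂ x ∈ K, {y | -1 ≤ dotp x y} := by
  ext y
  simp [dualSet]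

lemma isClosed_dualSet (K : Set (Fin n → ℝ)) : IsClosed (dualSet K) := by
  rw [dualSet_eq_iInter]
  exact isClosed_biInter fun x _ => isClosed_le continuous_const (continuous_dotp_right x)

lemma convex_dualSet (K : Set (Fin n → ℝ)) : Convex ℝ (dualSet K) := by
  rw [dualSet_eq_iInter]
  refine convex_iInter₂ fun x _ => ?_
  simpa only [dotp_comm x] using convex_setOf_le_dotp x (-1)

lemma mem_dualSet_convexHull {V : Set (Fin n → ℝ)} {y : Fin n → ℝ} :
    y ∈ dualSet (convexHull ℝ V) ↔ ∀ v ∈ V, -1 ≤ dotp v y :=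
  ⟨fun h v hv => h v (subset_convexHull ℝ V hv), forall_mem_convexHull_le_dotp⟩

lemma isBounded_dualSet {K : Set (Fin n → ℝ)} (hK : (0 : Fin n → ℝ) ∈ interior K) :
    Bornology.IsBounded (dualSet K) := by
  obtain ⟨ε, hε, hball⟩ := Metric.isOpen_iff.1 isOpen_interior 0 hK
  refine Metric.isBounded_iff_subset_closedBall 0 |>.2 ⟨2 / ε, fun y hy => ?_⟩
  rw [mem_closedBall_zero_iff, pi_norm_le_iff_of_nonneg (by positivity)]
  intro i
  have key (s : ℝ) (hs : |s| < ε) : -1 ≤ s * y i := by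
    have := hy (Pi.single i s) (interior_subset (hball (by simpa [Pi.norm_single] using hs)))
    simpa [dotp, Pi.single_apply] using this
  have h₁ := key (ε / 2) (by rw [abs_of_pos] <;> linarith)
  have h₂ := key (-(ε / 2)) (by rw [abs_neg, abs_of_pos] <;> linarith)
  rw [Real.norm_eq_abs, abs_le]
  constructor
  · rw [← neg_div, div_le_iff₀ hε]; linarith
  · rw [le_div_iff₀ hε]; linarith

lemma zero_mem_interior_dualSet {K : Set (Fin n → ℝ)} (hK : Bornology.IsBounded K) :
    (0 : Fin n → ℝ) ∈ interior (dualSet K) := by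
  obtain ⟨r, hr⟩ := hK.subset_closedBall 0
  have hr' : 0 < |r| + 1 := by positivity
  rw [mem_interior_iff_mem_nhds, Metric.mem_nhds_iff]
  refine ⟨1 / ((n + 1) * (|r| + 1)), by positivity, fun y hy x hx => ?_⟩
  rw [mem_ball_zero_iff] at hy
  have hx := mem_closedBall_zero_iff.1 (hr hx)
  have hbd : |dotp x y| ≤ n * ((|r| + 1) * (1 / ((n + 1) * (|r| + 1)))) := by
    refine (Finset.abs_sum_le_sum_abs _ _).trans ?_
    have : ∀ i ∈ Finset.univ, |x i * y i| ≤ (|r| + 1) * (1 / ((n + 1) * (|r| + 1))) := by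
      intro i _
      rw [abs_mul]
      have h₁ : |x i| ≤ |r| + 1 :=
        (norm_le_pi_norm x i).trans (hx.trans ((le_abs_self r).trans (by linarith)))
      have h₂ : |y i| ≤ 1 / ((n + 1) * (|r| + 1)) := (norm_le_pi_norm y i).trans hy.le
      gcongr
    simpa using Finset.sum_le_card_nsmul _ _ _ this
  have hle : (n : ℝ) * ((|r| + 1) * (1 / ((n + 1) * (|r| + 1)))) ≤ 1 := by
    have : (n : ℝ) * ((|r| + 1) * (1 / ((n + 1) * (|r| + 1)))) = n / (n + 1) := by
      field_simp
    rw [this, div_le_one (by positivity)]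
    linarith
  linarith [neg_abs_le (dotp x y)]

/-- The bipolar theorem for closed convex sets containing the origin. -/
lemma exists_mem_dualSet_of_not_mem {K : Set (Fin n → ℝ)} (hc : Convex ℝ K) (hcl : IsClosed K)
    (h₀ : (0 : Fin n → ℝ) ∈ K) {x : Fin n → ℝ} (hx : x ∉ K) :
    ∃ y ∈ dualSet K, dotp x y < -1 := by
  obtain ⟨f, c, hfx, hfK⟩ := geometric_hahn_banach_point_closed hc hcl hx
  have hc₀ : c < 0 := by simpa using hfK 0 h₀
  have hf (z : Fin n → ℝ) : f z = dotp z fun i => f (Pi.single i 1) := by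
    conv_lhs => rw [pi_eq_sum_univ' z]
    simp [dotp, map_sum]
  refine ⟨(-c)⁻¹ • fun i => f (Pi.single i 1), fun z hz => ?_, ?_⟩
  · rw [dotp_smul_right, ← hf, inv_mul_eq_div, le_div_iff₀ (by linarith)]
    linarith [hfK z hz]
  · rw [dotp_smul_right, ← hf, inv_mul_eq_div, div_lt_iff₀ (by linarith)]
    linarith

end dotp

/-- The extreme points of the dual of a reflexive polygon are lattice points. -/
lemma isLatticePoint_of_mem_extremePoints_dualSet {Δ : Set (Fin 2 → ℝ)} (h : IsReflexive Δ)
    {y : Fin 2 → ℝ} (hy : y ∈ Set.extremePoints ℝ (dualSet Δ)) : IsLatticePoint y := by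
  obtain ⟨⟨V, hV, -, rfl⟩, -, hface⟩ := h
  obtain ⟨v, hv, w, hw, hvy, hwy, hvw⟩ : ∃ v ∈ V, ∃ w ∈ V, dotp v y = -1 ∧ dotp w y = -1 ∧
      v 0 * w 1 - v 1 * w 0 ≠ 0 := by
    by_contra! hc
    obtain ⟨d, hd₀, hd⟩ : ∃ d : Fin 2 → ℝ, d ≠ 0 ∧ ∀ v ∈ V, dotp v y = -1 → dotp v d = 0 := by
      by_cases hT : ∃ v ∈ V, dotp v y = -1
      · obtain ⟨v, hv, hvy⟩ := hT
        refine ⟨![-v 1, v 0], fun h₀ => ?_, fun w hw hwy => ?_⟩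
        · have e₀ := congrFun h₀ 0
          have e₁ := congrFun h₀ 1
          simp at e₀ e₁
          simp [dotp, Fin.sum_univ_two, e₀, e₁] at hvy
        · have := hc v hv w hw hvy hwy
          simp [dotp, Fin.sum_univ_two]
          linarith
      · push Not at hT
        exact ⟨1, one_ne_zero, fun v hv hvy => absurd hvy (hT v hv)⟩
    have hev (s : ℝ) : ∀ᶠ t : ℝ in nhds 0, y + (s * t) • d ∈ dualSet (convexHull ℝ V) := by
      simp only [mem_dualSet_convexHull]
      refine (Filter.eventually_all_finite hV).2 fun v hv => ?_
      rcases eq_or_ne (dotp v y) (-1) with hvy | hvy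
      · exact .of_forall fun t => by rw [dotp_add_right, dotp_smul_right, hd v hv hvy]; linarith
      · have hlt : -1 < dotp v y :=
          lt_of_le_of_ne (mem_dualSet_convexHull.1 hy.1 v hv) hvy.symm
        have hcont : Continuous fun t : ℝ => dotp v (y + (s * t) • d) :=
          (continuous_dotp_right v).comp (by fun_prop)
        filter_upwards [(hcont.tendsto 0).eventually (lt_mem_nhds (by simpa using hlt))]
          with t ht using ht.le
    have hev' : ∀ᶠ t : ℝ in nhdsWithin 0 (Set.Ioi 0), _ :=
      ((hev 1).and (hev (-1))).filter_mono nhdsWithin_le_nhds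
    obtain ⟨t, ⟨ht₁, ht₂⟩, ht⟩ := (hev'.and self_mem_nhdsWithin).exists
    have ht : 0 < t := ht
    have hmem : y ∈ openSegment ℝ (y + (1 * t) • d) (y + (-1 * t) • d) :=
      ⟨1 / 2, 1 / 2, by norm_num, by norm_num, by norm_num, by module⟩
    have := hy.2 ht₁ ht₂ hmem
    simp [ht.ne', hd₀] at this
  set F := {x ∈ convexHull ℝ V | dotp x (-y) = 1} with hF
  have hneg (x : Fin 2 → ℝ) : dotp x (-y) = -dotp x y := by
    simpa using dotp_smul_right x y (-1)
  have hvF : v ∈ F := ⟨subset_convexHull ℝ V hv, by rw [hneg, hvy, neg_neg]⟩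
  have hwF : w ∈ F := ⟨subset_convexHull ℝ V hw, by rw [hneg, hwy, neg_neg]⟩
  have hface₁ : IsFaceOf F (convexHull ℝ V) :=
    ⟨⟨v, hvF⟩, -y, 1, fun x hx => by rw [hneg]; linarith [hy.1 x hx], rfl⟩
  have hne : v - w ≠ 0 := fun h₀ => hvw (by rw [sub_eq_zero.1 h₀]; ring)
  have hmem : v - w ∈ vectorSpan ℝ F := vsub_mem_vectorSpan ℝ hvF hwF
  let φ : (Fin 2 → ℝ) →ₗ[ℝ] ℝ :=
    { toFun x := dotp x y
      map_add' x z := dotp_add_left x z y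
      map_smul' c x := dotp_smul_left x y c }
  have hspan : vectorSpan ℝ F ≤ LinearMap.ker φ := by
    rw [vectorSpan, Submodule.span_le]
    rintro _ ⟨x, hx, z, hz, rfl⟩
    have hx₁ := hx.2
    have hz₁ := hz.2
    rw [hneg] at hx₁ hz₁
    have hx₂ : φ x = -1 := by show dotp x y = -1; linarith
    have hz₂ : φ z = -1 := by show dotp z y = -1; linarith
    simp [hx₂, hz₂]
  have hdim : faceDim F + 1 = 2 := by
    have h₁ : 0 < faceDim F :=
      Module.finrank_pos_iff_exists_ne_zero.2 ⟨⟨_, hmem⟩, by simpa using hne⟩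
    have h₂ : faceDim F < Module.finrank ℝ (Fin 2 → ℝ) := by
      refine Submodule.finrank_lt fun htop => ?_
      have : v ∈ LinearMap.ker φ := hspan (htop ▸ Submodule.mem_top)
      have : dotp v y = 0 := this
      linarith
    simp at h₂
    omega
  obtain ⟨l, hl⟩ := hface F hface₁ hdim
  have hlv : dotp v (fun i => (l i : ℝ)) = -1 := hl hvF
  have hlw : dotp w (fun i => (l i : ℝ)) = -1 := hl hwF
  simp only [dotp, Fin.sum_univ_two] at hvy hwy hlv hlw
  intro i
  refine ⟨l i, mul_left_cancel₀ hvw ?_⟩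
  fin_cases i
  · show _ * y 0 = _ * (l 0 : ℝ)
    linear_combination w 1 * (hvy - hlv) - v 1 * (hwy - hlw)
  · show _ * y 1 = _ * (l 1 : ℝ)
    linear_combination v 0 * (hwy - hlw) - w 0 * (hvy - hlv)

lemma finite_setOf_intVec_mem {K : Set (Fin 2 → ℝ)} (hK : Bornology.IsBounded K) :
    {p : ℤ × ℤ | intVec p ∈ K}.Finite := by
  obtain ⟨r, hr⟩ := hK.subset_closedBall 0
  refine (Set.finite_Icc ((-⌈r⌉, -⌈r⌉) : ℤ × ℤ) (⌈r⌉, ⌈r⌉)).subset fun p hp => ?_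
  have hp := mem_closedBall_zero_iff.1 (hr hp)
  have key (i : Fin 2) : |intVec p i| ≤ ⌈r⌉ :=
    (norm_le_pi_norm _ i).trans (hp.trans (Int.le_ceil r))
  have h₀ := abs_le.1 (key 0)
  have h₁ := abs_le.1 (key 1)
  simp only [intVec, Matrix.cons_val_zero, Matrix.cons_val_one] at h₀ h₁
  exact ⟨⟨by exact_mod_cast h₀.1, by exact_mod_cast h₁.1⟩,
    ⟨by exact_mod_cast h₀.2, by exact_mod_cast h₁.2⟩⟩

/-- If a nonzero lattice point of `K` is never interior, then the lattice points of the frontier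
are the nonzero lattice points of `K`. -/
lemma ncard_frontier_eq_card {K : Set (Fin 2 → ℝ)} (hcl : IsClosed K)
    (h₀ : (0 : Fin 2 → ℝ) ∈ interior K)
    (hint : ∀ p : ℤ × ℤ, intVec p ∈ interior K → p = 0) {S : Finset (ℤ × ℤ)}
    (hS : ∀ p, p ∈ S ↔ p ≠ 0 ∧ intVec p ∈ K) :
    Set.ncard {x ∈ frontier K | IsLatticePoint x} = S.card := by
  have : {x ∈ frontier K | IsLatticePoint x} = intVec '' S := by
    ext x
    simp only [Set.mem_ofPred_eq, isLatticePoint_iff_exists_intVec, Set.mem_image,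
      Finset.mem_coe, hS, hcl.frontier_eq, Set.mem_sdiff]
    constructor
    · rintro ⟨⟨hxK, hxi⟩, p, rfl⟩
      refine ⟨p, ⟨?_, hxK⟩, rfl⟩
      rintro rfl
      exact hxi (by rwa [intVec_eq_zero.2 rfl])
    · rintro ⟨p, ⟨hp, hpK⟩, rfl⟩
      exact ⟨⟨hpK, fun hi => hp (hint p hi)⟩, p, rfl⟩
  rw [this, Set.ncard_image_of_injective _ intVec_injective, Set.ncard_coe_finset]

/-- For a 2-dimensional reflexive polytope (reflexive polygon) `Δ` with dual
`Δ*`, the number of lattice points on the boundary of `Δ` plus the number of lattice points on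
the boundary of `Δ*` equals `12`. -/
theorem boundary_lattice_points_add_dual_boundary_lattice_points_eq_12
    (Δ : Set (Fin 2 → ℝ)) (h : IsReflexive Δ) :
    Set.ncard {x ∈ frontier Δ | IsLatticePoint x} +
      Set.ncard {y ∈ frontier (dualSet Δ) | IsLatticePoint y} = 12 := by
  have hext := fun y hy => isLatticePoint_of_mem_extremePoints_dualSet h (y := y) hy
  obtain ⟨⟨V, hV, hVint, rfl⟩, h₀, -⟩ := h
  have hcpt : IsCompact (convexHull ℝ V) := hV.isCompact_convexHull ℝ
  have hdcpt : IsCompact (dualSet (convexHull ℝ V)) :=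
    Metric.isCompact_of_isClosed_isBounded (isClosed_dualSet _) (isBounded_dualSet h₀)
  have hd₀ := zero_mem_interior_dualSet hcpt.isBounded
  -- lower bounds on a polygon or its dual may be tested on lattice points
  have hdual (x : Fin 2 → ℝ) (c : ℝ)
      (hx : ∀ q : ℤ × ℤ, intVec q ∈ dualSet (convexHull ℝ V) → c ≤ dotp x (intVec q)) :
      ∀ y ∈ dualSet (convexHull ℝ V), c ≤ dotp x y := by
    intro y hy
    rw [← closure_convexHull_extremePoints hdcpt (convex_dualSet _)] at hy
    have hcl : IsClosed {y | c ≤ dotp x y} :=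
      isClosed_le continuous_const (continuous_dotp_right x)
    refine closure_minimal (fun z hz => ?_) hcl hy
    rw [Set.mem_ofPred_eq, dotp_comm]
    refine forall_mem_convexHull_le_dotp (fun v hv => ?_) z hz
    obtain ⟨q, rfl⟩ := isLatticePoint_iff_exists_intVec.1 (hext v hv)
    rw [dotp_comm]
    exact hx q hv.1
  have hprim (y : Fin 2 → ℝ) (c : ℝ)
      (hy : ∀ p : ℤ × ℤ, intVec p ∈ convexHull ℝ V → c ≤ dotp (intVec p) y) :
      ∀ x ∈ convexHull ℝ V, c ≤ dotp x y := by
    refine forall_mem_convexHull_le_dotp fun v hv => ?_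
    obtain ⟨p, rfl⟩ := isLatticePoint_iff_exists_intVec.1 (hVint v hv)
    exact hy p (subset_convexHull ℝ V hv)
  have int_nonneg {p q : ℤ × ℤ} (hpq : -1 < dotp (intVec p) (intVec q)) :
      0 ≤ dotp (intVec p) (intVec q) := by
    rw [dotp_intVec] at hpq ⊢
    have : -1 < intPairing p q := by exact_mod_cast hpq
    exact_mod_cast (by omega : 0 ≤ intPairing p q)
  have hfin₁ : {p | p ≠ 0 ∧ intVec p ∈ convexHull ℝ V}.Finite :=
    (finite_setOf_intVec_mem hcpt.isBounded).subset fun p hp => hp.2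
  have hfin₂ : {p | p ≠ 0 ∧ intVec p ∈ dualSet (convexHull ℝ V)}.Finite :=
    (finite_setOf_intVec_mem hdcpt.isBounded).subset fun p hp => hp.2
  have hS (p) : p ∈ hfin₁.toFinset ↔ p ≠ 0 ∧ intVec p ∈ convexHull ℝ V := by simp
  have hD (p) : p ∈ hfin₂.toFinset ↔ p ≠ 0 ∧ intVec p ∈ dualSet (convexHull ℝ V) := by simp
  have cast_iff (p q : ℤ × ℤ) : -1 ≤ intPairing p q ↔ -1 ≤ dotp (intVec p) (intVec q) := by
    rw [dotp_intVec]
    exact_mod_cast Iff.rfl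
  have hpair : PolarPair hfin₁.toFinset hfin₂.toFinset := by
    refine ⟨fun p => ?_, fun q => ?_⟩
    · simp only [hS, hD, cast_iff]
      refine and_congr_right fun hp => ⟨fun hpK q hq => hq.2 _ hpK, fun hq => ?_⟩
      by_contra hpK
      obtain ⟨y, hy, hlt⟩ := exists_mem_dualSet_of_not_mem (convex_convexHull ℝ V)
        hcpt.isClosed (interior_subset h₀) hpK
      refine hlt.not_ge (hdual _ _ (fun q hqD => ?_) y hy)
      rcases eq_or_ne q 0 with rfl | hq₀
      · rw [dotp_intVec]
        simp [intPairing]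
      · exact hq q ⟨hq₀, hqD⟩
    · simp only [hS, hD, cast_iff]
      refine and_congr_right fun hq₀ => ⟨fun hq p hp => hq _ hp.2, fun hq => ?_⟩
      refine hprim _ _ fun p hp => ?_
      rcases eq_or_ne p 0 with rfl | hp₀
      · rw [dotp_intVec]
        simp [intPairing]
      · exact hq p ⟨hp₀, hp⟩
  rw [ncard_frontier_eq_card hcpt.isClosed h₀ (fun p hp => ?_) hS,
    ncard_frontier_eq_card hdcpt.isClosed hd₀ (fun q hq => ?_) hD]
  · exact hpair.card_add_card
  · refine intVec_eq_zero.1 (eq_zero_of_forall_dotp_nonneg h₀ (hprim _ _ fun p hp => ?_))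
    rw [dotp_comm]
    refine int_nonneg (neg_one_lt_dotp_of_mem_interior hq fun z hz => ?_)
    rw [dotp_comm]
    exact hz _ hp
  · refine intVec_eq_zero.1 (eq_zero_of_forall_dotp_nonneg hd₀ fun y hy => ?_)
    rw [dotp_comm]
    refine hdual _ _ (fun q hq => ?_) y hy
    exact int_nonneg (neg_one_lt_dotp_of_mem_interior hp hq)
end
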